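/- Let p be a prime, F a finite field of characteristic p, and n ≥ 2 with (n,|F|) ∉ {(2,2),(2,3)}. Let H be a finite group such that L = [H,H] is quasi-simple, Z(L) = Z(H), and L/Z(L) is isomorphic to PSL_n(F), the quotient of SL_n(F) by its center. Let χ be a faithful irreducible complex character of H and h ∈ H with χ(h) ≠ 0 and H = ⟨L, h⟩. Then the p-part of the order of hZ(H) in H/Z(H) divides the p-part of |H : Z(H)|/χ(1); equivalently, o(hZ(H))_p · χ(1)_p divides |H : Z(H)|_p. -/

import Mathlib

/-- A group `L` is quasi-simple if it is perfect and `L/Z(L)` is simple. -/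
def IsQuasisimple (L : Type*) [Group L] : Prop :=
  commutator L = ⊤ ∧ IsSimpleGroup (L ⧸ Subgroup.center L)

namespace PX

open CategoryTheory in
theorem aux_schur (H : Type) [Group H] (V : FDRep ℂ H) (hV : Simple V)
    (A : V →ₗ[ℂ] V) (hA : ∀ g, V.ρ g ∘ₗ A = A ∘ₗ V.ρ g) : ∃ c : ℂ, A = c • LinearMap.id := by
  let f : (forget₂ (FDRep ℂ H) (Rep ℂ H)).obj V ⟶ (forget₂ (FDRep ℂ H) (Rep ℂ H)).obj V :=
    Rep.ofHom ⟨A, fun g => (hA g).symm⟩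
  have h1 := finrank_endomorphism_simple_eq_one ℂ V
  obtain ⟨c, hc⟩ := (finrank_eq_one_iff_of_nonzero' (𝟙 V) (id_nonzero V)).1 h1
    (FDRep.forget₂HomLinearEquiv V V f)
  refine ⟨c, ?_⟩
  have h2 : f = c • 𝟙 _ := by
    apply (FDRep.forget₂HomLinearEquiv V V).injective
    rw [map_smul, ← hc]
    rfl
  have : f.hom.toLinearMap = (c • 𝟙 ((forget₂ (FDRep ℂ H) (Rep ℂ H)).obj V) : _ ⟶ _).hom.toLinearMap := by rw [h2]
  exact this

theorem aux_matrix (H : Type) [Group H] (V : FDRep ℂ H) (hV : CategoryTheory.Simple V)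
    (hfaith : Function.Injective V.ρ) :
    ∃ ρ : H →* Matrix (Fin (Module.finrank ℂ V)) (Fin (Module.finrank ℂ V)) ℂ,
      Function.Injective ρ ∧ (∀ g, (ρ g).trace = V.character g) ∧
      ∀ A, (∀ g, ρ g * A = A * ρ g) → ∃ c : ℂ, A = c • 1 := by
  let b := Module.finBasis ℂ V
  let e := LinearMap.toMatrixAlgEquiv b
  refine ⟨(e : _ →* _).comp V.ρ, ?_, ?_, ?_⟩
  · exact e.injective.comp hfaith
  · intro g
    exact (LinearMap.trace_eq_matrix_trace ℂ b (V.ρ g)).symm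
  · intro A hA
    obtain ⟨A, rfl⟩ := e.surjective A
    obtain ⟨c, rfl⟩ := aux_schur H V hV A (fun g => by
      change V.ρ g * A = A * V.ρ g
      apply e.injective
      rw [map_mul, map_mul]
      exact hA g)
    exact ⟨c, by rw [map_smul]; congr 1; exact map_one e⟩
end PX

namespace PX
section A1
open Matrix

variable {G : Type*} [Group G] {d : ℕ} 

theorem rho_inv_mul (ρ : G →* Matrix (Fin d) (Fin d) ℂ) (g : G) : ρ g⁻¹ * ρ g = 1 := by
  rw [← map_mul]; simp
theorem rho_mul_inv (ρ : G →* Matrix (Fin d) (Fin d) ℂ) (g : G) : ρ g * ρ g⁻¹ = 1 := by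
  rw [← map_mul]; simp

theorem avg_scalar [Fintype G] (hd : d ≠ 0) (ρ : G →* Matrix (Fin d) (Fin d) ℂ)
    (hs : ∀ A, (∀ g, ρ g * A = A * ρ g) → ∃ c : ℂ, A = c • 1) (T : Matrix (Fin d) (Fin d) ℂ) :
    ∑ g, ρ g * T * ρ g⁻¹ = ((Fintype.card G : ℂ) * T.trace / d) • 1 := by
  obtain ⟨c, hc⟩ := hs (∑ g, ρ g * T * ρ g⁻¹) (by
    intro x
    rw [Finset.mul_sum, Finset.sum_mul]
    refine Fintype.sum_equiv (Equiv.mulLeft x) _ _ (fun g => ?_)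
    simp only [Equiv.coe_mulLeft, map_mul, _root_.mul_inv_rev, mul_assoc]
    rw [rho_inv_mul, mul_one])
  have h1 : (∑ g, ρ g * T * ρ g⁻¹).trace = (Fintype.card G : ℂ) * T.trace := by
    rw [trace_sum]
    rw [Finset.sum_congr rfl (fun g _ => by
      rw [Matrix.trace_mul_comm, ← mul_assoc, rho_inv_mul, one_mul])]
    simp
  rw [hc]
  congr 1
  rw [hc] at h1
  simp only [trace_smul, trace_one, Fintype.card_fin, smul_eq_mul] at h1
  rw [← h1]
  have : (d : ℂ) ≠ 0 := by exact_mod_cast hd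
  field_simp

theorem semi_inv [Fintype G] (hd : d ≠ 0) (ρ : G →* Matrix (Fin d) (Fin d) ℂ)
    (hs : ∀ A, (∀ g, ρ g * A = A * ρ g) → ∃ c : ℂ, A = c • 1) (A : Matrix (Fin d) (Fin d) ℂ)
    (hA0 : A ≠ 0) (hA : ∀ g, ∃ μ : ℂ, ρ g * A = μ • (A * ρ g)) : ∃ B, A * B = 1 := by
  choose μ hμ using hA
  obtain ⟨i, j, hij⟩ : ∃ i j, A i j ≠ 0 := by
    by_contra hcon
    push Not at hcon
    exact hA0 (by ext i j; simpa using hcon i j)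
  let T : Matrix (Fin d) (Fin d) ℂ := Matrix.single j i 1
  have hT : (A * T).trace = A i j := by
    simp [T, Matrix.trace_mul_single]
  have key := avg_scalar hd ρ hs (A * T)
  have hcard : (Fintype.card G : ℂ) ≠ 0 := by exact_mod_cast Fintype.card_ne_zero
  have hd' : (d : ℂ) ≠ 0 := by exact_mod_cast hd
  set c : ℂ := (Fintype.card G : ℂ) * (A * T).trace / d
  have hc : c ≠ 0 := by
    simp only [c, hT]
    exact div_ne_zero (mul_ne_zero hcard hij) hd'
  refine ⟨c⁻¹ • ∑ g, μ g • (ρ g * T * ρ g⁻¹), ?_⟩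
  have : A * ∑ g, μ g • (ρ g * T * ρ g⁻¹) = c • 1 := by
    rw [← key, Finset.mul_sum]
    refine Finset.sum_congr rfl (fun g _ => ?_)
    rw [← mul_assoc (ρ g) A T, hμ g]
    simp [mul_assoc]
  rw [mul_smul_comm, this, smul_smul, inv_mul_cancel₀ hc, one_smul]

theorem comm_scalar [Fintype G] (hd : d ≠ 0) (ρ : G →* Matrix (Fin d) (Fin d) ℂ)
    (hs : ∀ A, (∀ g, ρ g * A = A * ρ g) → ∃ c : ℂ, A = c • 1)
    (L : Subgroup G) [L.Normal] (h : G) (hgen : L ⊔ Subgroup.zpowers h = ⊤)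
    (hne : (ρ h).trace ≠ 0) (A : Matrix (Fin d) (Fin d) ℂ)
    (hA : ∀ l ∈ L, ρ l * A = A * ρ l) : ∃ c : ℂ, A = c • 1 := by
  -- commuting up to scalars
  have step (B : Matrix (Fin d) (Fin d) ℂ) (hB : ∀ l ∈ L, ρ l * B = B * ρ l) (μ : ℂ) (hμ0 : μ ≠ 0)
      (hμ : ρ h * B = μ • (B * ρ h)) : ∀ g, ∃ ν : ℂ, ν ≠ 0 ∧ ρ g * B = ν • (B * ρ g) := by
    let K : Subgroup G :=
      { carrier := {g | ∃ ν : ℂ, ν ≠ 0 ∧ ρ g * B = ν • (B * ρ g)}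
        one_mem' := ⟨1, one_ne_zero, by simp⟩
        mul_mem' := by
          rintro a b ⟨ν, h0, h1⟩ ⟨ν', h0', h1'⟩
          refine ⟨ν * ν', mul_ne_zero h0 h0', ?_⟩
          rw [map_mul, mul_assoc, h1', mul_smul_comm, ← mul_assoc, h1, smul_mul_assoc, smul_smul,
            mul_comm ν', mul_assoc B]
        inv_mem' := by
          rintro a ⟨ν, h0, h1⟩
          refine ⟨ν⁻¹, inv_ne_zero h0, ?_⟩
          have h2 : ρ a⁻¹ * (ρ a * B) * ρ a⁻¹ = ν • (ρ a⁻¹ * B) := by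
            rw [h1]; simp only [mul_smul_comm, smul_mul_assoc, mul_assoc, rho_mul_inv, mul_one]
          rw [← mul_assoc, rho_inv_mul, one_mul] at h2
          rw [h2, smul_smul, inv_mul_cancel₀ h0, one_smul] }
    have hK : K = ⊤ := by
      rw [← top_le_iff, ← hgen, sup_le_iff]
      refine ⟨fun l hl => ⟨1, one_ne_zero, by simpa using hB l hl⟩, ?_⟩
      rw [Subgroup.zpowers_le]
      exact ⟨μ, hμ0, hμ⟩
    intro g
    have : g ∈ K := hK ▸ Subgroup.mem_top g
    exact this
  -- eigencomponents
  have hneH : Nonempty G := ⟨h⟩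
  let o := orderOf h
  have ho : 0 < o := orderOf_pos h
  have : NeZero o := ⟨ho.ne'⟩
  let ζ : ℂ := Complex.exp (2 * Real.pi * Complex.I / o)
  have hζ : IsPrimitiveRoot ζ o := Complex.isPrimitiveRoot_exp o ho.ne'
  have hζ0 : ζ ≠ 0 := hζ.ne_zero ho.ne'
  let t : ℕ → Matrix (Fin d) (Fin d) ℂ := fun i => ρ (h ^ i) * A * ρ (h ^ i)⁻¹
  have ht : ∀ i, ρ h * t i = t (i + 1) * ρ h := by
    intro i
    simp only [t, pow_succ', _root_.mul_inv_rev, map_mul, mul_assoc, rho_inv_mul, mul_one]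
  have ht0 : t o = t 0 := by simp only [t, o, pow_orderOf_eq_one, pow_zero]
  have htL : ∀ i, ∀ l ∈ L, ρ l * t i = t i * ρ l := by
    intro i l hl
    have h1 := hA ((h ^ i)⁻¹ * l * (h ^ i)) (by
      have := Subgroup.Normal.conj_mem ‹L.Normal› l hl (h ^ i)⁻¹
      simpa using this)
    have h2 : ρ (h ^ i) * (ρ ((h ^ i)⁻¹ * l * (h ^ i)) * A) * ρ (h ^ i)⁻¹ = 
      ρ (h ^ i) * (A * ρ ((h ^ i)⁻¹ * l * (h ^ i))) * ρ (h ^ i)⁻¹ := by rw [h1]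
    have e1 : ρ (h ^ i) * (ρ ((h ^ i)⁻¹ * l * (h ^ i)) * A) * ρ (h ^ i)⁻¹ = ρ l * t i := by
      simp only [t, ← mul_assoc, ← map_mul]; simp
    have e2 : ρ (h ^ i) * (A * ρ ((h ^ i)⁻¹ * l * (h ^ i))) * ρ (h ^ i)⁻¹ = t i * ρ l := by
      simp only [t, mul_assoc, ← map_mul]; simp
    rw [← e1, h2, e2]
  let B : ℕ → Matrix (Fin d) (Fin d) ℂ := fun k => ∑ i ∈ Finset.range o, (ζ ^ (k * i)) • t i
  have hBL : ∀ k, ∀ l ∈ L, ρ l * B k = B k * ρ l := by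
    intro k l hl
    simp only [B, Finset.mul_sum, Finset.sum_mul]
    refine Finset.sum_congr rfl (fun i _ => ?_)
    rw [mul_smul_comm, smul_mul_assoc, htL i l hl]
  have hBh : ∀ k, ζ ^ k • (ρ h * B k) = B k * ρ h := by
    intro k
    have h1 : ζ ^ k • (ρ h * B k) = (∑ i ∈ Finset.range o, (ζ ^ (k * (i + 1))) • t (i + 1)) * ρ h := by
      simp only [B, Finset.mul_sum, Finset.sum_mul, Finset.smul_sum]
      refine Finset.sum_congr rfl (fun i _ => ?_)
      rw [mul_smul_comm, ht, smul_mul_assoc, smul_smul, ← pow_add, mul_add, mul_one, add_comm]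
    rw [h1]
    congr 1
    have h2 := Finset.sum_range_succ (fun i => (ζ ^ (k * i)) • t i) o
    have h3 := Finset.sum_range_succ' (fun i => (ζ ^ (k * i)) • t i) o
    have h4 : (ζ ^ (k * o)) • t o = (ζ ^ (k * 0)) • t 0 := by
      rw [ht0, mul_comm k, pow_mul, hζ.pow_eq_one]; simp
    rw [h2, h4] at h3
    exact (add_right_cancel h3).symm
  have hBh' : ∀ k, ρ h * B k = (ζ ^ k)⁻¹ • (B k * ρ h) := by
    intro k
    rw [← hBh k, smul_smul, inv_mul_cancel₀ (pow_ne_zero _ hζ0), one_smul]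
  have hB0 : ∀ k ∈ Finset.range o, k ≠ 0 → B k = 0 := by
    intro k hk hk0
    by_contra hB
    obtain ⟨C, hC⟩ := semi_inv hd ρ hs (B k) hB (fun g => by
      obtain ⟨ν, -, hν⟩ := step (B k) (hBL k) (ζ ^ k)⁻¹ (inv_ne_zero (pow_ne_zero _ hζ0)) (hBh' k) g
      exact ⟨ν, hν⟩)
    have hC' : C * B k = 1 := mul_eq_one_comm.1 hC
    have h1 : ζ ^ k * (ρ h).trace = (ρ h).trace := by
      have : ζ ^ k • (ρ h * B k) * C = B k * ρ h * C := by rw [hBh k]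
      have h2 := congrArg Matrix.trace this
      rw [smul_mul_assoc, mul_assoc, hC, mul_one, trace_smul, Matrix.trace_mul_comm, ← mul_assoc, hC',
        one_mul] at h2
      exact h2
    have h2 : ζ ^ k = 1 := by
      have := mul_right_cancel₀ hne (h1.trans (one_mul _).symm)
      exact this
    have := hζ.pow_ne_one_of_pos_of_lt hk0 (Finset.mem_range.1 hk)
    exact this h2
  have hsum : ∑ k ∈ Finset.range o, B k = (o : ℂ) • A := by
    simp only [B]
    rw [Finset.sum_comm]
    rw [Finset.sum_eq_single_of_mem 0 (Finset.mem_range.2 ho)]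
    · simp only [t, mul_zero, pow_zero, one_smul, inv_one, map_one, mul_one, one_mul,
        Finset.sum_const, Finset.card_range]
      exact (Nat.cast_smul_eq_nsmul ℂ o A).symm
    · intro i hi hi0
      rw [← Finset.sum_smul]
      have : ∑ k ∈ Finset.range o, ζ ^ (k * i) = 0 := by
        have hne1 : ζ ^ i ≠ 1 := hζ.pow_ne_one_of_pos_of_lt hi0 (Finset.mem_range.1 hi)
        have := geom_sum_eq hne1 o
        rw [← pow_mul, mul_comm i o, pow_mul, hζ.pow_eq_one, one_pow, sub_self, zero_div] at this
        rw [← this]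
        exact Finset.sum_congr rfl (fun k _ => by rw [← pow_mul, mul_comm])
      rw [this, zero_smul]
  have hB0' : B 0 = (o : ℂ) • A := by
    rw [← hsum]
    exact (Finset.sum_eq_single_of_mem 0 (Finset.mem_range.2 ho) (fun k hk hk0 => hB0 k hk hk0)).symm
  have hoC : (o : ℂ) ≠ 0 := by exact_mod_cast ho.ne'
  obtain ⟨c, hc⟩ := hs (B 0) (by
    let K : Subgroup G :=
      { carrier := {g | ρ g * B 0 = B 0 * ρ g}
        one_mem' := by simp
        mul_mem' := by
          intro a b h1 h2
          simp only [Set.mem_ofPred_eq] at *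
          rw [map_mul, mul_assoc, h2, ← mul_assoc, h1, mul_assoc]
        inv_mem' := by
          intro a h1
          simp only [Set.mem_ofPred_eq] at *
          calc ρ a⁻¹ * B 0 = ρ a⁻¹ * (B 0 * ρ a) * ρ a⁻¹ := by
                rw [mul_assoc, mul_assoc, rho_mul_inv, mul_one]
            _ = _ := by rw [← h1, ← mul_assoc, rho_inv_mul, one_mul] }
    have hK : K = ⊤ := by
      rw [← top_le_iff, ← hgen, sup_le_iff, Subgroup.zpowers_le]
      refine ⟨fun l hl => hBL 0 l hl, ?_⟩
      have : ρ h * B 0 = B 0 * ρ h := by simpa using hBh' 0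
      exact this
    intro g
    have : g ∈ K := hK ▸ Subgroup.mem_top g
    exact this)
  refine ⟨(o : ℂ)⁻¹ * c, ?_⟩
  rw [mul_smul, ← hc, hB0', smul_smul, inv_mul_cancel₀ hoC, one_smul]

/-- Fourier-type identity -/
theorem fourier [Fintype G] (hd : d ≠ 0) (ρ : G →* Matrix (Fin d) (Fin d) ℂ)
    (hs : ∀ A, (∀ g, ρ g * A = A * ρ g) → ∃ c : ℂ, A = c • 1) (X : Matrix (Fin d) (Fin d) ℂ) :
    ∑ g, (X * ρ g).trace • ρ g⁻¹ = ((Fintype.card G : ℂ) / d) • X := by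
  ext i j
  have h1 : ∀ a b, ∑ g, ρ g a b * ρ g⁻¹ i j = if b = i ∧ a = j then (Fintype.card G : ℂ) / d else 0 := by
    intro a b
    have := avg_scalar hd ρ hs (Matrix.single b i 1)
    have h2 := congrFun (congrFun this a) j
    rw [Matrix.sum_apply] at h2
    rw [Finset.sum_congr rfl (fun g _ => ?_)]
    · rw [h2]
      rw [Matrix.smul_apply, Matrix.one_apply, smul_eq_mul]
      by_cases hbi : b = i <;> by_cases haj : a = j <;> simp [hbi, haj, Matrix.trace_single_eq_same, Matrix.trace_single_eq_of_ne]
    · simp [Matrix.mul_apply, Matrix.single_apply, Finset.sum_mul, Finset.mul_sum, ite_and]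
  rw [Matrix.sum_apply]
  simp only [Matrix.trace, Matrix.diag_apply, Matrix.mul_apply, Matrix.smul_apply, smul_eq_mul, Finset.sum_mul]
  rw [Finset.sum_comm]
  have : ∀ y, ∑ g, ∑ x, X y x * ρ g x y * ρ g⁻¹ i j = ∑ x, X y x * ∑ g, ρ g x y * ρ g⁻¹ i j := by
    intro y
    rw [Finset.sum_comm]
    exact Finset.sum_congr rfl (fun x _ => by rw [Finset.mul_sum]; simp only [mul_assoc])
  simp only [this, h1]
  simp [ite_and, mul_comm]
end A1
end PX

namespace PX
section A2
open Matrix Polynomial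

theorem sum_nthRoots_shift {o : ℕ} (ho : 0 < o) {M : Type*} [AddCommMonoid M] (f : ℂ → M) (ε : ℂ) (hε : ε ^ o = 1) :
    ∑ θ ∈ nthRootsFinset o (1 : ℂ), f (ε * θ) = ∑ θ ∈ nthRootsFinset o (1 : ℂ), f θ := by
  have hε0 : ε ≠ 0 := by rintro rfl; simp [ho.ne'] at hε
  refine Finset.sum_nbij' (fun θ => ε * θ) (fun θ => ε⁻¹ * θ) ?_ ?_ ?_ ?_ ?_
  · intro θ hθ
    rw [mem_nthRootsFinset ho] at *
    rw [mul_pow, hε, hθ, one_mul]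
  · intro θ hθ
    rw [mem_nthRootsFinset ho] at *
    rw [mul_pow, inv_pow, hε, hθ]; simp
  · intro θ _; field_simp
  · intro θ _; field_simp
  · intro θ _; rfl

theorem sum_nthRoots_pow {o : ℕ} (ho : 0 < o) (i : ℕ) (hi : i < o) :
    ∑ θ ∈ nthRootsFinset o (1 : ℂ), (θ⁻¹) ^ i = if i = 0 then (o : ℂ) else 0 := by
  have hζ := Complex.isPrimitiveRoot_exp o ho.ne'
  set ζ : ℂ := Complex.exp (2 * Real.pi * Complex.I / o)
  have hζ0 : ζ ≠ 0 := hζ.ne_zero ho.ne'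
  split_ifs with h0
  · subst h0
    simp [hζ.card_nthRootsFinset]
  · have := sum_nthRoots_shift ho (fun θ : ℂ => (θ⁻¹) ^ i) ζ hζ.pow_eq_one
    simp only [mul_inv, mul_pow, ← Finset.mul_sum] at this
    have hne : (ζ⁻¹) ^ i ≠ 1 := hζ.inv.pow_ne_one_of_pos_of_lt h0 hi
    have h2 : ((ζ⁻¹) ^ i - 1) * ∑ θ ∈ nthRootsFinset o (1 : ℂ), (θ⁻¹) ^ i = 0 := by
      rw [sub_mul, this, one_mul, sub_self]
    exact (mul_eq_zero.1 h2).resolve_left (sub_ne_zero.2 hne)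

/-- multiplicity of eigenvalue -/
noncomputable def mult {d : ℕ} {K : Type*} [Field K] (g : Matrix (Fin d) (Fin d) K) (θ : K) : ℕ :=
  Module.finrank K (LinearMap.ker (Matrix.toLin' (g - θ • 1)))

theorem trace_pow_eq {d o : ℕ} (ho : 0 < o) (g : Matrix (Fin d) (Fin d) ℂ) (hg : g ^ o = 1) (j : ℕ) :
    (g ^ j).trace = ∑ θ ∈ nthRootsFinset o (1 : ℂ), (mult g θ : ℂ) * θ ^ j := by
  have hoC : (o : ℂ) ≠ 0 := by exact_mod_cast ho.ne'
  let e : ℂ → Matrix (Fin d) (Fin d) ℂ := fun θ => (o : ℂ)⁻¹ • ∑ i ∈ Finset.range o, (θ⁻¹) ^ i • g ^ i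
  have hsum : ∑ θ ∈ nthRootsFinset o (1 : ℂ), e θ = 1 := by
    simp only [e, ← Finset.smul_sum]
    rw [Finset.sum_comm]
    have : ∀ i ∈ Finset.range o, ∑ θ ∈ nthRootsFinset o (1 : ℂ), (θ⁻¹) ^ i • g ^ i =
        (if i = 0 then (o : ℂ) else 0) • g ^ i := by
      intro i hi
      rw [← Finset.sum_smul, sum_nthRoots_pow ho i (Finset.mem_range.1 hi)]
    rw [Finset.sum_congr rfl this, Finset.sum_eq_single_of_mem 0 (Finset.mem_range.2 ho)]
    · simp only [if_true, pow_zero, smul_smul, inv_mul_cancel₀ hoC, one_smul]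
    · intro i _ hi; simp [hi]
  have hge : ∀ θ ∈ nthRootsFinset o (1 : ℂ), g * e θ = θ • e θ := by
    intro θ hθ
    rw [mem_nthRootsFinset ho] at hθ
    have hθ0 : θ ≠ 0 := by rintro rfl; simp [ho.ne'] at hθ
    simp only [e, mul_smul_comm, Finset.mul_sum]
    rw [smul_comm]
    congr 1
    have h2 := Finset.sum_range_succ (fun i => θ • (θ⁻¹) ^ i • g ^ i) o
    have h3 := Finset.sum_range_succ' (fun i => θ • (θ⁻¹) ^ i • g ^ i) o
    have h4 : θ • (θ⁻¹) ^ o • g ^ o = θ • (θ⁻¹) ^ 0 • g ^ 0 := by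
      rw [hg, inv_pow, hθ]; simp
    rw [h2, h4] at h3
    rw [Finset.smul_sum, add_right_cancel h3]
    refine Finset.sum_congr rfl (fun i _ => ?_)
    rw [← pow_succ', smul_smul]
    congr 1
    rw [pow_succ', ← mul_assoc, mul_inv_cancel₀ hθ0, one_mul]
  have hgje : ∀ θ ∈ nthRootsFinset o (1 : ℂ), g ^ j * e θ = θ ^ j • e θ := by
    intro θ hθ
    induction j with
    | zero => simp
    | succ j ih => rw [pow_succ, mul_assoc, hge θ hθ, mul_smul_comm, ih, smul_smul, pow_succ']
  have htr : ∀ θ ∈ nthRootsFinset o (1 : ℂ), (e θ).trace = mult g θ := by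
    intro θ hθ
    have hp : LinearMap.IsProj (LinearMap.ker (Matrix.toLin' (g - θ • 1))) (Matrix.toLin' (e θ)) := by
      constructor
      · intro x
        rw [LinearMap.mem_ker, ← LinearMap.comp_apply, ← Matrix.toLin'_mul, sub_mul, hge θ hθ]
        simp
      · intro x hx
        rw [LinearMap.mem_ker] at hx
        have hx' : g *ᵥ x = θ • x := by
          simp only [Matrix.toLin'_apply, Matrix.sub_mulVec, Matrix.smul_mulVec, Matrix.one_mulVec] at hx
          exact sub_eq_zero.1 hx
        rw [mem_nthRootsFinset ho] at hθ
        have hθ0 : θ ≠ 0 := by rintro rfl; simp [ho.ne'] at hθ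
        have hx2 : ∀ i : ℕ, (g ^ i) *ᵥ x = θ ^ i • x := by
          intro i
          induction i with
          | zero => simp
          | succ i ih => rw [pow_succ, ← Matrix.mulVec_mulVec, hx', Matrix.mulVec_smul, ih, smul_smul, pow_succ']
        simp only [Matrix.toLin'_apply, e, Matrix.smul_mulVec, Matrix.sum_mulVec, hx2, smul_smul, ← mul_pow,
          inv_mul_cancel₀ hθ0, one_pow, one_smul]
        simp only [Finset.sum_const, Finset.card_range]
        rw [← Nat.cast_smul_eq_nsmul ℂ, smul_smul, inv_mul_cancel₀ hoC, one_smul]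
    have := hp.trace
    rw [Matrix.trace_toLin'_eq] at this
    exact this
  have : g ^ j = ∑ θ ∈ nthRootsFinset o (1 : ℂ), θ ^ j • e θ := by
    rw [← Finset.sum_congr rfl hgje, ← Finset.mul_sum, hsum, mul_one]
  rw [this, trace_sum]
  refine Finset.sum_congr rfl (fun θ hθ => ?_)
  rw [trace_smul, htr θ hθ, smul_eq_mul, mul_comm]

theorem trace_inv_conj {d o : ℕ} (ho : 0 < o) (g : Matrix (Fin d) (Fin d) ℂ) (hg : g ^ o = 1) :
    (g ^ (o - 1)).trace = (starRingEnd ℂ) g.trace := by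
  rw [trace_pow_eq ho g hg]
  conv_rhs => rw [← pow_one g, trace_pow_eq ho g hg]
  rw [map_sum]
  refine Finset.sum_congr rfl (fun θ hθ => ?_)
  rw [mem_nthRootsFinset ho] at hθ
  simp only [map_mul, map_natCast, pow_one]
  congr 1
  have hθ0 : θ ≠ 0 := by rintro rfl; simp [ho.ne'] at hθ
  have h1 : ‖θ‖ = 1 := Complex.norm_eq_one_of_pow_eq_one hθ ho.ne'
  rw [← Complex.inv_eq_conj h1]
  apply mul_right_cancel₀ hθ0
  rw [inv_mul_cancel₀ hθ0, ← pow_succ, Nat.sub_add_cancel ho, hθ]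

theorem trace_integral {d o : ℕ} (ho : 0 < o) (g : Matrix (Fin d) (Fin d) ℂ) (hg : g ^ o = 1) :
    IsIntegral ℤ g.trace := by
  conv => arg 2; rw [← pow_one g]
  rw [trace_pow_eq ho g hg]
  refine IsIntegral.sum _ (fun θ hθ => ?_)
  rw [mem_nthRootsFinset ho] at hθ
  refine IsIntegral.mul ?_ ?_
  · exact map_natCast (algebraMap ℤ ℂ) (mult g θ) ▸ isIntegral_algebraMap
  · rw [pow_one]
    exact IsIntegral.of_pow ho (by rw [hθ]; exact isIntegral_one)

theorem norm_conj (γ : algebraicClosure ℚ ℂ) (h0 : γ ≠ 0) (hi : IsIntegral ℤ γ) :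
    ∃ σ : algebraicClosure ℚ ℂ →ₐ[ℚ] ℂ, 1 ≤ ‖σ γ‖ := by
  by_contra! hcon
  have hAlg : Algebra.IsAlgebraic ℚ (algebraicClosure ℚ ℂ) := algebraicClosure.isAlgebraic ℚ ℂ
  have hP := minpoly.isIntegrallyClosed_eq_field_fractions' ℚ hi
  have hm : (minpoly ℚ γ).Monic := minpoly.monic (Algebra.IsIntegral.isIntegral γ)
  have hs : ((minpoly ℚ γ).map (algebraMap ℚ ℂ)).Splits := IsAlgClosed.splits _
  have hc := hs.coeff_zero_eq_prod_roots_of_monic (hm.map _)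
  have hr : ∀ r ∈ ((minpoly ℚ γ).map (algebraMap ℚ ℂ)).roots, ‖r‖ < 1 := by
    intro r hr
    have : r ∈ (minpoly ℚ γ).rootSet ℂ := by
      rw [Polynomial.mem_rootSet']
      refine ⟨(hm.map _).ne_zero, ?_⟩
      have := Polynomial.isRoot_of_mem_roots hr
      rwa [IsRoot.def, eval_map_algebraMap] at this
    rw [← Algebra.IsAlgebraic.range_eval_eq_rootSet_minpoly] at this
    obtain ⟨σ, rfl⟩ := this
    exact hcon σ
  have hc0 : (minpoly ℤ γ).coeff 0 ≠ 0 := by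
    have := minpoly.coeff_zero_ne_zero (Algebra.IsIntegral.isIntegral (R := ℚ) γ) h0
    rw [hP, Polynomial.coeff_map] at this
    intro h
    exact this (by rw [h, map_zero])
  have hdeg : ((minpoly ℚ γ).map (algebraMap ℚ ℂ)).roots ≠ 0 := by
    intro h0
    have := hs.natDegree_eq_card_roots
    rw [h0, Multiset.card_zero, Polynomial.natDegree_map] at this
    exact (minpoly.natDegree_pos (Algebra.IsIntegral.isIntegral (R := ℚ) γ)).ne' this
  have h1 : ‖((minpoly ℚ γ).map (algebraMap ℚ ℂ)).coeff 0‖ = |(((minpoly ℤ γ).coeff 0 : ℤ) : ℝ)| := by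
    rw [hP, Polynomial.coeff_map, Polynomial.coeff_map]
    simp
  have h2 : (1 : ℝ) ≤ |(((minpoly ℤ γ).coeff 0 : ℤ) : ℝ)| := by
    exact_mod_cast Int.one_le_abs hc0
  have h3 : ∀ s : Multiset ℂ, (∀ r ∈ s, ‖r‖ < 1) → s ≠ 0 → ‖s.prod‖ < 1 := by
    intro s
    induction s using Multiset.induction with
    | empty => intro _ h; exact absurd rfl h
    | cons a s ih =>
      intro h _
      rw [Multiset.prod_cons, norm_mul]
      have ha := h a (Multiset.mem_cons_self a s)
      by_cases hs0 : s = 0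
      · simpa [hs0] using ha
      · have := ih (fun r hr => h r (Multiset.mem_cons_of_mem hr)) hs0
        nlinarith [norm_nonneg a, norm_nonneg s.prod]
  have h4 := h3 _ hr hdeg
  rw [hc, norm_mul, norm_pow, norm_neg, norm_one, one_pow, one_mul] at h1
  linarith

theorem galois_bound {d o : ℕ} (ho : 0 < o) (A : Matrix (Fin d) (Fin d) ℂ) (hA : A ^ o = 1) (N m : ℕ)
    (hm : 0 < m) (hne : A.trace ≠ 0)
    (hint : IsIntegral ℤ ((A.trace * (A ^ (o - 1)).trace) ^ N / (m : ℂ))) :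
    ∃ j, j.Coprime o ∧ (A ^ j).trace ≠ 0 ∧ (m : ℝ) ≤ ‖(A ^ j).trace‖ ^ (2 * N) := by
  have hζ := Complex.isPrimitiveRoot_exp o ho.ne'
  set ζ : ℂ := Complex.exp (2 * Real.pi * Complex.I / o)
  have : NeZero o := ⟨ho.ne'⟩
  have mem_of_int : ∀ x : ℂ, IsIntegral ℤ x → x ∈ algebraicClosure ℚ ℂ := by
    intro x hx
    rw [mem_algebraicClosure_iff]
    exact (hx.tower_top (A := ℚ)).isAlgebraic
  have hpow : ∀ j : ℕ, (A ^ j) ^ o = 1 := fun j => by rw [← pow_mul, mul_comm, pow_mul, hA, one_pow]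
  let ζ' : algebraicClosure ℚ ℂ := ⟨ζ, mem_of_int _ (hζ.isIntegral ho)⟩
  have hζ' : IsPrimitiveRoot ζ' o :=
    IsPrimitiveRoot.of_map_of_injective (f := algebraMap (algebraicClosure ℚ ℂ) ℂ) hζ Subtype.val_injective
  let x : algebraicClosure ℚ ℂ := ⟨A.trace, mem_of_int _ (trace_integral ho A hA)⟩
  let y : algebraicClosure ℚ ℂ := ⟨(A ^ (o - 1)).trace, mem_of_int _ (trace_integral ho _ (hpow _))⟩
  let γ : algebraicClosure ℚ ℂ := (x * y) ^ N / (m : algebraicClosure ℚ ℂ)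
  have hγv : (γ : ℂ) = (A.trace * (A ^ (o - 1)).trace) ^ N / (m : ℂ) := by
    simp [γ, x, y]
  have hmC : (m : ℂ) ≠ 0 := by exact_mod_cast hm.ne'
  have hγ0 : γ ≠ 0 := by
    intro h
    have : (γ : ℂ) = 0 := by rw [h]; rfl
    rw [hγv, trace_inv_conj ho A hA] at this
    have h2 := (div_eq_zero_iff.1 this).resolve_right hmC
    have h4 : A.trace * (starRingEnd ℂ) A.trace ≠ 0 := mul_ne_zero hne (by simpa using hne)
    exact (pow_ne_zero N h4) h2
  have hγi : IsIntegral ℤ γ := by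
    have : IsIntegral ℤ ((algebraMap (algebraicClosure ℚ ℂ) ℂ) γ) := by
      change IsIntegral ℤ (γ : ℂ)
      rw [hγv]; exact hint
    exact (isIntegral_algebraMap_iff (algebraMap (algebraicClosure ℚ ℂ) ℂ).injective).1 this
  obtain ⟨σ, hσ⟩ := norm_conj γ hγ0 hγi
  have hσζ : IsPrimitiveRoot (σ ζ') o := hζ'.map_of_injective σ.injective
  obtain ⟨j, hj, hjc, hjζ⟩ := (hζ.isPrimitiveRoot_iff).1 hσζ
  have hroot : ∀ θ : ℂ, θ ^ o = 1 → ∃ θ' : algebraicClosure ℚ ℂ, (θ' : ℂ) = θ ∧ σ θ' = θ ^ j := by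
    intro θ hθ
    obtain ⟨k, _, rfl⟩ := hζ.eq_pow_of_pow_eq_one hθ
    refine ⟨ζ' ^ k, by simp [ζ'], ?_⟩
    rw [map_pow, ← hjζ, ← pow_mul, ← pow_mul, mul_comm]
  have htr : ∀ (B : Matrix (Fin d) (Fin d) ℂ), B ^ o = 1 → ∀ z : algebraicClosure ℚ ℂ, (z : ℂ) = B.trace →
      σ z = (B ^ j).trace := by
    intro B hB z hz
    choose! t ht1 ht2 using hroot
    have : z = ∑ θ ∈ nthRootsFinset o (1 : ℂ), (mult B θ : algebraicClosure ℚ ℂ) * t θ := by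
      apply Subtype.val_injective
      change (z : ℂ) = (algebraMap (algebraicClosure ℚ ℂ) ℂ) _
      rw [hz, ← pow_one B, trace_pow_eq ho B hB, map_sum]
      refine Finset.sum_congr rfl (fun θ hθ => ?_)
      rw [mem_nthRootsFinset ho] at hθ
      rw [map_mul, map_natCast, pow_one, pow_one]
      congr 1
      exact (ht1 θ hθ).symm
    rw [this, trace_pow_eq ho B hB, map_sum]
    refine Finset.sum_congr rfl (fun θ hθ => ?_)
    rw [mem_nthRootsFinset ho] at hθ
    rw [map_mul, map_natCast, ht2 θ hθ]
  have hx := htr A hA x rfl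
  have hy := htr (A ^ (o - 1)) (hpow _) y rfl
  rw [← pow_mul, mul_comm (o - 1) j, pow_mul, trace_inv_conj ho _ (hpow j)] at hy
  refine ⟨j, hjc, ?_, ?_⟩
  · rw [← hx]
    intro h
    have : x = 0 := (map_eq_zero σ).1 h
    exact hne (congrArg Subtype.val this)
  · have : ‖σ γ‖ = ‖(A ^ j).trace‖ ^ (2 * N) / m := by
      simp only [γ, map_div₀, map_pow, map_mul, map_natCast, hx, hy]
      rw [norm_div, norm_pow, norm_mul, RCLike.norm_conj, ← sq, ← pow_mul]
      simp
    rw [this, le_div_iff₀ (by exact_mod_cast hm), one_mul] at hσ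
    exact hσ

theorem integral_of_sum {G : Type*} [Group G] [Fintype G] {d : ℕ} (hd : d ≠ 0)
    (ρ : G →* Matrix (Fin d) (Fin d) ℂ) (c : G → ℂ) (hc : ∀ g, IsIntegral ℤ (c g)) (ω : ℂ)
    (hω : ∑ g, c g • ρ g = ω • 1) : IsIntegral ℤ ω := by
  let R := integralClosure ℤ ℂ
  let φ : MonoidAlgebra R G →ₐ[R] Matrix (Fin d) (Fin d) ℂ := MonoidAlgebra.lift R _ G ρ
  let a : MonoidAlgebra R G := ∑ g, MonoidAlgebra.single g (⟨c g, hc g⟩ : R)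
  have ha : φ a = ω • 1 := by
    rw [← hω]
    simp only [a, map_sum, φ]
    refine Finset.sum_congr rfl (fun g _ => ?_)
    rw [MonoidAlgebra.lift_single]
    rfl
  have h1 : IsIntegral R a := Algebra.IsIntegral.isIntegral a
  have h2 : IsIntegral R (φ a) := h1.map φ
  have : Nonempty (Fin d) := ⟨⟨0, Nat.pos_of_ne_zero hd⟩⟩
  have h3 : IsIntegral R (algebraMap ℂ (Matrix (Fin d) (Fin d) ℂ) ω) := by
    rw [Algebra.algebraMap_eq_smul_one, ← ha]; exact h2
  have h4 : IsIntegral R ω :=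
    (isIntegral_algebraMap_iff (algebraMap ℂ (Matrix (Fin d) (Fin d) ℂ)).injective).1 h3
  exact isIntegral_trans (R := ℤ) (A := R) ω h4
end A2
end PX

namespace PX
section A3
open Matrix

variable {H : Type*} [Group H] {d : ℕ}

/-- order of the centralizer of `g` in `L` -/
noncomputable def cc (L : Subgroup H) (g : H) : ℕ := Nat.card ↥(L ⊓ Subgroup.centralizer {g})

/-- commutant of `L` is scalar -/
def ScalarComm (L : Subgroup H) (ρ : H →* Matrix (Fin d) (Fin d) ℂ) : Prop :=
  ∀ A, (∀ l ∈ L, ρ l * A = A * ρ l) → ∃ c : ℂ, A = c • 1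

theorem ScalarComm.res {L : Subgroup H} {ρ : H →* Matrix (Fin d) (Fin d) ℂ} (h : ScalarComm L ρ) :
    ∀ A, (∀ g, (ρ.comp L.subtype) g * A = A * (ρ.comp L.subtype) g) → ∃ c : ℂ, A = c • 1 := by
  intro A hA
  exact h A (fun l hl => hA ⟨l, hl⟩)

theorem central_scalar {L : Subgroup H} {ρ : H →* Matrix (Fin d) (Fin d) ℂ} (h : ScalarComm L ρ)
    {z : H} (hz : z ∈ Subgroup.center H) : ∃ c : ℂ, ρ z = c • 1 := by
  refine h _ (fun l _ => ?_)
  rw [← map_mul, ← map_mul, Subgroup.mem_center_iff.1 hz l]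

theorem conj_center (hd : d ≠ 0) {L : Subgroup H} {ρ : H →* Matrix (Fin d) (Fin d) ℂ} (h : ScalarComm L ρ)
    (hinj : Function.Injective ρ) {g x z : H} (hz : z ∈ Subgroup.center H) (hne : (ρ g).trace ≠ 0)
    (hx : x * g * x⁻¹ = g * z) : z = 1 := by
  obtain ⟨c, hc⟩ := central_scalar h hz
  have h1 : (ρ (x * g * x⁻¹)).trace = (ρ g).trace := by
    rw [map_mul, Matrix.trace_mul_comm, ← map_mul]; simp
  rw [hx, map_mul, hc] at h1
  simp only [mul_smul_comm, mul_one, trace_smul, smul_eq_mul] at h1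
  have h2 : c = 1 := mul_right_cancel₀ hne (h1.trans (one_mul _).symm)
  apply hinj
  rw [hc, h2, one_smul, map_one]

theorem norm_central (hd : d ≠ 0) [Finite H] {L : Subgroup H} {ρ : H →* Matrix (Fin d) (Fin d) ℂ} (h : ScalarComm L ρ)
    {g z : H} (hz : z ∈ Subgroup.center H) : ‖(ρ (g * z)).trace‖ = ‖(ρ g).trace‖ := by
  obtain ⟨c, hc⟩ := central_scalar h hz
  have : Nonempty (Fin d) := ⟨⟨0, Nat.pos_of_ne_zero hd⟩⟩
  have h1 : c ^ (orderOf z) = 1 := by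
    have h2 : (ρ z) ^ (orderOf z) = 1 := by rw [← map_pow, pow_orderOf_eq_one, map_one]
    rw [hc, smul_pow, one_pow] at h2
    have := congrFun (congrFun h2 ⟨0, Nat.pos_of_ne_zero hd⟩) ⟨0, Nat.pos_of_ne_zero hd⟩
    simpa using this
  have h2 : ‖c‖ = 1 := Complex.norm_eq_one_of_pow_eq_one h1 (orderOf_pos z).ne'
  rw [map_mul, hc]
  simp [h2]

theorem rho_pow_card [Finite H] (ρ : H →* Matrix (Fin d) (Fin d) ℂ) (g : H) : (ρ g) ^ (Nat.card H) = 1 := by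
  rw [← map_pow, pow_card_eq_one', map_one]

theorem chi_inv [Finite H] (ρ : H →* Matrix (Fin d) (Fin d) ℂ) (g : H) :
    (ρ g⁻¹).trace = (starRingEnd ℂ) (ρ g).trace := by
  rw [← trace_inv_conj (Nat.card_pos (α := H)) (ρ g) (rho_pow_card ρ g), ← map_pow]
  congr 2
  rw [inv_eq_iff_mul_eq_one, ← pow_succ', Nat.sub_add_cancel Nat.card_pos, pow_card_eq_one']

theorem chi_integral [Finite H] (ρ : H →* Matrix (Fin d) (Fin d) ℂ) (g : H) : IsIntegral ℤ (ρ g).trace :=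
  trace_integral (Nat.card_pos (α := H)) (ρ g) (rho_pow_card ρ g)

theorem sum_coset (hd : d ≠ 0) [Finite H] {L : Subgroup H} [Fintype L] {ρ : H →* Matrix (Fin d) (Fin d) ℂ}
    (h : ScalarComm L ρ) (g : H) : ∑ l : L, ‖(ρ (g * l)).trace‖ ^ 2 = Nat.card L := by
  have h1 := fourier hd (ρ.comp L.subtype) h.res (ρ g)
  have h2 := congrArg (fun M => (M * ρ g⁻¹).trace) h1
  have hd' : (d : ℂ) ≠ 0 := by exact_mod_cast hd
  simp only [Finset.sum_mul, smul_mul_assoc, trace_smul, Fintype.card_fin,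
    smul_eq_mul, trace_sum, MonoidHom.comp_apply, ← map_mul, Subgroup.subtype_apply] at h2
  rw [mul_inv_cancel, map_one, trace_one, Fintype.card_fin, div_mul_cancel₀ _ hd'] at h2
  have h3 : ∀ l : L, (ρ (g * l)).trace * (ρ (((l⁻¹ : L) : H) * g⁻¹)).trace = ((‖(ρ (g * l)).trace‖ ^ 2 : ℝ) : ℂ) := by
    intro l
    have : (((l⁻¹ : L) : H) * g⁻¹) = (g * l)⁻¹ := by simp
    rw [this, chi_inv, Complex.mul_conj, Complex.normSq_eq_norm_sq]
  rw [Finset.sum_congr rfl (fun l _ => h3 l)] at h2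
  rw [Nat.card_eq_fintype_card]
  exact_mod_cast h2

theorem fiber_card (L : Subgroup H) (g : H) (l₀ : L) :
    Nat.card {l : L // (l : H) * g * (l : H)⁻¹ = l₀ * g * (l₀ : H)⁻¹} = cc L g := by
  refine Nat.card_congr ⟨fun l => ⟨(l₀ : H)⁻¹ * l.1, ?_, ?_⟩, fun c => ⟨l₀ * ⟨c.1, c.2.1⟩, ?_⟩, ?_, ?_⟩
  · exact L.mul_mem (L.inv_mem l₀.2) l.1.2
  · change _ ∈ Subgroup.centralizer {g}
    rw [Subgroup.mem_centralizer_singleton_iff]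
    have := l.2
    have h2 : (l.1 : H) * g = l₀ * g * (l₀ : H)⁻¹ * l.1 := (mul_inv_eq_iff_eq_mul.1 this)
    rw [mul_assoc, h2]; group
  · have : _ ∈ Subgroup.centralizer {g} := c.2.2
    rw [Subgroup.mem_centralizer_singleton_iff] at this
    simp only [Subgroup.coe_mul, _root_.mul_inv_rev]
    calc (l₀ : H) * c.1 * g * ((c.1)⁻¹ * (l₀ : H)⁻¹) = l₀ * (c.1 * g) * ((c.1)⁻¹ * (l₀ : H)⁻¹) := by group
      _ = _ := by rw [this]; group
  · intro l; ext; simp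
  · intro c; ext; simp

theorem sum_conj [Fintype H] [DecidableEq H] (L : Subgroup H) [Fintype L] (g : H) {M : Type*} [AddCommMonoid M] (f : H → M) :
    ∑ l : L, f (l * g * (l : H)⁻¹) = cc L g • ∑ x ∈ Finset.univ.image (fun l : L => (l : H) * g * (l : H)⁻¹), f x := by
  rw [Finset.sum_comp f (fun l : L => (l : H) * g * (l : H)⁻¹), Finset.smul_sum]
  refine Finset.sum_congr rfl (fun x hx => ?_)
  obtain ⟨l₀, _, rfl⟩ := Finset.mem_image.1 hx
  congr 1
  rw [← fiber_card L g l₀, Nat.card_eq_fintype_card, Fintype.card_subtype]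

theorem card_conj [Fintype H] [DecidableEq H] (L : Subgroup H) [Fintype L] (g : H) :
    Nat.card L = cc L g * (Finset.univ.image (fun l : L => (l : H) * g * (l : H)⁻¹)).card := by
  have := sum_conj L g (fun _ => 1)
  simpa using this

theorem cc_pos [Finite H] (L : Subgroup H) (g : H) : 0 < cc L g := Nat.card_pos

theorem omega_integral [Fintype H] (hd : d ≠ 0) {L : Subgroup H} {ρ : H →* Matrix (Fin d) (Fin d) ℂ}
    (h : ScalarComm L ρ) (g : H) : IsIntegral ℤ ((Nat.card L : ℂ) / cc L g * (ρ g).trace / d) := by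
  classical
  have : Fintype L := Fintype.ofFinite L
  have h1 := avg_scalar hd (ρ.comp L.subtype) h.res (ρ g)
  simp only [MonoidHom.comp_apply, ← map_mul, Subgroup.subtype_apply, Subgroup.coe_inv] at h1
  rw [sum_conj L g (fun x => ρ x)] at h1
  have hcc : (cc L g : ℂ) ≠ 0 := by exact_mod_cast (cc_pos L g).ne'
  refine integral_of_sum hd ρ (fun y => if y ∈ Finset.univ.image (fun l : L => (l : H) * g * (l : H)⁻¹) then 1 else 0)
    (fun y => ?_) _ ?_
  · split_ifs
    · exact isIntegral_one
    · exact isIntegral_zero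
  · simp only [ite_smul, one_smul, zero_smul]
    rw [Finset.sum_ite_mem, Finset.univ_inter]
    have h2 : (cc L g : ℂ) • ∑ x ∈ Finset.univ.image (fun l : L => (l : H) * g * (l : H)⁻¹), ρ x =
      (cc L g : ℂ) • ((Nat.card L : ℂ) / cc L g * (ρ g).trace / d) • (1 : Matrix (Fin d) (Fin d) ℂ) := by
      rw [Nat.cast_smul_eq_nsmul, h1, smul_smul]
      congr 1
      rw [Nat.card_eq_fintype_card]
      field_simp
    exact smul_right_injective _ hcc h2

theorem chi_bound [Fintype H] (hd : d ≠ 0) {L : Subgroup H} [L.Normal] {ρ : H →* Matrix (Fin d) (Fin d) ℂ}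
    (h : ScalarComm L ρ) (hinj : Function.Injective ρ) (hZ : Subgroup.center H ≤ L) (g : H)
    (hne : (ρ g).trace ≠ 0) : ‖(ρ g).trace‖ ^ 2 * Nat.card (Subgroup.center H) ≤ cc L g := by
  classical
  have : Fintype L := Fintype.ofFinite L
  have : Fintype (Subgroup.center H) := Fintype.ofFinite _
  let φ : L × Subgroup.center H → L := fun y =>
    ⟨g⁻¹ * ((y.1 : H) * g * (y.1 : H)⁻¹ * y.2), by
      have h1 : g⁻¹ * (y.1 : H) * g ∈ L := by
        have := Subgroup.Normal.conj_mem ‹L.Normal› y.1 y.1.2 g⁻¹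
        simpa using this
      have : g⁻¹ * ((y.1 : H) * g * (y.1 : H)⁻¹ * y.2) = (g⁻¹ * (y.1 : H) * g) * (y.1 : H)⁻¹ * y.2 := by group
      rw [this]
      exact L.mul_mem (L.mul_mem h1 (L.inv_mem y.1.2)) (hZ y.2.2)⟩
  have hφ : ∀ y, g * (φ y : H) = (y.1 : H) * g * (y.1 : H)⁻¹ * y.2 := fun y => by simp [φ]
  have h1 : ∑ y : L × Subgroup.center H, ‖(ρ (g * (φ y : H))).trace‖ ^ 2 =
      Nat.card L * Nat.card (Subgroup.center H) * ‖(ρ g).trace‖ ^ 2 := by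
    have : ∀ y : L × Subgroup.center H, ‖(ρ (g * (φ y : H))).trace‖ ^ 2 = ‖(ρ g).trace‖ ^ 2 := by
      intro y
      rw [hφ, norm_central hd h y.2.2]
      congr 2
      rw [map_mul, Matrix.trace_mul_comm, ← map_mul]; simp
    rw [Finset.sum_congr rfl (fun y _ => this y)]
    simp [Fintype.card_prod]
  have hfib : ∀ l : L, (Finset.univ.filter (fun y => φ y = l)).card ≤ cc L g := by
    intro l
    by_cases hemp : (Finset.univ.filter (fun y => φ y = l)) = ∅
    · rw [hemp]; simp
    obtain ⟨y₀, hy₀⟩ := Finset.nonempty_iff_ne_empty.2 hemp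
    have hy₀' := (Finset.mem_filter.1 hy₀).2
    rw [← fiber_card L g y₀.1, Nat.card_eq_fintype_card, Fintype.card_subtype]
    have key : ∀ y, φ y = l → y.2 = y₀.2 ∧ (y.1 : H) * g * (y.1 : H)⁻¹ = y₀.1 * g * (y₀.1 : H)⁻¹ := by
      intro y hy
      have e1 : (y.1 : H) * g * (y.1 : H)⁻¹ * y.2 = (y₀.1 : H) * g * (y₀.1 : H)⁻¹ * y₀.2 := by
        rw [← hφ, ← hφ, hy, hy₀']
      have hc : (y₀.2 : H) * (y.2 : H)⁻¹ ∈ Subgroup.center H := mul_mem y₀.2.2 (inv_mem y.2.2)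
      have e2 : (y.1 : H) * g * (y.1 : H)⁻¹ = (y₀.1 : H) * g * (y₀.1 : H)⁻¹ * ((y₀.2 : H) * (y.2 : H)⁻¹) := by
        rw [← mul_assoc, ← e1]; group
      have e3 : ((y₀.1 : H)⁻¹ * y.1) * g * ((y₀.1 : H)⁻¹ * y.1)⁻¹ = g * ((y₀.2 : H) * (y.2 : H)⁻¹) := by
        have : ((y₀.1 : H)⁻¹ * y.1) * g * ((y₀.1 : H)⁻¹ * y.1)⁻¹ = (y₀.1 : H)⁻¹ * ((y.1 : H) * g * (y.1 : H)⁻¹) * y₀.1 := by group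
        rw [this, e2]
        have hc2 := Subgroup.mem_center_iff.1 hc (y₀.1 : H)
        calc _ = g * (y₀.1 : H)⁻¹ * (((y₀.2 : H) * (y.2 : H)⁻¹) * y₀.1) := by group
          _ = g * (y₀.1 : H)⁻¹ * (y₀.1 * ((y₀.2 : H) * (y.2 : H)⁻¹)) := by rw [hc2]
          _ = _ := by group
      have e4 := conj_center hd h hinj hc hne e3
      refine ⟨?_, ?_⟩
      · ext; exact (mul_inv_eq_one.1 e4).symm
      · rw [e2, e4, mul_one]
    refine Finset.card_le_card_of_injOn (fun y => y.1) ?_ ?_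
    · intro y hy
      have := (key y (Finset.mem_filter.1 hy).2).2
      simpa using this
    · intro y hy y' hy' e
      have h1 := (key y (Finset.mem_filter.1 hy).2).1
      have h2 := (key y' (Finset.mem_filter.1 hy').2).1
      exact Prod.ext e (h1.trans h2.symm)
  have h2 : ∑ y : L × Subgroup.center H, ‖(ρ (g * (φ y : H))).trace‖ ^ 2 ≤ cc L g * Nat.card L := by
    rw [← sum_coset hd h g, Finset.mul_sum, ← Finset.sum_fiberwise (s := Finset.univ) (g := φ)]
    refine Finset.sum_le_sum (fun l _ => ?_)
    rw [Finset.sum_congr rfl (g := fun _ => ‖(ρ (g * (l : H))).trace‖ ^ 2)]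
    · rw [Finset.sum_const, nsmul_eq_mul]
      gcongr
      exact hfib l
    · intro y hy
      rw [(Finset.mem_filter.1 hy).2]
  rw [h1] at h2
  have hL : (0 : ℝ) < Nat.card L := by exact_mod_cast Nat.card_pos
  nlinarith

theorem degree_dvd [Fintype H] (hd : d ≠ 0) {L : Subgroup H} {ρ : H →* Matrix (Fin d) (Fin d) ℂ}
    (h : ScalarComm L ρ) (hZ : Subgroup.center H ≤ L) (s : ℕ) (hs : Nat.card L = Nat.card (Subgroup.center H) * s) :
    d ∣ s := by
  classical
  have : Fintype L := Fintype.ofFinite L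
  have : Fintype (Subgroup.center H) := Fintype.ofFinite _
  let Z := (Subgroup.center H).subgroupOf L
  have : Fintype (L ⧸ Z) := Fintype.ofFinite _
  have : Fintype Z := Fintype.ofFinite _
  have h1 := fourier hd (ρ.comp L.subtype) h.res 1
  have hd' : (d : ℂ) ≠ 0 := by exact_mod_cast hd
  have hz' : Nat.card Z = Nat.card (Subgroup.center H) := Nat.card_congr (Subgroup.subgroupOfEquivOfLe hZ).toEquiv
  let F : L → Matrix (Fin d) (Fin d) ℂ := fun l => (ρ (l : H)).trace • ρ ((l : H)⁻¹)
  have hF : ∀ (l : L) (z : Z), F (l * z) = F l := by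
    intro l z
    have hzc : ((z : L) : H) ∈ Subgroup.center H := z.2
    obtain ⟨c, hc⟩ := central_scalar h hzc
    have e : ρ (((z : L) : H)⁻¹) * (c • 1) = 1 := by rw [← hc, rho_inv_mul]
    have e2 : c • ρ (((z : L) : H)⁻¹) = 1 := by simpa using e
    simp only [F, Subgroup.coe_mul, map_mul, _root_.mul_inv_rev, hc, mul_smul_comm, mul_one, trace_smul, smul_eq_mul]
    rw [mul_comm c, mul_smul, ← smul_mul_assoc, e2, one_mul]
  have h2 : ∑ l : L, F l = (Nat.card (Subgroup.center H) : ℂ) • ∑ q : L ⧸ Z, F q.out := by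
    have hbij : Function.Bijective (fun y : (L ⧸ Z) × Z => (y.1.out * y.2 : L)) := by
      constructor
      · rintro ⟨q, z⟩ ⟨q', z'⟩ hq
        simp only at hq
        have h1 : ∀ (q : L ⧸ Z) (z : Z), ((q.out * z : L) : L ⧸ Z) = q := by
          intro q z
          rw [QuotientGroup.mk_mul_of_mem _ z.2, QuotientGroup.out_eq']
        have h2 : q = q' := by rw [← h1 q z, hq, h1]
        subst h2
        have h3 := mul_left_cancel hq
        rw [Subtype.ext h3]
      · intro l
        refine ⟨⟨(l : L ⧸ Z), ⟨(l : L ⧸ Z).out⁻¹ * l, ?_⟩⟩, by simp⟩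
        rw [← QuotientGroup.eq, QuotientGroup.out_eq']
    rw [← Fintype.sum_bijective _ hbij (fun y : (L ⧸ Z) × Z => F y.1.out) F (fun y => (hF _ _).symm)]
    rw [Fintype.sum_prod_type]
    simp only [Finset.sum_const, Finset.card_univ]
    rw [← Finset.smul_sum, ← Nat.cast_smul_eq_nsmul ℂ, ← Nat.card_eq_fintype_card, hz']
  have hZ0 : (Nat.card (Subgroup.center H) : ℂ) ≠ 0 := by exact_mod_cast Nat.card_pos.ne'
  have h3 : ∑ q : L ⧸ Z, F q.out = ((s : ℂ) / d) • 1 := by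
    apply smul_right_injective _ hZ0
    simp only
    rw [← h2]
    simp only [one_mul, MonoidHom.comp_apply, Subgroup.subtype_apply, Subgroup.coe_inv] at h1
    simp only [F]
    rw [h1, smul_smul, ← Nat.card_eq_fintype_card, hs]
    congr 1
    push_cast
    ring
  have h4 : IsIntegral ℤ ((s : ℂ) / d) := by
    refine integral_of_sum hd (ρ.comp L.subtype) (fun l => ∑ q : L ⧸ Z, if q.out⁻¹ = l then (ρ (q.out : H)).trace else 0) ?_ _ ?_
    · intro l
      refine IsIntegral.sum _ (fun q _ => ?_)
      split_ifs
      · exact chi_integral ρ _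
      · exact isIntegral_zero
    · rw [← h3]
      simp only [Finset.sum_smul]
      rw [Finset.sum_comm]
      refine Finset.sum_congr rfl (fun q _ => ?_)
      simp [F, ite_smul]
  have h5 : IsIntegral ℤ ((s : ℚ) / d) := by
    have : IsIntegral ℤ (algebraMap ℚ ℂ ((s : ℚ) / d)) := by
      simpa using h4
    exact (isIntegral_algebraMap_iff (algebraMap ℚ ℂ).injective).1 this
  obtain ⟨k, hk⟩ := IsIntegrallyClosed.isIntegral_iff.1 h5
  have hdQ : (d : ℚ) ≠ 0 := by exact_mod_cast hd
  have hk' : (k : ℚ) * d = s := by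
    have : (k : ℚ) = (s : ℚ) / d := hk
    rw [this]; field_simp
  have : (d : ℤ) ∣ s := ⟨k, by rw [mul_comm]; exact_mod_cast hk'.symm⟩
  exact_mod_cast this
end A3
end PX

namespace PX
section B1
open MonoidAlgebra
open scoped Classical

theorem psum {p : ℕ} [Fact p.Prime] {P X M : Type*} [Group P] [Finite P] (hP : IsPGroup p P) [Fintype X]
    (φ : P →* Equiv.Perm X) [AddCommGroup M] (hM : ∀ m : M, p • m = 0) (f : X → M)
    (hf : ∀ u x, f (φ u x) = f x) :
    ∑ x, f x = ∑ x ∈ Finset.univ.filter (fun x => ∀ u, φ u x = x), f x := by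
  letI act : MulAction P X := MulAction.compHom X φ
  have hact : ∀ (u : P) (x : X), u • x = φ u x := fun u x => rfl
  rw [← Finset.sum_fiberwise_of_maps_to (s := Finset.univ) (t := Finset.univ.image f) (g := f)
    (fun x hx => Finset.mem_image_of_mem f hx)]
  rw [← Finset.sum_fiberwise_of_maps_to (s := Finset.univ.filter (fun x => ∀ u, φ u x = x))
    (t := Finset.univ.image f) (g := f) (fun x hx => Finset.mem_image_of_mem f (Finset.mem_univ x))]
  refine Finset.sum_congr rfl (fun b _ => ?_)
  rw [Finset.sum_congr rfl (g := fun _ => b) (fun x hx => (Finset.mem_filter.1 hx).2)]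
  rw [Finset.sum_congr rfl (g := fun _ => b) (fun x hx => (Finset.mem_filter.1 hx).2)]
  rw [Finset.sum_const, Finset.sum_const]
  let S : SubMulAction P X := ⟨{x | f x = b}, fun u x hx => by
    have hx' : f x = b := hx
    change f (u • x) = b
    rw [hact, hf, hx']⟩
  have h1 := hP.card_modEq_card_fixedPoints S
  have e1 : Nat.card S = (Finset.univ.filter (fun x => f x = b)).card := by
    rw [← Fintype.card_subtype, ← Nat.card_eq_fintype_card]; rfl
  have e2 : Nat.card (MulAction.fixedPoints P S) =
      ((Finset.univ.filter (fun x => ∀ u, φ u x = x)).filter (fun x => f x = b)).card := by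
    rw [Finset.filter_filter, ← Fintype.card_subtype, ← Nat.card_eq_fintype_card]
    refine Nat.card_congr ⟨fun y => ⟨y.1.1, fun u => ?_, y.1.2⟩, fun y => ⟨⟨y.1, y.2.2⟩, fun u => ?_⟩, ?_, ?_⟩
    · have := y.2 u
      exact congrArg Subtype.val this
    · apply Subtype.ext
      exact y.2.1 u
    · intro y; rfl
    · intro y; rfl
  rw [e1, e2] at h1
  have key : ∀ m n : ℕ, m ≤ n → m ≡ n [MOD p] → n • b = m • b := by
    intro m n hle hmn
    obtain ⟨t, ht⟩ := (Nat.modEq_iff_dvd' hle).1 hmn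
    have : n = m + p * t := by omega
    rw [this, add_smul, mul_smul, hM, add_zero]
  rcases le_total ((Finset.univ.filter (fun x => f x = b)).card)
    (((Finset.univ.filter (fun x => ∀ u, φ u x = x)).filter (fun x => f x = b)).card) with h | h
  · exact (key _ _ h h1).symm
  · exact key _ _ h h1.symm

variable {G : Type*} [Group G] [Fintype G] {p : ℕ} [Fact p.Prime]

theorem coeff_mul_fin {k : Type*} [CommRing k] (x y : MonoidAlgebra k G) (g : G) :
    coeff (x * y) g = ∑ h, coeff x h * coeff y (h⁻¹ * g) := by
  rw [coeff_mul_apply_left, Finsupp.sum_fintype]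
  intro i; simp

/-- restriction of coefficients to the centralizer -/
noncomputable def br {k : Type*} [CommRing k] (Q : Subgroup G) (a : MonoidAlgebra k G) : MonoidAlgebra k G :=
  ∑ g ∈ Finset.univ.filter (fun g => g ∈ Subgroup.centralizer (Q : Set G)), single g (coeff a g)

theorem coeff_sum' {k : Type*} [CommRing k] {ι : Type*} (s : Finset ι) (f : ι → MonoidAlgebra k G) (g : G) :
    coeff (∑ i ∈ s, f i) g = ∑ i ∈ s, coeff (f i) g := by
  induction s using Finset.induction with
  | empty => simp
  | insert a s ha ih => rw [Finset.sum_insert ha, Finset.sum_insert ha, ← ih]; simp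

theorem coeff_br {k : Type*} [CommRing k] (Q : Subgroup G) (a : MonoidAlgebra k G) (g : G) :
    coeff (br Q a) g = if g ∈ Subgroup.centralizer (Q : Set G) then coeff a g else 0 := by
  rw [br, coeff_sum']
  simp only [coeff_single, Finsupp.single_apply]
  rw [Finset.sum_ite_eq']
  simp

/-- class function -/
def IsCl {k : Type*} [CommRing k] (a : MonoidAlgebra k G) : Prop :=
  ∀ x g : G, coeff a (x * g * x⁻¹) = coeff a g

theorem IsCl.mul {k : Type*} [CommRing k] {a b : MonoidAlgebra k G} (ha : IsCl a) (hb : IsCl b) : IsCl (a * b) := by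
  intro x g
  rw [coeff_mul_fin, coeff_mul_fin]
  refine (Fintype.sum_equiv (MulAut.conj x).toEquiv _ _ (fun h => ?_)).symm
  simp only [MulEquiv.toEquiv_eq_coe, EquivLike.coe_coe, MulAut.conj_apply]
  rw [ha]
  congr 1
  rw [← hb x]
  congr 1; group

theorem IsCl.sub {k : Type*} [CommRing k] {a b : MonoidAlgebra k G} (ha : IsCl a) (hb : IsCl b) : IsCl (a - b) := by
  intro x g
  simp only [coeff_sub, Finsupp.sub_apply]
  rw [ha, hb]

theorem IsCl.one {k : Type*} [CommRing k] : IsCl (1 : MonoidAlgebra k G) := by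
  intro x g
  simp only [one_def, coeff_single, Finsupp.single_apply]
  congr 1
  simp [eq_comm, conj_eq_one_iff]

theorem IsCl.smul {k : Type*} [CommRing k] {a : MonoidAlgebra k G} (c : k) (ha : IsCl a) : IsCl (c • a) := by
  intro x g
  simp only [coeff_smul, Finsupp.smul_apply]
  rw [ha]

theorem IsCl.pow {k : Type*} [CommRing k] {a : MonoidAlgebra k G} (ha : IsCl a) (n : ℕ) : IsCl (a ^ n) := by
  induction n with
  | zero => rw [pow_zero]; exact IsCl.one
  | succ n ih => rw [pow_succ]; exact ih.mul ha

/-- conjugation action -/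
def cj (Q : Subgroup G) : Q →* Equiv.Perm G := (MulAut.toPerm G).comp (MulAut.conj.comp Q.subtype)

theorem cj_apply (Q : Subgroup G) (u : Q) (x : G) : cj Q u x = u * x * (u : G)⁻¹ := rfl

theorem cj_fixed (Q : Subgroup G) (x : G) : (∀ u, cj Q u x = x) ↔ x ∈ Subgroup.centralizer (Q : Set G) := by
  rw [Subgroup.mem_centralizer_iff]
  constructor
  · intro h u hu
    have := h ⟨u, hu⟩
    rw [cj_apply] at this
    exact mul_inv_eq_iff_eq_mul.1 this
  · intro h u
    rw [cj_apply, h u u.2]; group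

theorem zmod_nsmul {M : Type*} [AddCommGroup M] [Module (ZMod p) M] (m : M) : p • m = 0 := by
  rw [← Nat.cast_smul_eq_nsmul (ZMod p)]; simp

theorem br_mul (Q : Subgroup G) (hQ : IsPGroup p Q) {a b : MonoidAlgebra (ZMod p) G} (ha : IsCl a) (hb : IsCl b) :
    br Q (a * b) = br Q a * br Q b := by
  ext g
  rw [coeff_br, coeff_mul_fin (br Q a) (br Q b)]
  simp only [coeff_br]
  split_ifs with hg
  · rw [coeff_mul_fin, psum hQ (cj Q) zmod_nsmul, Finset.sum_filter]
    · refine Finset.sum_congr rfl (fun x _ => ?_)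
      simp only [cj_fixed]
      split_ifs with h1 h2 h2
      · rfl
      · exact absurd (Subgroup.mul_mem _ (Subgroup.inv_mem _ h1) hg) h2
      · simp
      · simp
    · intro u x
      rw [cj_apply, ha]
      congr 1
      have : (u * x * (u : G)⁻¹)⁻¹ * g = u * (x⁻¹ * g) * (u : G)⁻¹ := by
        have := Subgroup.mem_centralizer_iff.1 hg u u.2
        calc _ = u * x⁻¹ * ((u : G)⁻¹ * (g * u)) * (u : G)⁻¹ := by group
          _ = _ := by rw [← this]; group
      rw [this, hb]
  · symm
    refine Finset.sum_eq_zero (fun x _ => ?_)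
    split_ifs with h1 h2
    · exfalso
      apply hg
      have := Subgroup.mul_mem _ h1 h2
      simpa using this
    · simp
    · simp
    · simp

theorem br_one (Q : Subgroup G) : br Q (1 : MonoidAlgebra (ZMod p) G) = 1 := by
  ext g
  rw [coeff_br]
  simp only [one_def, coeff_single, Finsupp.single_apply]
  split_ifs with h1 h2 h2
  · rfl
  · rfl
  · subst h2; exact absurd (Subgroup.one_mem _) h1
  · rfl

theorem br_pow (Q : Subgroup G) (hQ : IsPGroup p Q) {a : MonoidAlgebra (ZMod p) G} (ha : IsCl a) (n : ℕ) :
    br Q (a ^ n) = br Q a ^ n := by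
  induction n with
  | zero => rw [pow_zero, pow_zero, br_one]
  | succ n ih => rw [pow_succ, pow_succ, br_mul Q hQ (ha.pow n) ha, ih]

theorem br_sub (Q : Subgroup G) (a b : MonoidAlgebra (ZMod p) G) : br Q (a - b) = br Q a - br Q b := by
  ext g
  simp only [coeff_br, coeff_sub, Finsupp.sub_apply]
  split_ifs <;> simp

theorem br_smul (Q : Subgroup G) (c : ZMod p) (a : MonoidAlgebra (ZMod p) G) : br Q (c • a) = c • br Q a := by
  ext g
  simp only [coeff_br, coeff_smul, Finsupp.smul_apply]
  split_ifs <;> simp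

theorem nil_desc (Q Q' : Subgroup G) (hQ' : IsPGroup p Q') (hle : Q ≤ Q') (hn : Q' ≤ Subgroup.normalizer (Q : Set G))
    (hC : Subgroup.centralizer (Q : Set G) ≤ Subgroup.normalizer (Q' : Set G)) {a : MonoidAlgebra (ZMod p) G} (ha : IsCl a)
    (hnil : IsNilpotent (br Q' a)) : IsNilpotent (br Q a) := by
  set A := br Q a with hA
  obtain ⟨m, hm⟩ := hnil
  -- A commutes with Q'
  have hAu : ∀ u ∈ Q', single u (1 : ZMod p) * A = A * single u 1 := by
    intro u hu
    ext g
    rw [coeff_single_mul_apply, coeff_mul_single_apply, one_mul, mul_one, hA, coeff_br, coeff_br]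
    have h1 : coeff a (u⁻¹ * g) = coeff a (g * u⁻¹) := by
      rw [← ha u (u⁻¹ * g)]; congr 1; group
    have h2 : u⁻¹ * g ∈ Subgroup.centralizer (Q : Set G) ↔ g * u⁻¹ ∈ Subgroup.centralizer (Q : Set G) := by
      have hnorm : ∀ v ∈ Q', ∀ x ∈ Subgroup.centralizer (Q : Set G), v * x * v⁻¹ ∈ Subgroup.centralizer (Q : Set G) := by
        intro v hv x hx
        rw [Subgroup.mem_centralizer_iff] at *
        intro q hq
        have h3 : v⁻¹ * q * v ∈ Q := by
          have := (Subgroup.mem_normalizer_iff.1 (Subgroup.inv_mem _ (hn hv)) q).1 hq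
          simpa using this
        have h4 := hx _ h3
        calc q * (v * x * v⁻¹) = v * ((v⁻¹ * q * v) * x) * v⁻¹ := by group
          _ = v * (x * (v⁻¹ * q * v)) * v⁻¹ := by rw [h4]
          _ = _ := by group
      constructor
      · intro h
        have := hnorm u hu _ h
        have e : u * (u⁻¹ * g) * u⁻¹ = g * u⁻¹ := by group
        rwa [e] at this
      · intro h
        have := hnorm u⁻¹ (Q'.inv_mem hu) _ h
        have e : u⁻¹ * (g * u⁻¹) * u⁻¹⁻¹ = u⁻¹ * g := by group
        rwa [e] at this
    rw [h1]
    simp only [h2]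
  have hAu' : ∀ n, ∀ u ∈ Q', single u (1 : ZMod p) * A ^ n = A ^ n * single u 1 := by
    intro n u hu
    exact (Commute.pow_right (hAu u hu) n)
  -- action on fixed vectors
  have hfix : ∀ w : MonoidAlgebra (ZMod p) G, (∀ u ∈ Q', single u (1 : ZMod p) * w = w) → A * w = br Q' a * w := by
    intro w hw
    rw [hA, br, br, Finset.sum_mul, Finset.sum_mul]
    let f : G → MonoidAlgebra (ZMod p) G := fun g => if g ∈ Subgroup.centralizer (Q : Set G) then single g (coeff a g) * w else 0
    have h1 : ∑ g ∈ Finset.univ.filter (fun g => g ∈ Subgroup.centralizer (Q : Set G)), single g (coeff a g) * w = ∑ g, f g := by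
      rw [Finset.sum_filter]
    rw [h1, psum hQ' (cj Q') zmod_nsmul]
    · simp only [cj_fixed]
      refine Finset.sum_congr rfl (fun g hg => ?_)
      have hg' := (Finset.mem_filter.1 hg).2
      simp only [f]
      rw [if_pos (Subgroup.centralizer_le hle hg')]
    · intro u g
      rw [cj_apply]
      have hiff : u * g * (u : G)⁻¹ ∈ Subgroup.centralizer (Q : Set G) ↔ g ∈ Subgroup.centralizer (Q : Set G) := by
        have hnorm : ∀ v ∈ Q', ∀ x ∈ Subgroup.centralizer (Q : Set G), v * x * v⁻¹ ∈ Subgroup.centralizer (Q : Set G) := by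
          intro v hv x hx
          rw [Subgroup.mem_centralizer_iff] at *
          intro q hq
          have h3 : v⁻¹ * q * v ∈ Q := by
            have := (Subgroup.mem_normalizer_iff.1 (Subgroup.inv_mem _ (hn hv)) q).1 hq
            simpa using this
          have h4 := hx _ h3
          calc q * (v * x * v⁻¹) = v * ((v⁻¹ * q * v) * x) * v⁻¹ := by group
            _ = v * (x * (v⁻¹ * q * v)) * v⁻¹ := by rw [h4]
            _ = _ := by group
        constructor
        · intro h
          have := hnorm _ (Q'.inv_mem u.2) _ h
          have e : (u : G)⁻¹ * (u * g * (u : G)⁻¹) * (u : G)⁻¹⁻¹ = g := by group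
          rwa [e] at this
        · exact hnorm u u.2 g
      simp only [f, hiff]
      split_ifs with hg
      · rw [ha]
        have hgn := hC hg
        have e1 : single (u * g * (u : G)⁻¹) (coeff a g) = single (g * (g⁻¹ * u * g)) (1 : ZMod p) * (single ((u : G)⁻¹) (coeff a g)) := by
          rw [single_mul_single, one_mul]; congr 1; group
        have e2 : single ((u : G)⁻¹) (coeff a g) * w = (coeff a g) • w := by
          have : single ((u : G)⁻¹) (coeff a g) = (coeff a g) • single ((u : G)⁻¹) (1 : ZMod p) := by
            rw [smul_single, smul_eq_mul, mul_one]
          rw [this, smul_mul_assoc, hw _ (Q'.inv_mem u.2)]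
        have e3 : single (g * (g⁻¹ * u * g)) (1 : ZMod p) = single g 1 * single (g⁻¹ * u * g) 1 := by
          rw [single_mul_single, one_mul]
        have e4 : g⁻¹ * u * g ∈ Q' := by
          have := (Subgroup.mem_normalizer_iff.1 (Subgroup.inv_mem _ hgn) u).1 u.2
          simpa using this
        have e5 : single g (coeff a g) = (coeff a g) • single g (1 : ZMod p) := by
          rw [smul_single, smul_eq_mul, mul_one]
        rw [e1, mul_assoc, e2, e3, mul_smul_comm, mul_assoc, hw _ e4, e5, smul_mul_assoc]
      · rfl
  -- stable range
  let T : MonoidAlgebra (ZMod p) G →ₗ[ZMod p] MonoidAlgebra (ZMod p) G := LinearMap.mulLeft (ZMod p) A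
  have hfin : Module.Finite (ZMod p) (MonoidAlgebra (ZMod p) G) := inferInstance
  obtain ⟨k, -, hk⟩ := Module.End.exists_ker_pow_eq_ker_pow_succ T
  have hTp : ∀ n x, (T ^ n) x = A ^ n * x := by
    intro n
    induction n with
    | zero => intro x; simp
    | succ n ih => intro x; rw [pow_succ, Module.End.mul_apply, ih, pow_succ, mul_assoc]; rfl
  let N : Submodule (ZMod p) (MonoidAlgebra (ZMod p) G) := LinearMap.range (T ^ k)
  have hNmem : ∀ w, w ∈ N ↔ ∃ x, A ^ k * x = w := by
    intro w
    simp only [N, LinearMap.mem_range, hTp]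
  have hinj : ∀ w ∈ N, A * w = 0 → w = 0 := by
    intro w hw h0
    obtain ⟨x, rfl⟩ := (hNmem w).1 hw
    have : x ∈ LinearMap.ker (T ^ (k + 1)) := by
      rw [LinearMap.mem_ker, hTp, pow_succ', mul_assoc, h0]
    rw [← hk, LinearMap.mem_ker, hTp] at this
    exact this
  have hstab : ∀ w ∈ N, A * w ∈ N := by
    intro w hw
    obtain ⟨x, rfl⟩ := (hNmem w).1 hw
    exact (hNmem _).2 ⟨A * x, by rw [← mul_assoc, ← mul_assoc, ← pow_succ, ← pow_succ']⟩
  have hinj' : ∀ n, ∀ w ∈ N, A ^ n * w = 0 → w = 0 := by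
    intro n
    induction n with
    | zero => intro w _ h; simpa using h
    | succ n ih =>
      intro w hw h
      rw [pow_succ, mul_assoc] at h
      exact hinj w hw (ih _ (hstab w hw) h)
  have hfixN : ∀ w ∈ N, (∀ u ∈ Q', single u (1 : ZMod p) * w = w) → w = 0 := by
    intro w hw hu
    apply hinj' m w hw
    have : ∀ n, A ^ n * w = br Q' a ^ n * w ∧ ∀ u ∈ Q', single u (1 : ZMod p) * (A ^ n * w) = A ^ n * w := by
      intro n
      have h2 : ∀ n, ∀ u ∈ Q', single u (1 : ZMod p) * (A ^ n * w) = A ^ n * w := by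
        intro n u hu'
        rw [← mul_assoc, hAu' n u hu', mul_assoc, hu u hu']
      refine ⟨?_, h2 n⟩
      induction n with
      | zero => simp
      | succ n ih =>
        rw [pow_succ', mul_assoc, hfix _ (h2 n), ih, pow_succ', mul_assoc]
    rw [(this m).1, hm, zero_mul]
  have hN0 : N = ⊥ := by
    by_contra hne
    obtain ⟨w₀, hw₀, hw₀0⟩ := Submodule.exists_mem_ne_zero_of_ne_bot hne
    letI act : MulAction Q' N :=
      { smul := fun u w => ⟨single (u : G) (1 : ZMod p) * w.1, by
          obtain ⟨x, hx⟩ := (hNmem w.1).1 w.2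
          refine (hNmem _).2 ⟨single (u : G) (1 : ZMod p) * x, ?_⟩
          rw [← mul_assoc, ← hAu' k u u.2, mul_assoc, hx]⟩
        one_smul := fun w => Subtype.ext (by
          change single ((1 : Q') : G) (1 : ZMod p) * w.1 = w.1
          rw [Subgroup.coe_one, ← one_def, one_mul])
        mul_smul := fun u v w => Subtype.ext (by
          change single ((u * v : Q') : G) (1 : ZMod p) * w.1 = single (u : G) (1 : ZMod p) * (single (v : G) (1 : ZMod p) * w.1)
          rw [← mul_assoc, single_mul_single, one_mul, Subgroup.coe_mul]) }
    have : Finite (MonoidAlgebra (ZMod p) G) := Module.finite_of_finite (ZMod p)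
    have hdvd : p ∣ Nat.card N := by
      have hne0 : (⟨w₀, hw₀⟩ : N) ≠ 0 := fun h => hw₀0 (congrArg Subtype.val h)
      have : addOrderOf (⟨w₀, hw₀⟩ : N) = p := addOrderOf_eq_prime (zmod_nsmul _) hne0
      have h5 := addOrderOf_dvd_natCard (⟨w₀, hw₀⟩ : N)
      rwa [this] at h5
    obtain ⟨w, hw, hw0⟩ := hQ'.exists_fixed_point_of_prime_dvd_card_of_fixed_point N hdvd (a := 0) (by
      intro u
      apply Subtype.ext
      change single (u : G) (1 : ZMod p) * 0 = 0
      rw [mul_zero])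
    apply hw0
    have := hfixN w.1 w.2 (fun u hu => congrArg Subtype.val (hw ⟨u, hu⟩))
    exact Subtype.ext this.symm
  refine ⟨k, ?_⟩
  have : A ^ k * 1 ∈ N := (hNmem _).2 ⟨1, rfl⟩
  rw [hN0, Submodule.mem_bot, mul_one] at this
  exact this

theorem nil_ext (Qs : Subgroup G) (hQs : IsPGroup p Qs) {a : MonoidAlgebra (ZMod p) G} (ha : IsCl a)
    (hnil : IsNilpotent (br Qs a)) (n : ℕ) : ∀ (Q : Subgroup G), Nat.card Qs - Nat.card Q ≤ n → Q ≤ Qs →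
    Subgroup.centralizer (Q : Set G) ≤ Subgroup.normalizer (Qs : Set G) → IsNilpotent (br Q a) := by
  induction n with
  | zero =>
    intro Q hn hle _
    have : Q = Qs := Subgroup.eq_of_le_of_card_ge hle (by omega)
    rw [this]; exact hnil
  | succ n ih =>
    intro Q hn hle hC
    by_cases heq : Q = Qs
    · rw [heq]; exact hnil
    let Q1 : Subgroup G := Subgroup.normalizer (Q : Set G) ⊓ Qs
    have hQ1 : Q ≤ Q1 := le_inf Subgroup.le_normalizer hle
    have hlt : Q < Q1 := by
      have : Group.IsNilpotent Qs := hQs.isNilpotent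
      have hnc := Group.normalizerCondition_of_isNilpotent (G := Qs)
      have h1 : Q.subgroupOf Qs < ⊤ := by
        rw [lt_top_iff_ne_top]
        intro h
        exact heq (le_antisymm hle (Subgroup.subgroupOf_eq_top.1 h))
      have h2 := hnc _ h1
      obtain ⟨x, hx, hxn⟩ := SetLike.exists_of_lt h2
      refine lt_of_le_of_ne hQ1 (fun h => hxn ?_)
      rw [Subgroup.mem_subgroupOf, h]
      refine ⟨?_, x.2⟩
      change (x : G) ∈ Subgroup.normalizer (Q : Set G)
      rw [Subgroup.mem_normalizer_iff] at hx ⊢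
      intro y
      constructor
      · intro hy
        exact (hx ⟨y, hle hy⟩).1 hy
      · intro hy
        have hy' : y ∈ Qs := by
          have h3 := Qs.mul_mem (Qs.mul_mem (Qs.inv_mem x.2) (hle hy)) x.2
          have e : (x : G)⁻¹ * (x * y * (x : G)⁻¹) * x = y := by group
          rwa [e] at h3
        exact (hx ⟨y, hy'⟩).2 hy
    have hcard : Nat.card Q < Nat.card Q1 := by
      have : (Q : Set G) ⊂ Q1 := hlt
      exact Set.ncard_lt_ncard this
    have h1 : IsNilpotent (br Q1 a) := by
      refine ih Q1 (by omega) inf_le_right ?_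
      exact (Subgroup.centralizer_le hQ1).trans hC
    refine nil_desc Q Q1 (hQs.to_le inf_le_right) hQ1 inf_le_left ?_ ha h1
    intro g hg
    have hg1 := hC hg
    rw [Subgroup.mem_centralizer_iff] at hg
    have hgQ : ∀ q ∈ Q, g * q * g⁻¹ = q := fun q hq => by rw [← hg q hq]; group
    have key : ∀ g : G, g ∈ Subgroup.normalizer (Qs : Set G) → (∀ q ∈ Q, g * q * g⁻¹ = q) → ∀ y ∈ Q1, g * y * g⁻¹ ∈ Q1 := by
      intro g hg1 hgQ y hy
      have hgn : g ∈ Subgroup.normalizer (Q : Set G) := by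
        rw [Subgroup.mem_normalizer_iff]
        intro q
        constructor
        · intro hq
          have h3 : g * q * g⁻¹ = q := hgQ q hq
          rw [h3]; exact hq
        · intro hq
          have h3 := hgQ _ hq
          have h4 : g * q * g⁻¹ = q := by
            have := mul_left_cancel (a := g) (mul_right_cancel (b := g⁻¹) (h3 : g * (g * q * g⁻¹) * g⁻¹ = g * q * g⁻¹))
            exact this
          rwa [h4] at hq
      refine ⟨Subgroup.mul_mem _ (Subgroup.mul_mem _ hgn hy.1) (Subgroup.inv_mem _ hgn), ?_⟩
      exact (Subgroup.mem_normalizer_iff.1 hg1 y).1 hy.2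
    rw [Subgroup.mem_normalizer_iff]
    intro y
    refine ⟨key g hg1 hgQ y, fun h => ?_⟩
    have := key g⁻¹ (Subgroup.inv_mem _ hg1) (fun q hq => by
      have := hgQ q hq
      rw [inv_inv]
      calc g⁻¹ * q * g = g⁻¹ * (g * q * g⁻¹) * g := by rw [this]
        _ = q := by group) _ h
    have e : g⁻¹ * (g * y * g⁻¹) * g⁻¹⁻¹ = y := by group
    rwa [e] at this
end B1
end PX

namespace PX
section B2
open MonoidAlgebra
open scoped Classical

theorem bez {m d' : ℕ} (hc : Nat.Coprime d' m) {w α : ℂ} (hw : IsIntegral ℤ w) (hα : IsIntegral ℤ α)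
    (h : (d' : ℂ) * w = m * α) : ∃ γ : ℂ, IsIntegral ℤ γ ∧ w = m * γ := by
  have hb := Nat.gcd_eq_gcd_ab d' m
  rw [Nat.coprime_iff_gcd_eq_one.1 hc] at hb
  refine ⟨(Nat.gcdA d' m : ℤ) * α + (Nat.gcdB d' m : ℤ) * w, ?_, ?_⟩
  · exact ((isIntegral_algebraMap (R := ℤ) (A := ℂ) (x := Nat.gcdA d' m)).mul hα).add
      ((isIntegral_algebraMap (R := ℤ) (A := ℂ) (x := Nat.gcdB d' m)).mul hw)
  · have hb' : (1 : ℂ) = d' * (Nat.gcdA d' m : ℤ) + m * (Nat.gcdB d' m : ℤ) := by exact_mod_cast hb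
    calc w = 1 * w := (one_mul w).symm
      _ = (d' * (Nat.gcdA d' m : ℤ) + m * (Nat.gcdB d' m : ℤ)) * w := by rw [← hb']
      _ = (Nat.gcdA d' m : ℤ) * (d' * w) + m * (Nat.gcdB d' m : ℤ) * w := by ring
      _ = _ := by rw [h]; ring

variable {G : Type*} [Group G] [Fintype G] {p : ℕ} [Fact p.Prime]

/-- local structure hypothesis -/
def HB (p : ℕ) (G : Type*) [Group G] : Prop :=
  ∀ x : G, x ∉ Subgroup.center G → x ^ p ∈ Subgroup.center G → (∃ k, x ^ p ^ k = 1) →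
    ∃ Q : Subgroup G, IsPGroup p Q ∧ x ∈ Q ∧
      Subgroup.centralizer {x} ≤ Subgroup.normalizer (Q : Set G) ∧
      Subgroup.centralizer (Q : Set G) ≤ Q ⊔ Subgroup.center G

theorem center_le_normalizer (U : Subgroup G) : Subgroup.center G ≤ Subgroup.normalizer (U : Set G) := by
  intro z hz
  rw [Subgroup.mem_normalizer_iff]
  intro y
  have : z * y * z⁻¹ = y := by
    rw [← Subgroup.mem_center_iff.1 hz y]; group
  rw [this]

theorem nil_at (hB : HB p G) {a : MonoidAlgebra (ZMod p) G} (ha : IsCl a)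
    (hU : ∀ U : Sylow p G, IsNilpotent (br (U : Subgroup G) a)) {x : G} (h1 : x ∉ Subgroup.center G)
    (h2 : x ^ p ∈ Subgroup.center G) (h3 : ∃ k, x ^ p ^ k = 1) : IsNilpotent (br (Subgroup.zpowers x) a) := by
  obtain ⟨Q, hQ, hxQ, hCx, hCQ⟩ := hB x h1 h2 h3
  obtain ⟨U, hUQ⟩ := hQ.exists_le_sylow
  have n1 : IsNilpotent (br Q a) := by
    refine nil_ext (U : Subgroup G) U.isPGroup' ha (hU U) _ Q le_rfl hUQ ?_
    refine hCQ.trans (sup_le (hUQ.trans Subgroup.le_normalizer) (center_le_normalizer _))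
  refine nil_ext Q hQ ha n1 _ (Subgroup.zpowers x) le_rfl (by simpa using hxQ) ?_
  refine le_trans ?_ hCx
  exact Subgroup.centralizer_le (by simp)

theorem nil_unif (hB : HB p G) {a : MonoidAlgebra (ZMod p) G} (ha : IsCl a)
    (hU : ∀ U : Sylow p G, IsNilpotent (br (U : Subgroup G) a)) : ∃ N, ∀ x : G, x ∉ Subgroup.center G → 
    x ^ p ∈ Subgroup.center G → (∃ k, x ^ p ^ k = 1) → ∀ g, g * x = x * g → coeff (a ^ N) g = 0 := by
  have : ∀ x : G, ∃ N, x ∉ Subgroup.center G → 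
    x ^ p ∈ Subgroup.center G → (∃ k, x ^ p ^ k = 1) → br (Subgroup.zpowers x) a ^ N = 0 := by
    intro x
    by_cases h : x ∉ Subgroup.center G ∧ x ^ p ∈ Subgroup.center G ∧ (∃ k, x ^ p ^ k = 1)
    · obtain ⟨N, hN⟩ := nil_at hB ha hU h.1 h.2.1 h.2.2
      exact ⟨N, fun _ _ _ => hN⟩
    · exact ⟨0, fun h1 h2 h3 => absurd ⟨h1, h2, h3⟩ h⟩
  choose N hN using this
  refine ⟨∑ x, N x, fun x h1 h2 h3 g hg => ?_⟩
  have hpx : IsPGroup p (Subgroup.zpowers x) := by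
    obtain ⟨k, hk⟩ := h3
    intro y
    refine ⟨k, ?_⟩
    obtain ⟨y, m, rfl⟩ := y
    apply Subtype.ext
    simp only [Subgroup.coe_pow, Subgroup.coe_one]
    change (x ^ m) ^ p ^ k = 1
    rw [← zpow_natCast, zpow_comm, zpow_natCast, hk, one_zpow]
  have h4 : br (Subgroup.zpowers x) (a ^ (∑ x, N x)) = 0 := by
    rw [br_pow _ hpx ha]
    exact pow_eq_zero_of_le (Finset.single_le_sum (fun i _ => Nat.zero_le (N i)) (Finset.mem_univ x)) (hN x h1 h2 h3)
  have h5 := congrArg (fun b => coeff b g) h4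
  simp only [coeff_br] at h5
  rw [if_pos] at h5
  · simpa using h5
  · rw [Subgroup.mem_centralizer_iff]
    rintro y ⟨m, rfl⟩
    exact ((show Commute g x from hg).zpow_right m).eq.symm

theorem exists_x (g : G) (s : ℕ) (hs : Nat.card G = Nat.card (Subgroup.center G) * s)
    (hno : ¬ ∃ x : G, x ∉ Subgroup.center G ∧ x ^ p ∈ Subgroup.center G ∧ (∃ k, x ^ p ^ k = 1) ∧ g * x = x * g) :
    p ^ (s.factorization p) * cc ⊤ g ∣ Nat.card G * (cc ⊤ g / p ^ (cc ⊤ g).factorization p) := by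
  have hp : p.Prime := Fact.out
  let C : Subgroup G := ⊤ ⊓ Subgroup.centralizer {g}
  obtain ⟨P⟩ : Nonempty (Sylow p C) := inferInstance
  have hPZ : (P : Subgroup C).map C.subtype ≤ Subgroup.center G := by
    rintro y ⟨x, hx, rfl⟩
    by_contra hxc
    apply hno
    obtain ⟨k, hk⟩ := P.isPGroup' ⟨x, hx⟩
    have hk' : (x : G) ^ p ^ k = 1 := congrArg (fun t => ((t : C) : G)) (congrArg Subtype.val hk)
    have hex : ∃ i, (x : G) ^ p ^ i ∈ Subgroup.center G := ⟨k, by rw [hk']; exact Subgroup.one_mem _⟩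
    have hpos : Nat.find hex ≠ 0 := by
      intro h0
      have := Nat.find_spec hex
      rw [h0, pow_zero, pow_one] at this
      exact hxc this
    obtain ⟨i, hi⟩ := Nat.exists_eq_succ_of_ne_zero hpos
    refine ⟨(x : G) ^ p ^ i, Nat.find_min hex (by omega), ?_, ⟨k, ?_⟩, ?_⟩
    · rw [← pow_mul, ← pow_succ]
      have := Nat.find_spec hex
      rwa [hi] at this
    · rw [← pow_mul, mul_comm, pow_mul, hk', one_pow]
    · have : (x : G) ∈ Subgroup.centralizer {g} := x.2.2
      rw [Subgroup.mem_centralizer_singleton_iff] at this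
      exact (Commute.pow_right (show Commute g x from this.symm) _)
  have hcard : p ^ (cc ⊤ g).factorization p ∣ Nat.card (Subgroup.center G) := by
    have h1 := Subgroup.card_dvd_of_le hPZ
    rw [Subgroup.card_map_of_injective C.subtype_injective] at h1
    have h2 := P.card_eq_multiplicity
    rw [show Nat.card C = cc ⊤ g from rfl] at h2
    rw [← h2]; exact h1
  obtain ⟨u, hu⟩ := hcard
  have hcc : cc ⊤ g = p ^ (cc ⊤ g).factorization p * (cc ⊤ g / p ^ (cc ⊤ g).factorization p) :=
    (Nat.ordProj_mul_ordCompl_eq_self _ _).symm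
  obtain ⟨s', hs'⟩ := Nat.ordProj_dvd s p
  refine ⟨u * s', ?_⟩
  rw [hs, hu]
  generalize cc ⊤ g / p ^ (cc ⊤ g).factorization p = t at *
  nth_rewrite 1 [hs']
  generalize (cc ⊤ g).factorization p = w at *
  rw [hcc]
  ring

theorem block {d : ℕ} (hd : d ≠ 0) {ρ : G →* Matrix (Fin d) (Fin d) ℂ} (hS : ScalarComm ⊤ ρ) (hB : HB p G)
    (s : ℕ) (hs : Nat.card G = Nat.card (Subgroup.center G) * s) (hb : d.factorization p < s.factorization p)
    (a : MonoidAlgebra ℤ G) (ha : IsCl a) (c : ℤ)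
    (hU : ∀ U : Sylow p G, IsNilpotent (br (U : Subgroup G) (mapRingHom G (Int.castRingHom (ZMod p)) a - (c : ZMod p) • 1)))
    (ω : ℂ) (hω : ∑ g, (coeff a g : ℂ) • ρ g = ω • (1 : Matrix (Fin d) (Fin d) ℂ)) :
    ∃ (N : ℕ) (γ : ℂ), IsIntegral ℤ γ ∧ (ω - c) ^ N = p * γ := by
  have hp : p.Prime := Fact.out
  have hne : Nonempty (Fin d) := ⟨⟨0, Nat.pos_of_ne_zero hd⟩⟩
  have hd' : (d : ℂ) ≠ 0 := by exact_mod_cast hd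
  let π := mapRingHom G (Int.castRingHom (ZMod p))
  have hπ : ∀ (b : MonoidAlgebra ℤ G) g, coeff (π b) g = (coeff b g : ZMod p) := by
    intro b g
    simp [π]
  have haπ : IsCl (π a - (c : ZMod p) • 1) := by
    refine IsCl.sub (fun x g => ?_) (IsCl.smul _ IsCl.one)
    rw [hπ, hπ, ha]
  obtain ⟨N, hN⟩ := nil_unif hB haπ hU
  let B : MonoidAlgebra ℤ G := (a - c • 1) ^ N
  have hBcl : IsCl B := (ha.sub (IsCl.smul c IsCl.one)).pow N
  have hπB : π B = (π a - (c : ZMod p) • 1) ^ N := by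
    simp only [B, map_pow, map_sub]
    congr 2
    rw [map_zsmul, map_one, Int.cast_smul_eq_zsmul]
  -- the representation of the group ring
  let R : MonoidAlgebra ℤ G →+* Matrix (Fin d) (Fin d) ℂ := (MonoidAlgebra.lift ℤ _ G ρ : _ →ₐ[ℤ] _)
  have hR : ∀ b, R b = ∑ g, (coeff b g : ℂ) • ρ g := by
    intro b
    change MonoidAlgebra.lift ℤ _ G ρ b = _
    rw [MonoidAlgebra.lift_apply, Finsupp.sum_fintype]
    · refine Finset.sum_congr rfl (fun g _ => ?_)
      rw [Int.cast_smul_eq_zsmul]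
    · intro i; simp
  have h1 : ∑ g, (coeff B g : ℂ) • ρ g = ((ω - c) ^ N) • (1 : Matrix (Fin d) (Fin d) ℂ) := by
    rw [← hR]
    simp only [B, map_pow, map_sub, map_zsmul, map_one]
    rw [hR, hω, ← Int.cast_smul_eq_zsmul ℂ, ← sub_smul, smul_pow, one_pow]
  have h2 := congrArg Matrix.trace h1
  simp only [Matrix.trace_sum, Matrix.trace_smul, Matrix.trace_one, Fintype.card_fin, smul_eq_mul] at h2
  have hcls : ∀ K : ConjClasses G, ∃ γ : ℂ, IsIntegral ℤ γ ∧
      ∑ g ∈ Finset.univ.filter (fun g => ConjClasses.mk g = K), (coeff B g : ℂ) * (ρ g).trace = d * (p * γ) := by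
    intro K
    obtain ⟨g, rfl⟩ := ConjClasses.exists_rep K
    have himg : Finset.univ.filter (fun x => ConjClasses.mk x = ConjClasses.mk g) =
        Finset.univ.image (fun l : (⊤ : Subgroup G) => (l : G) * g * (l : G)⁻¹) := by
      ext x
      simp only [Finset.mem_filter, Finset.mem_univ, true_and, Finset.mem_image, ConjClasses.mk_eq_mk_iff_isConj]
      rw [isConj_comm, isConj_iff]
      constructor
      · rintro ⟨l, hl⟩; exact ⟨⟨l, trivial⟩, hl⟩
      · rintro ⟨l, hl⟩; exact ⟨l, hl⟩
    have hcard := card_conj (⊤ : Subgroup G) g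
    rw [← himg] at hcard
    have hsum : ∑ x ∈ Finset.univ.filter (fun x => ConjClasses.mk x = ConjClasses.mk g), (coeff B x : ℂ) * (ρ x).trace
        = (Finset.univ.filter (fun x => ConjClasses.mk x = ConjClasses.mk g)).card * ((coeff B g : ℂ) * (ρ g).trace) := by
      rw [Finset.sum_congr rfl (g := fun _ => (coeff B g : ℂ) * (ρ g).trace), Finset.sum_const, nsmul_eq_mul]
      intro x hx
      rw [himg] at hx
      obtain ⟨l, _, rfl⟩ := Finset.mem_image.1 hx
      rw [hBcl, map_mul, Matrix.trace_mul_comm, ← map_mul]; simp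
    rw [hsum]
    set k := (Finset.univ.filter (fun x => ConjClasses.mk x = ConjClasses.mk g)).card with hk
    have hcc : (cc ⊤ g : ℂ) ≠ 0 := by exact_mod_cast (cc_pos ⊤ g).ne'
    have hint := omega_integral hd hS g
    rw [hcard] at hint
    push_cast at hint
    rw [mul_div_cancel_left₀ _ hcc] at hint
    have hBint : IsIntegral ℤ (coeff B g : ℂ) := isIntegral_algebraMap (R := ℤ) (A := ℂ)
    by_cases hx : ∃ x : G, x ∉ Subgroup.center G ∧ x ^ p ∈ Subgroup.center G ∧ (∃ k, x ^ p ^ k = 1) ∧ g * x = x * g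
    · obtain ⟨x, h1, h2, h3, h4⟩ := hx
      have := hN x h1 h2 h3 g h4
      rw [← hπB, hπ, ZMod.intCast_zmod_eq_zero_iff_dvd] at this
      obtain ⟨t, ht⟩ := this
      refine ⟨t * (k * (ρ g).trace / d), (isIntegral_algebraMap (R := ℤ) (A := ℂ) (x := t)).mul hint, ?_⟩
      rw [ht]
      push_cast
      field_simp
    · have hdv := exists_x g s hs hx
      rw [← Subgroup.card_top (G := G), hcard, show p ^ s.factorization p * cc ⊤ g = cc ⊤ g * p ^ s.factorization p by ring, Nat.mul_assoc] at hdv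
      have hdv2 := Nat.dvd_of_mul_dvd_mul_left (cc_pos ⊤ g) hdv
      have hcop : Nat.Coprime (p ^ s.factorization p) (cc ⊤ g / p ^ (cc ⊤ g).factorization p) :=
        (Nat.coprime_ordCompl hp (cc_pos ⊤ g).ne').pow_left _
      obtain ⟨k', hk'⟩ := hcop.dvd_of_dvd_mul_right hdv2
      have hdd : d = p ^ d.factorization p * (d / p ^ d.factorization p) := (Nat.ordProj_mul_ordCompl_eq_self _ _).symm
      set d' := d / p ^ d.factorization p with hd'def
      obtain ⟨e, he⟩ := Nat.exists_eq_add_of_lt hb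
      have hp0 : (p : ℂ) ≠ 0 := by exact_mod_cast hp.ne_zero
      have hd'0 : (d' : ℂ) ≠ 0 := by
        intro h0
        apply hd'
        rw [hdd]; push_cast; rw [h0, mul_zero]
      obtain ⟨γ, hγ, hγ2⟩ := bez (m := p) (d' := d') (Nat.coprime_ordCompl hp hd).symm hint
        (α := (p ^ e * k' : ℕ) * (ρ g).trace) ((isIntegral_algebraMap (R := ℤ) (A := ℂ) (x := ((p ^ e * k' : ℕ) : ℤ))).mul (chi_integral ρ g)) (by
          rw [hk', he]
          have hdc : (d : ℂ) = p ^ d.factorization p * d' := by exact_mod_cast hdd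
          generalize d.factorization p = r at *
          rw [hdc]
          push_cast
          field_simp
          ring)
      refine ⟨coeff B g * γ, hBint.mul hγ, ?_⟩
      calc (k : ℂ) * (coeff B g * (ρ g).trace) = d * (coeff B g * (k * (ρ g).trace / d)) := by field_simp
        _ = _ := by rw [hγ2]; ring
  choose γ hγ hγ2 using hcls
  refine ⟨N, ∑ K, γ K, IsIntegral.sum _ (fun K _ => hγ K), ?_⟩
  apply mul_right_cancel₀ hd'
  rw [← h2, ← Finset.sum_fiberwise_of_maps_to (s := Finset.univ) (t := Finset.univ) (g := ConjClasses.mk) (fun _ _ => Finset.mem_univ _)]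
  rw [Finset.sum_congr rfl (fun K _ => hγ2 K), Finset.mul_sum, Finset.sum_mul]
  refine Finset.sum_congr rfl (fun K _ => by ring)

end B2
end PX

namespace PX
section B3
variable {G S : Type*} [Group G] [Finite G] [Group S] {p : ℕ} [Fact p.Prime]

/-- local structure hypothesis for the simple quotient -/
def HS (p : ℕ) (S : Type*) [Group S] : Prop :=
  ∀ x : S, orderOf x = p → ∃ Q : Subgroup S, IsPGroup p Q ∧ x ∈ Q ∧
      Subgroup.centralizer {x} ≤ Subgroup.normalizer (Q : Set S) ∧
      Subgroup.centralizer (Q : Set S) ≤ Q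

theorem zpowers_pgroup {G : Type*} [Group G] {x : G} (h : ∃ k, x ^ p ^ k = 1) : IsPGroup p (Subgroup.zpowers x) := by
  obtain ⟨k, hk⟩ := h
  intro y
  refine ⟨k, ?_⟩
  obtain ⟨y, m, rfl⟩ := y
  apply Subtype.ext
  simp only [Subgroup.coe_pow, Subgroup.coe_one]
  change (x ^ m) ^ p ^ k = 1
  rw [← zpow_natCast, zpow_comm, zpow_natCast, hk, one_zpow]

theorem HB_of_HS (φ : G →* S) (hφ : Function.Surjective φ) (hker : φ.ker = Subgroup.center G) (hS : HS p S) : HB p G := by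
  intro x hx hxp hxk
  have hp : p.Prime := Fact.out
  have hmem : ∀ g, g ∈ Subgroup.center G ↔ φ g = 1 := by
    intro g; rw [← hker, MonoidHom.mem_ker]
  have hord : orderOf (φ x) = p := by
    apply orderOf_eq_prime
    · rw [← map_pow]; exact (hmem _).1 hxp
    · exact fun h => hx ((hmem _).2 h)
  obtain ⟨Bs, hBs, hxB, hCx, hCB⟩ := hS _ hord
  let T := Bs.comap φ
  obtain ⟨Q0⟩ : Nonempty (Sylow p T) := inferInstance
  have hmap : ∀ b ∈ Bs, ∃ q ∈ (Q0 : Subgroup T), φ q = b := by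
    have hsurj : Function.Surjective (φ.subgroupComap Bs) := φ.subgroupComap_surjective_of_surjective Bs hφ
    have hfin : Finite Bs := Finite.of_surjective _ hsurj
    have h1 := (Q0.mapSurjective hsurj).is_maximal' (Q := ⊤) (hBs.of_equiv Subgroup.topEquiv.symm) le_top
    intro b hb
    have h2 : (⟨b, hb⟩ : Bs) ∈ (⊤ : Subgroup Bs) := trivial
    rw [h1] at h2
    obtain ⟨q, hq, hq2⟩ := h2
    exact ⟨q, hq, congrArg Subtype.val hq2⟩
  have hdec : ∀ t : T, ∃ q ∈ (Q0 : Subgroup T), ∃ z ∈ Subgroup.center G, (t : G) = q * z := by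
    intro t
    obtain ⟨q, hq, hqt⟩ := hmap (φ t) t.2
    refine ⟨q, hq, (q : G)⁻¹ * t, ?_, by group⟩
    rw [hmem, map_mul, map_inv, hqt, inv_mul_cancel]
  have hnorm : ∀ t : T, ∀ q ∈ (Q0 : Subgroup T), t * q * t⁻¹ ∈ (Q0 : Subgroup T) := by
    intro t q hq
    obtain ⟨u, hu, z, hz, ht⟩ := hdec t
    have : t * q * t⁻¹ = u * q * u⁻¹ := by
      apply Subtype.ext
      simp only [Subgroup.coe_mul, Subgroup.coe_inv, ht]
      have := Subgroup.mem_center_iff.1 hz q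
      calc (u : G) * z * q * (u * z)⁻¹ = u * (z * q) * z⁻¹ * (u : G)⁻¹ := by group
        _ = u * (q * z) * z⁻¹ * (u : G)⁻¹ := by rw [this]
        _ = _ := by group
    rw [this]
    exact Subgroup.mul_mem _ (Subgroup.mul_mem _ hu hq) (Subgroup.inv_mem _ hu)
  have hpel : ∀ t : T, (∃ k, t ^ p ^ k = 1) → t ∈ (Q0 : Subgroup T) := by
    intro t ht
    have h1 : IsPGroup p (Subgroup.zpowers t ⊔ (Q0 : Subgroup T) : Subgroup T) := by
      refine IsPGroup.to_sup_of_normal_right' (zpowers_pgroup ht) Q0.isPGroup' ?_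
      intro u _
      rw [Subgroup.mem_normalizer_iff]
      intro y
      refine ⟨hnorm u y, fun h => ?_⟩
      have := hnorm u⁻¹ _ h
      have e : u⁻¹ * (u * y * u⁻¹) * u⁻¹⁻¹ = y := by group
      rwa [e] at this
    have h2 := Q0.is_maximal' h1 le_sup_right
    have h3 : t ∈ (Subgroup.zpowers t ⊔ (Q0 : Subgroup T) : Subgroup T) := Subgroup.mem_sup_left (Subgroup.mem_zpowers t)
    rw [h2] at h3
    exact h3
  refine ⟨(Q0 : Subgroup T).map T.subtype, Q0.isPGroup'.map _, ?_, ?_, ?_⟩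
  · refine ⟨⟨x, hxB⟩, hpel _ ?_, rfl⟩
    obtain ⟨k, hk⟩ := hxk
    exact ⟨k, Subtype.ext hk⟩
  · have key : ∀ c ∈ Subgroup.centralizer {x}, ∀ y ∈ (Q0 : Subgroup T).map T.subtype, c * y * c⁻¹ ∈ (Q0 : Subgroup T).map T.subtype := by
      rintro c hc y ⟨q, hq, rfl⟩
      have hcn : φ c ∈ Subgroup.normalizer (Bs : Set S) := by
        apply hCx
        rw [Subgroup.mem_centralizer_singleton_iff] at hc ⊢
        rw [← map_mul, hc, map_mul]
      have hT : c * q * c⁻¹ ∈ T := by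
        change φ _ ∈ Bs
        rw [map_mul, map_mul, map_inv]
        exact (Subgroup.mem_normalizer_iff.1 hcn _).1 q.2
      refine ⟨⟨_, hT⟩, hpel _ ?_, rfl⟩
      obtain ⟨k, hk⟩ := Q0.isPGroup' ⟨q, hq⟩
      refine ⟨k, Subtype.ext ?_⟩
      have hk' : (q : G) ^ p ^ k = 1 := congrArg (fun t => ((t : T) : G)) (congrArg Subtype.val hk)
      simp only [Subgroup.coe_pow, Subgroup.coe_one, conj_pow, hk']
      group
    intro c hc
    rw [Subgroup.mem_normalizer_iff]
    intro y
    refine ⟨key c hc y, fun h => ?_⟩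
    have := key c⁻¹ (Subgroup.inv_mem _ hc) _ h
    have e : c⁻¹ * (c * y * c⁻¹) * c⁻¹⁻¹ = y := by group
    rwa [e] at this
  · intro g hg
    have h1 : φ g ∈ Bs := by
      apply hCB
      rw [Subgroup.mem_centralizer_iff] at hg ⊢
      intro b hb
      obtain ⟨q, hq, rfl⟩ := hmap b hb
      rw [← map_mul, hg q ⟨q, hq, rfl⟩, map_mul]
    obtain ⟨q, hq, z, hz, ht⟩ := hdec ⟨g, h1⟩
    have : g = q * z := ht
    rw [this]
    exact Subgroup.mul_mem _ (Subgroup.mem_sup_left ⟨q, hq, rfl⟩) (Subgroup.mem_sup_right hz)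
end B3
end PX

namespace PX
section C1
open Module

theorem geom_char {k A : Type*} [Field k] {p : ℕ} [Fact p.Prime] [CharP k p] [Ring A] [Algebra k A] (X : A) :
    ∑ i ∈ Finset.range p, X ^ i = (X - 1) ^ (p - 1) := by
  have hp : p.Prime := Fact.out
  have h1 : ∑ i ∈ Finset.range p, (Polynomial.X : Polynomial k) ^ i = (Polynomial.X - 1) ^ (p - 1) := by
    have hne : (Polynomial.X - 1 : Polynomial k) ≠ 0 := by
      have := Polynomial.X_sub_C_ne_zero (1 : k)
      simpa using this
    apply mul_right_cancel₀ hne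
    rw [geom_sum_mul, ← pow_succ, Nat.sub_add_cancel hp.one_le, sub_pow_char, one_pow]
  have h2 := congrArg (Polynomial.aeval X) h1
  simpa using h2

theorem eig_sum {k W : Type*} [Field k] [AddCommGroup W] [Module k W] [FiniteDimensional k W] (g : End k W) (s : Finset k)
    (U : Submodule k W) (hU : ∀ x ∈ s, g.eigenspace x ≤ U) : ∑ x ∈ s, finrank k (g.eigenspace x) ≤ finrank k U := by
  classical
  have key : ∀ t : Finset k, ∑ x ∈ t, finrank k (g.eigenspace x) = finrank k ↥(⨆ x ∈ t, g.eigenspace x) := by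
    intro t
    induction t using Finset.induction with
    | empty =>
      have h0 : (⨆ x ∈ (∅ : Finset k), g.eigenspace x) = ⊥ := by simp
      rw [Finset.sum_empty, h0, finrank_bot]
    | insert a t ha ih =>
      rw [Finset.sum_insert ha, ih, Finset.iSup_insert]
      have h1 := Submodule.finrank_sup_add_finrank_inf_eq (g.eigenspace a) (⨆ x ∈ t, g.eigenspace x)
      have h2 : Disjoint (g.eigenspace a) (⨆ x ∈ t, g.eigenspace x) :=
        (g.eigenspaces_iSupIndep).disjoint_biSup (y := (t : Set k)) (by simpa using ha)
      rw [h2.eq_bot, finrank_bot, add_zero] at h1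
      exact h1.symm
  rw [key]
  exact Submodule.finrank_mono (iSup₂_le hU)

theorem ker_dim {k W : Type*} [Field k] [AddCommGroup W] [Module k W] [FiniteDimensional k W] (ν : End k W) (N : ℕ) (hN : 0 < N)
    (h : LinearMap.ker ν ≤ LinearMap.range (ν ^ (N - 1))) : N * finrank k (LinearMap.ker ν) ≤ finrank k W := by
  have key : ∀ i ≤ N, i * finrank k (LinearMap.ker ν) ≤ finrank k (LinearMap.ker (ν ^ i)) := by
    intro i
    induction i with
    | zero => simp
    | succ i ih =>
      intro hi
      let f : LinearMap.ker (ν ^ (i + 1)) →ₗ[k] W := (ν ^ i).domRestrict _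
      have h1 := LinearMap.finrank_range_add_finrank_ker f
      have h2 : LinearMap.ker ν ≤ LinearMap.range f := by
        intro v hv
        obtain ⟨w, rfl⟩ := h hv
        refine ⟨⟨(ν ^ (N - 1 - i)) w, ?_⟩, ?_⟩
        · rw [LinearMap.mem_ker] at hv ⊢
          rw [← End.mul_apply, ← pow_succ'] at hv
          rw [← End.mul_apply, ← pow_add]
          rw [← hv]; congr 2; omega
        · change (ν ^ i) ((ν ^ (N - 1 - i)) w) = _
          rw [← End.mul_apply, ← pow_add]
          congr 2; omega
      have h3 : finrank k (LinearMap.ker (ν ^ i)) ≤ finrank k (LinearMap.ker f) := by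
        have hle : LinearMap.ker (ν ^ i) ≤ LinearMap.ker (ν ^ (i + 1)) := by
          intro v hv
          rw [LinearMap.mem_ker] at hv ⊢
          rw [pow_succ', End.mul_apply, hv, map_zero]
        let φ : LinearMap.ker (ν ^ i) →ₗ[k] LinearMap.ker f :=
          LinearMap.codRestrict _ (Submodule.inclusion hle) (fun v => by
            rw [LinearMap.mem_ker]; exact v.2)
        refine LinearMap.finrank_le_finrank_of_injective (f := φ) ?_
        intro a b hab
        have := congrArg (fun t => ((t : LinearMap.ker (ν ^ (i+1))) : W)) (congrArg Subtype.val hab)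
        exact Subtype.ext this
      have h4 := Submodule.finrank_mono h2
      have h5 := ih (by omega)
      rw [add_mul, one_mul]
      omega
  exact (key N le_rfl).trans (Submodule.finrank_le _)

theorem kdim {k W : Type*} [Field k] {p : ℕ} [Fact p.Prime] [CharP k p] [AddCommGroup W] [Module k W]
    [FiniteDimensional k W] (g T : End k W) (o' j : ℕ) (hg : g ^ (o' * p ^ (j + 1)) = 1)
    (hT : ∑ i ∈ Finset.range p, (g ^ (o' * p ^ j)) ^ i * T * (g ^ (o' * p ^ j)) ^ (p - i) = 1)
    (s : Finset k) (hs : ∀ x ∈ s, x ^ o' = 1) :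
    p ^ (j + 1) * ∑ x ∈ s, finrank k (g.eigenspace x) ≤ finrank k W := by
  have hp : p.Prime := Fact.out
  have hfr : ∀ n : ℕ, g ^ (o' * p ^ n) - 1 = (g ^ o' - 1) ^ p ^ n := by
    intro n
    have h1 : ((Polynomial.X : Polynomial k) ^ (o' * p ^ n) - 1) = (Polynomial.X ^ o' - 1) ^ p ^ n := by
      rw [sub_pow_char_pow, one_pow, pow_mul]
    have h2 := congrArg (Polynomial.aeval g) h1
    simpa using h2
  set ν := g ^ o' - 1 with hν
  have hν0 : ν ^ p ^ (j + 1) = 0 := by rw [← hfr, hg, sub_self]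
  set X := g ^ (o' * p ^ j) with hX
  have hX1 : X - 1 = ν ^ p ^ j := hfr j
  have hmpos : 0 < p ^ j := pow_pos hp.pos j
  have hNm : p ^ (j + 1) = p * p ^ j := pow_succ' p j
  have hle2 : 2 * p ^ j ≤ p ^ (j + 1) := by rw [hNm]; exact Nat.mul_le_mul_right _ hp.two_le
  -- base inclusion
  have hbase : ∀ v, (ν ^ p ^ j) v = 0 → ∃ w, (ν ^ (p ^ (j + 1) - p ^ j)) w = v := by
    intro v hv
    have hXv : X v = v := by
      have : (X - 1) v = 0 := by rw [hX1]; exact hv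
      simpa [sub_eq_zero] using this
    have hXv' : ∀ n : ℕ, (X ^ n) v = v := by
      intro n
      induction n with
      | zero => simp
      | succ n ih => rw [pow_succ, End.mul_apply, hXv, ih]
    refine ⟨T v, ?_⟩
    have h1 := congrArg (fun f : End k W => f v) hT
    simp only [LinearMap.sum_apply, End.mul_apply, hXv', End.one_apply] at h1
    have h2 : p ^ (j + 1) - p ^ j = p ^ j * (p - 1) := by rw [hNm, Nat.mul_sub, mul_one, mul_comm]
    rw [h2, pow_mul, ← hX1, ← geom_char (k := k)]
    simpa using h1
  have hdown : ∀ t : ℕ, t < p ^ j → ∀ v, (ν ^ (p ^ j - t)) v = 0 → ∃ w, (ν ^ (p ^ (j + 1) - (p ^ j - t))) w = v := by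
    intro t
    induction t with
    | zero => intro _; exact hbase
    | succ t ih =>
      intro ht v hv
      have hv' : (ν ^ (p ^ j - t)) v = 0 := by
        have e : p ^ j - t = 1 + (p ^ j - (t + 1)) := by omega
        rw [e, pow_add, End.mul_apply, hv, map_zero]
      obtain ⟨w, hw⟩ := ih (by omega) v hv'
      set u := (ν ^ (p ^ (j + 1) - (p ^ j - t) - 1)) w with hu
      have hvu : ν u = v := by
        rw [hu, ← End.mul_apply, ← pow_succ', ← hw]; congr 2; omega
      have hu0 : (ν ^ (p ^ j - t)) u = 0 := by
        have e : p ^ j - t = (p ^ j - (t + 1)) + 1 := by omega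
        rw [e, pow_succ, End.mul_apply, hvu, hv]
      obtain ⟨w', hw'⟩ := ih (by omega) u hu0
      refine ⟨w', ?_⟩
      have e : p ^ (j + 1) - (p ^ j - (t + 1)) = (p ^ (j + 1) - (p ^ j - t)) + 1 := by omega
      rw [e, pow_succ', End.mul_apply, hw', hvu]
  have hker : LinearMap.ker ν ≤ LinearMap.range (ν ^ (p ^ (j + 1) - 1)) := by
    intro v hv
    have e : p ^ j - (p ^ j - 1) = 1 := by omega
    have := hdown (p ^ j - 1) (by omega) v (by rw [e, pow_one]; exact hv)
    rw [e] at this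
    exact this
  have h1 := ker_dim ν (p ^ (j + 1)) (pow_pos hp.pos _) hker
  refine le_trans (Nat.mul_le_mul_left _ (eig_sum g s (LinearMap.ker ν) ?_)) h1
  intro x hx v hv
  rw [End.mem_eigenspace_iff] at hv
  have hpow : ∀ n : ℕ, (g ^ n) v = x ^ n • v := by
    intro n
    induction n with
    | zero => simp
    | succ n ih => rw [pow_succ', End.mul_apply, ih, map_smul, hv, smul_smul, pow_succ]
  rw [LinearMap.mem_ker, hν, LinearMap.sub_apply, hpow, hs x hx]
  simp
end C1
end PX

namespace PX
section C2
open Module Matrix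

theorem exists_val (p : ℕ) (hp : p.Prime) : ∃ A : ValuationSubring ℂ, A.valuation (p : ℂ) < 1 := by
  let R : Subring ℂ := (Int.castRingHom ℂ).range
  let P : R := ⟨(p : ℂ), ⟨p, by simp⟩⟩
  obtain ⟨B, hB, hB2⟩ := Ideal.image_subset_nonunits_valuationSubring (A := R) (Ideal.span {P}) (by
    intro h
    rw [Ideal.span_singleton_eq_top] at h
    obtain ⟨⟨u, hu⟩, hPu⟩ := isUnit_iff_exists_inv.1 h
    obtain ⟨m, rfl⟩ := hu
    have h1 : (p : ℂ) * (m : ℂ) = 1 := congrArg Subtype.val hPu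
    have h2 : (p : ℤ) * m = 1 := by exact_mod_cast h1
    have h3 : (p : ℤ) ∣ 1 := ⟨m, h2.symm⟩
    have : p ∣ 1 := by exact_mod_cast h3
    exact hp.one_lt.ne' (Nat.dvd_one.1 this))
  refine ⟨B, ?_⟩
  have : (p : ℂ) ∈ B.nonunits := hB2 ⟨P, Ideal.subset_span rfl, rfl⟩
  exact this

theorem lattice (A : ValuationSubring ℂ) {G : Type*} [Group G] [Finite G] {d : ℕ} (ρ : G →* Matrix (Fin d) (Fin d) ℂ) :
    ∃ P : Matrix (Fin d) (Fin d) ℂ, IsUnit P.det ∧ ∀ g i j, (P⁻¹ * ρ g * P) i j ∈ A := by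
  have : Fintype G := Fintype.ofFinite G
  let Pm : (Fin d → G × Fin d) → Matrix (Fin d) (Fin d) ℂ := fun f => Matrix.of (fun i j => ρ (f j).1 i (f j).2)
  obtain ⟨f, -, hf⟩ := Finset.exists_max_image (Finset.univ : Finset (Fin d → G × Fin d))
    (fun f => A.valuation (Pm f).det) ⟨fun j => (1, j), Finset.mem_univ _⟩
  have h1 : (1 : A.ValueGroup) ≤ A.valuation (Pm f).det := by
    have := hf (fun j => (1, j)) (Finset.mem_univ _)
    have e : Pm (fun j => (1, j)) = 1 := by
      ext i j; simp [Pm]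
    rw [e, det_one, map_one] at this
    exact this
  have hdet : (Pm f).det ≠ 0 := by
    intro h; rw [h, map_zero] at h1; simp at h1
  have hdu : IsUnit (Pm f).det := isUnit_iff_ne_zero.2 hdet
  refine ⟨Pm f, hdu, ?_⟩
  have hcol : ∀ g i j, ((Pm f)⁻¹ * ρ g) i j ∈ A := by
    intro g i j
    have h2 : ((Pm f)⁻¹ * ρ g) i j = (Pm (Function.update f i (g, j))).det / (Pm f).det := by
      have h3 := cramer_apply (Pm f) (fun a => ρ g a j) i
      have h4 : (Pm f).updateCol i (fun a => ρ g a j) = Pm (Function.update f i (g, j)) := by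
        ext a b
        by_cases hb : b = i
        · subst hb; simp [Pm]
        · simp [Pm, hb]
      rw [h4] at h3
      rw [← h3, cramer_eq_adjugate_mulVec, Matrix.inv_def, smul_mul, Matrix.smul_apply, smul_eq_mul, Ring.inverse_eq_inv',
        div_eq_mul_inv, mul_comm]
      rfl
    rw [h2, ← A.valuation_le_one_iff, map_div₀]
    exact div_le_one_of_le₀ (hf _ (Finset.mem_univ _)) zero_le
  intro g i j
  have h5 : ((Pm f)⁻¹ * ρ g * Pm f) i j = ((Pm f)⁻¹ * ρ (g * (f j).1)) i (f j).2 := by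
    rw [Matrix.mul_assoc, map_mul, Matrix.mul_apply, Matrix.mul_apply]
    refine Finset.sum_congr rfl (fun a _ => ?_)
    congr 1
  rw [h5]
  exact hcol _ _ _

theorem indep_lift (A : ValuationSubring ℂ) {d r : ℕ} (v : Fin r → Fin d → A)
    (h : LinearIndependent (IsLocalRing.ResidueField A) (fun i a => IsLocalRing.residue A (v i a))) :
    LinearIndependent ℂ (fun i a => ((v i a : A) : ℂ)) := by
  rw [Fintype.linearIndependent_iff] at h ⊢
  intro c hc
  by_contra! hne
  obtain ⟨i1, hi1⟩ := hne
  obtain ⟨i0, -, hi0⟩ := Finset.exists_max_image (Finset.univ : Finset (Fin r)) (fun i => A.valuation (c i)) ⟨i1, Finset.mem_univ _⟩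
  have hc0 : c i0 ≠ 0 := by
    intro h0
    have := hi0 i1 (Finset.mem_univ _)
    rw [h0, map_zero] at this
    simp at this
    exact hi1 this
  have hmem : ∀ i, c i / c i0 ∈ A := by
    intro i
    rw [← A.valuation_le_one_iff, map_div₀]
    exact div_le_one_of_le₀ (hi0 _ (Finset.mem_univ _)) zero_le
  have hrel : ∀ a, ∑ i, (⟨c i / c i0, hmem i⟩ : A) * v i a = 0 := by
    intro a
    apply Subtype.ext
    have h1 := congrFun hc a
    simp only [Finset.sum_apply, Pi.smul_apply, smul_eq_mul, Pi.zero_apply] at h1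
    push_cast
    have h2 : ∑ i, c i / c i0 * (v i a : ℂ) = (∑ i, c i * (v i a : ℂ)) / c i0 := by
      rw [Finset.sum_div]; exact Finset.sum_congr rfl (fun i _ => by ring)
    rw [h2, h1]; simp
  have h3 := h (fun i => IsLocalRing.residue A ⟨c i / c i0, hmem i⟩) (by
    ext a
    simp only [Finset.sum_apply, Pi.smul_apply, smul_eq_mul, Pi.zero_apply, ← map_mul, ← map_sum]
    rw [hrel, map_zero]) i0
  have h4 : (⟨c i0 / c i0, hmem i0⟩ : A) = 1 := Subtype.ext (div_self hc0)
  simp only [h4, map_one] at h3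
  exact one_ne_zero h3

theorem rank_le (A : ValuationSubring ℂ) {d : ℕ} (M : Matrix (Fin d) (Fin d) A) :
    (M.map (IsLocalRing.residue A)).rank ≤ (M.map A.subtype).rank := by
  rw [rank_eq_finrank_span_cols, rank_eq_finrank_span_cols]
  obtain ⟨f, hf, -, hli⟩ := Submodule.exists_fun_fin_finrank_span_eq (IsLocalRing.ResidueField A) (Set.range (M.map (IsLocalRing.residue A)).col)
  choose g hg using hf
  have h1 := indep_lift A (fun i a => M a (g i)) (by
    have e : f = fun i a => IsLocalRing.residue A (M a (g i)) := by
      ext i a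
      rw [← hg]; rfl
    rw [e] at hli
    exact hli)
  have h2 : LinearIndependent ℂ (fun i => (M.map A.subtype).col (g i)) := h1
  have h3 := finrank_span_eq_card h2
  rw [Fintype.card_fin] at h3
  rw [← h3]
  apply Submodule.finrank_mono
  apply Submodule.span_mono
  rintro _ ⟨i, rfl⟩
  exact ⟨g i, rfl⟩

theorem mult_rank {K : Type*} [Field K] {d : ℕ} (g : Matrix (Fin d) (Fin d) K) (θ : K) : mult g θ + (g - θ • 1).rank = d := by
  have := LinearMap.finrank_range_add_finrank_ker (Matrix.toLin' (g - θ • 1))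
  rw [Module.finrank_fin_fun] at this
  rw [mult, Matrix.rank_eq_finrank_range_toLin _ (Pi.basisFun K _) (Pi.basisFun K _), add_comm, Matrix.toLin_eq_toLin']
  exact this

theorem mult_le (A : ValuationSubring ℂ) {d : ℕ} (g : Matrix (Fin d) (Fin d) A) (θ : A) :
    mult (g.map A.subtype) (θ : ℂ) ≤ mult (g.map (IsLocalRing.residue A)) (IsLocalRing.residue A θ) := by
  have h1 := mult_rank (g.map A.subtype) (θ : ℂ)
  have h2 := mult_rank (g.map (IsLocalRing.residue A)) (IsLocalRing.residue A θ)
  have h3 := rank_le A (g - θ • 1)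
  have e1 : (g - θ • 1).map A.subtype = g.map A.subtype - (θ : ℂ) • 1 := by
    ext i j
    by_cases h : i = j <;> simp [h]
  have e2 : (g - θ • 1).map (IsLocalRing.residue A) = g.map (IsLocalRing.residue A) - (IsLocalRing.residue A θ) • 1 := by
    ext i j
    by_cases h : i = j <;> simp [h]
  rw [e1, e2] at h3
  omega

theorem defect_la (A : ValuationSubring ℂ) {p : ℕ} [Fact p.Prime] (hA : A.valuation (p : ℂ) < 1) {d : ℕ}
    (g T : Matrix (Fin d) (Fin d) A) (o' j : ℕ) (ho' : ¬ p ∣ o') (hg : g ^ (o' * p ^ (j + 1)) = 1)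
    (hT : ∑ i ∈ Finset.range p, (g ^ (o' * p ^ j)) ^ i * T * (g ^ (o' * p ^ j)) ^ (p - i) = 1) :
    (g.map A.subtype).trace = 0 := by
  classical
  have hp : p.Prime := Fact.out
  set k := IsLocalRing.ResidueField A with hk
  let π := IsLocalRing.residue A
  have hpk : (p : k) = 0 := by
    have h1 : π (p : A) = 0 := by
      rw [IsLocalRing.residue_eq_zero_iff, A.valuation_lt_one_iff]
      simpa using hA
    simpa using h1
  have : CharP k p := by
    obtain ⟨q, hq⟩ := CharP.exists k
    have h1 := (CharP.cast_eq_zero_iff k q p).1 hpk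
    rcases (Nat.dvd_prime hp).1 h1 with h2 | h2
    · subst h2
      exact absurd rfl (CharP.char_ne_one k 1)
    · subst h2; exact hq
  have ho'0 : 0 < o' := Nat.pos_of_ne_zero (by rintro rfl; simp at ho')
  set o := o' * p ^ (j + 1) with ho
  have ho0 : 0 < o := Nat.mul_pos ho'0 (pow_pos hp.pos _)
  have hmemA : ∀ θ : ℂ, θ ^ o = 1 → θ ∈ A := by
    intro θ hθ
    rw [← A.valuation_le_one_iff]
    by_contra! hlt
    have := one_lt_pow₀ hlt ho0.ne'
    rw [← map_pow, hθ, map_one] at this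
    exact lt_irrefl _ this
  let red : ℂ → k := fun θ => if h : θ ∈ A then π ⟨θ, h⟩ else 0
  have hred : ∀ θ (h : θ ∈ A), red θ = π ⟨θ, h⟩ := fun θ h => dif_pos h
  have hredmul : ∀ a b, a ∈ A → b ∈ A → red (a * b) = red a * red b := by
    intro a b ha hb
    rw [hred _ ha, hred _ hb, hred _ (A.mul_mem _ _ ha hb), ← map_mul]; rfl
  have hredpow : ∀ a n, a ∈ A → red (a ^ n) = red a ^ n := by
    intro a n ha
    rw [hred _ ha, hred _ (pow_mem ha n), ← map_pow]; rfl
  have hred1 : red 1 = 1 := by rw [hred _ A.one_mem]; exact map_one π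
  have hpp : ∀ (x : k) (n : ℕ), x ^ p ^ n = 1 → x = 1 := by
    intro x n hx
    have : (x - 1) ^ p ^ n = 0 := by rw [sub_pow_char_pow, hx, one_pow, sub_self]
    exact sub_eq_zero.1 (pow_eq_zero_iff (pow_pos hp.pos _).ne' |>.1 this)
  have hinj : ∀ η : ℂ, η ^ o' = 1 → red η = 1 → η = 1 := by
    intro η hη hr
    by_contra hne
    have hηA : η ∈ A := hmemA η (by rw [ho, pow_mul, hη, one_pow])
    have h1 : ∑ i ∈ Finset.range o', η ^ i = 0 := by
      have := geom_sum_mul η o'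
      rw [hη, sub_self] at this
      exact (mul_eq_zero.1 this).resolve_right (sub_ne_zero.2 hne)
    have h2 : ∑ i ∈ Finset.range o', (⟨η, hηA⟩ : A) ^ i = 0 := by
      apply Subtype.ext; push_cast; exact h1
    have h3 := congrArg π h2
    rw [map_sum, map_zero] at h3
    simp only [map_pow] at h3
    rw [← hred, hr] at h3
    simp at h3
    exact ho' ((CharP.cast_eq_zero_iff k p o').1 h3)
  let gC := g.map A.subtype
  let gk := g.map π
  have hgC : gC ^ o = 1 := by
    have h1 : gC = A.subtype.mapMatrix g := rfl
    rw [h1, ← map_pow, hg, map_one]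
  have hgk : gk = π.mapMatrix g := rfl
  have hgk' : gk ^ o = 1 := by rw [hgk, ← map_pow, hg, map_one]
  let f : ℂ → ℕ := fun θ => mult gk (red θ)
  have hnf : ∀ θ ∈ Polynomial.nthRootsFinset o (1 : ℂ), mult gC θ ≤ f θ := by
    intro θ hθ
    rw [Polynomial.mem_nthRootsFinset ho0] at hθ
    have := mult_le A g ⟨θ, hmemA θ hθ⟩
    simp only [f]
    rw [hred _ (hmemA θ hθ)]
    exact this
  have hsumn : ∑ θ ∈ Polynomial.nthRootsFinset o (1 : ℂ), mult gC θ = d := by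
    have := trace_pow_eq ho0 gC hgC 0
    simp at this
    exact_mod_cast this.symm
  -- bound on the sum of f
  let s : Finset k := (Polynomial.nthRootsFinset o (1 : ℂ)).image red
  have hs : ∀ x ∈ s, x ^ o' = 1 := by
    intro x hx
    obtain ⟨θ, hθ, rfl⟩ := Finset.mem_image.1 hx
    rw [Polynomial.mem_nthRootsFinset ho0] at hθ
    apply hpp _ (j + 1)
    rw [← pow_mul, ← ho, ← hredpow _ _ (hmemA θ hθ), hθ, hred1]
  have heig : ∀ x, finrank k (End.eigenspace (Matrix.toLin' gk) x) = mult gk x := by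
    intro x
    have e : End.eigenspace (Matrix.toLin' gk) x = LinearMap.ker (Matrix.toLin' (gk - x • 1)) := by
      ext v
      rw [End.mem_eigenspace_iff, LinearMap.mem_ker, map_sub, map_smul, Matrix.toLin'_one, LinearMap.sub_apply, sub_eq_zero]
      rfl
    rw [mult, e]
  have hkd := kdim (p := p) (Matrix.toLinAlgEquiv' gk) (Matrix.toLinAlgEquiv' (π.mapMatrix T)) o' j (by
    rw [← map_pow, ← ho, hgk', map_one]) (by
    simp only [hgk, ← map_pow, ← map_mul, ← map_sum]
    rw [hT, map_one, map_one]) s hs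
  have hkd' : p ^ (j + 1) * ∑ x ∈ s, mult gk x ≤ d := by
    rw [Module.finrank_fin_fun] at hkd
    rw [← Finset.sum_congr rfl (fun x _ => heig x)]
    exact hkd
  have hsumf : ∑ θ ∈ Polynomial.nthRootsFinset o (1 : ℂ), f θ ≤ d := by
    refine le_trans ?_ hkd'
    rw [← Finset.sum_fiberwise_of_maps_to (t := s) (g := red) (fun θ hθ => Finset.mem_image_of_mem red hθ), Finset.mul_sum]
    refine Finset.sum_le_sum (fun x hx => ?_)
    rw [Finset.sum_congr rfl (g := fun _ => mult gk x) (fun θ hθ => by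
      simp only [f]; rw [(Finset.mem_filter.1 hθ).2]), Finset.sum_const, smul_eq_mul]
    apply Nat.mul_le_mul_right
    obtain ⟨θ0, hθ0, rfl⟩ := Finset.mem_image.1 hx
    rw [Polynomial.mem_nthRootsFinset ho0] at hθ0
    have hθ00 : θ0 ≠ 0 := by rintro rfl; rw [zero_pow ho0.ne'] at hθ0; exact zero_ne_one hθ0
    have hr0 : red θ0 ≠ 0 := by
      intro h0
      have := hredpow θ0 o (hmemA _ hθ0)
      rw [h0, hθ0, hred1, zero_pow ho0.ne'] at this
      exact one_ne_zero this
    have hcard : (Polynomial.nthRootsFinset (p ^ (j + 1)) (1 : ℂ)).card ≤ p ^ (j + 1) :=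
      (Multiset.toFinset_card_le _).trans (Polynomial.card_nthRoots _ _)
    refine le_trans (Finset.card_le_card_of_injOn (fun θ => θ / θ0) ?_ ?_) hcard
    · intro θ hθ
      obtain ⟨hθ1, hθ2⟩ := Finset.mem_filter.1 (Finset.mem_coe.1 hθ)
      rw [Polynomial.mem_nthRootsFinset ho0] at hθ1
      rw [Finset.mem_coe, Polynomial.mem_nthRootsFinset (pow_pos hp.pos _)]
      have hq : (θ / θ0) ^ o = 1 := by rw [div_pow, hθ1, hθ0, div_one]
      have hqA := hmemA _ hq
      apply hinj
      · rw [← pow_mul, mul_comm, ← ho, hq]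
      · rw [hredpow _ _ hqA]
        have h5 := hredmul (θ / θ0) θ0 hqA (hmemA _ hθ0)
        rw [div_mul_cancel₀ _ hθ00, hθ2] at h5
        have h6 : red (θ / θ0) = 1 := by
          apply mul_right_cancel₀ hr0
          rw [← h5, one_mul]
        rw [h6, one_pow]
    · intro a _ b _ hab
      have : a / θ0 = b / θ0 := hab
      field_simp at this
      exact this
  have heq : ∀ θ ∈ Polynomial.nthRootsFinset o (1 : ℂ), mult gC θ = f θ := by
    have h7 : ∑ θ ∈ Polynomial.nthRootsFinset o (1 : ℂ), mult gC θ = ∑ θ ∈ Polynomial.nthRootsFinset o (1 : ℂ), f θ :=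
      le_antisymm (Finset.sum_le_sum hnf) (by rw [hsumn]; exact hsumf)
    exact (Finset.sum_eq_sum_iff_of_le hnf).1 h7
  -- p-th root of unity
  have hε := Complex.isPrimitiveRoot_exp p hp.ne_zero
  set ε : ℂ := Complex.exp (2 * Real.pi * Complex.I / p)
  have hεo : ε ^ o = 1 := by
    rw [ho, pow_succ, ← mul_assoc, mul_comm, pow_mul, hε.pow_eq_one, one_pow]
  have hεA := hmemA ε hεo
  have hεr : red ε = 1 := by
    apply hpp _ 1
    rw [pow_one, ← hredpow _ _ hεA, hε.pow_eq_one, hred1]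
  have htr := trace_pow_eq ho0 gC hgC 1
  simp only [pow_one] at htr
  have h8 : gC.trace = ε * gC.trace := by
    conv_lhs => rw [htr, ← sum_nthRoots_shift ho0 (fun θ => (mult gC θ : ℂ) * θ) ε hεo]
    rw [htr, Finset.mul_sum]
    refine Finset.sum_congr rfl (fun θ hθ => ?_)
    have hθ' := (Polynomial.mem_nthRootsFinset ho0 _).1 hθ
    have h9 : mult gC (ε * θ) = mult gC θ := by
      rw [heq θ hθ, heq (ε * θ) ((Polynomial.mem_nthRootsFinset ho0 _).2 (by rw [mul_pow, hεo, hθ', one_mul]))]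
      simp only [f]
      rw [hredmul _ _ hεA (hmemA θ hθ'), hεr, one_mul]
    rw [h9]; ring
  have h10 : (1 - ε) * gC.trace = 0 := by rw [sub_mul, one_mul, ← h8, sub_self]
  rcases mul_eq_zero.1 h10 with h11 | h11
  · exact absurd (sub_eq_zero.1 h11).symm (hε.ne_one hp.one_lt)
  · exact h11
end C2
end PX

namespace PX
section C3
open Matrix

theorem sum_quot {G M : Type*} [Group G] [Fintype G] [AddCommMonoid M] (Z : Subgroup G) [Fintype (G ⧸ Z)] (f : G ⧸ Z → M) :
    ∑ g : G, f (QuotientGroup.mk g) = Nat.card Z • ∑ s, f s := by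
  classical
  have : Fintype Z := Fintype.ofFinite Z
  rw [← Fintype.sum_equiv (Subgroup.groupEquivQuotientProdSubgroup (s := Z)).symm
    (fun y => f (QuotientGroup.mk ((Subgroup.groupEquivQuotientProdSubgroup (s := Z)).symm y))) _ (fun y => rfl)]
  have : ∀ y : (G ⧸ Z) × Z, (QuotientGroup.mk ((Subgroup.groupEquivQuotientProdSubgroup (s := Z)).symm y) : G ⧸ Z) = y.1 := by
    intro y
    have h1 : (QuotientGroup.mk ((Subgroup.groupEquivQuotientProdSubgroup (s := Z)).symm y) : G ⧸ Z) =
      ((Subgroup.groupEquivQuotientProdSubgroup (s := Z)) ((Subgroup.groupEquivQuotientProdSubgroup (s := Z)).symm y)).1 := rfl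
    rw [h1, Equiv.apply_symm_apply]
  simp only [this]
  rw [Fintype.sum_prod_type]
  simp [Finset.sum_const, Finset.smul_sum, Nat.card_eq_fintype_card]

theorem sum_split {G M : Type*} [Group G] [Fintype G] [AddCommGroup M] (Z : Subgroup G) [Z.Normal]
    (C : G →* AddMonoid.End M) (hC : ∀ z ∈ Z, C z = 1) {p : ℕ} [Fact p.Prime] (x : G) (hx : x ∉ Z) (hxp : x ^ p ∈ Z) :
    ∃ (R : Finset G), ∀ T, ∑ g, C g T = Nat.card Z • ∑ i ∈ Finset.range p, C (x ^ i) (∑ r ∈ R, C r T) := by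
  classical
  have : Fintype (G ⧸ Z) := Fintype.ofFinite _
  let D : (G ⧸ Z) →* AddMonoid.End M := QuotientGroup.lift Z C hC
  let xb : G ⧸ Z := QuotientGroup.mk x
  have ho : orderOf xb = p := by
    apply orderOf_eq_prime
    · rw [← QuotientGroup.mk_pow]; exact (QuotientGroup.eq_one_iff _).2 hxp
    · exact fun h => hx ((QuotientGroup.eq_one_iff _).1 h)
  let P := Subgroup.zpowers xb
  have : Fintype P := Fintype.ofFinite P
  have : Fintype ((G ⧸ Z) ⧸ P) := Fintype.ofFinite _
  let e : ((G ⧸ Z) ⧸ P) × P ≃ (G ⧸ Z) := Equiv.ofBijective (fun y => Quotient.out y.1 * (y.2 : G ⧸ Z)) (by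
    have hm : ∀ y : ((G ⧸ Z) ⧸ P) × P, (QuotientGroup.mk (Quotient.out y.1 * (y.2 : G ⧸ Z)) : (G ⧸ Z) ⧸ P) = y.1 := by
      intro y
      rw [QuotientGroup.mk_mul_of_mem _ y.2.2]; exact Quotient.out_eq' _
    constructor
    · rintro y y' hy
      have h1 : y.1 = y'.1 := by rw [← hm y, ← hm y']; exact congrArg _ hy
      refine Prod.ext h1 (Subtype.ext ?_)
      simp only [h1] at hy
      exact mul_left_cancel hy
    · intro s
      have h1 : (QuotientGroup.mk (Quotient.out (QuotientGroup.mk s : (G ⧸ Z) ⧸ P)) : (G ⧸ Z) ⧸ P) = QuotientGroup.mk s := Quotient.out_eq' _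
      exact ⟨(QuotientGroup.mk s, ⟨_, QuotientGroup.eq.1 h1⟩), by simp⟩)
  let rep : ((G ⧸ Z) ⧸ P) → G := fun q => (Quotient.out (Quotient.out q : G ⧸ Z))⁻¹
  have hrep : ∀ q, (QuotientGroup.mk (rep q) : G ⧸ Z) = (Quotient.out q)⁻¹ := by
    intro q
    simp only [rep, QuotientGroup.mk_inv]
    congr 1
    exact Quotient.out_eq' _
  have hrinj : Function.Injective rep := by
    intro q q' h
    have := congrArg (QuotientGroup.mk : G → G ⧸ Z) h
    rw [hrep, hrep, _root_.inv_inj] at this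
    exact Quotient.out_injective this
  refine ⟨Finset.univ.image rep, fun T => ?_⟩
  have h1 : ∑ g, C g T = ∑ g : G, (fun s : G ⧸ Z => D s T) (QuotientGroup.mk g) := rfl
  rw [h1, sum_quot Z (fun s : G ⧸ Z => D s T)]
  congr 1
  rw [← Equiv.sum_comp (Equiv.inv (G ⧸ Z)), ← Equiv.sum_comp e, Fintype.sum_prod_type]
  rw [Finset.sum_image (fun a _ b _ h => hrinj h)]
  have h2 : ∀ (q : (G ⧸ Z) ⧸ P) (u : P), D (Equiv.inv _ (e (q, u))) T = D ((u⁻¹ : P) : G ⧸ Z) (C (rep q) T) := by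
    intro q u
    have : e (q, u) = Quotient.out q * (u : G ⧸ Z) := rfl
    rw [this, Equiv.inv_apply, _root_.mul_inv_rev, map_mul, ← hrep]
    rfl
  simp only [h2]
  rw [Finset.sum_comm]
  simp only [← map_sum]
  generalize (∑ q, C (rep q) T) = W
  rw [← Equiv.sum_comp (Equiv.inv P)]
  simp only [Equiv.inv_apply, inv_inv]
  rw [← Equiv.sum_comp (finEquivZPowers (isOfFinOrder_of_finite xb))]
  rw [Finset.sum_range]
  rw [← Fin.sum_congr' _ ho]
  refine Finset.sum_congr rfl (fun i _ => ?_)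
  rw [finEquivZPowers_apply]
  rfl

variable {H : Type*} [Group H] {d : ℕ}

theorem defect_core [Finite H] (hd : d ≠ 0) {L : Subgroup H} {ρ : H →* Matrix (Fin d) (Fin d) ℂ} (h : ScalarComm L ρ)
    (hZ : Subgroup.center H ≤ L) {p : ℕ} [Fact p.Prime] {s t : ℕ} (hs : Nat.card L = Nat.card (Subgroup.center H) * s)
    (hst : s = d * t) (ht : ¬ p ∣ t) (A : ValuationSubring ℂ) (hA : A.valuation (p : ℂ) < 1)
    (hint : ∀ g i j, ρ g i j ∈ A) (g : H) (o' j : ℕ) (ho' : ¬ p ∣ o') (hg : g ^ (o' * p ^ (j + 1)) ∈ Subgroup.center H)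
    (hx : g ^ (o' * p ^ j) ∈ L) (hxZ : g ^ (o' * p ^ j) ∉ Subgroup.center H) : (ρ g).trace = 0 := by
  classical
  have : Fintype L := Fintype.ofFinite L
  have hp : p.Prime := Fact.out
  have hd' : (d : ℂ) ≠ 0 := by exact_mod_cast hd
  -- conj action
  let C : L →* AddMonoid.End (Matrix (Fin d) (Fin d) ℂ) :=
    { toFun := fun l => (AddMonoidHom.mulRight (ρ (l : H)⁻¹)).comp (AddMonoidHom.mulLeft (ρ l))
      map_one' := by
        refine AddMonoidHom.ext (fun T => ?_)
        change ρ 1 * T * ρ (1 : H)⁻¹ = T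
        simp
      map_mul' := by
        intro a b; refine AddMonoidHom.ext (fun T => ?_)
        change ρ (a * b) * T * ρ ((a : H) * b)⁻¹ = ρ a * (ρ b * T * ρ (b : H)⁻¹) * ρ (a : H)⁻¹
        rw [_root_.mul_inv_rev, map_mul, map_mul]; simp only [mul_assoc] }
  have hCa : ∀ l T, C l T = ρ l * T * ρ (l : H)⁻¹ := fun _ _ => rfl
  let Z : Subgroup L := (Subgroup.center H).subgroupOf L
  have hZn : Z.Normal := by infer_instance
  obtain ⟨R, hR⟩ := sum_split Z C (by
    intro z hz
    have hz' : (z : H) ∈ Subgroup.center H := hz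
    obtain ⟨c, hc⟩ := central_scalar h hz'
    refine AddMonoidHom.ext (fun T => ?_)
    change ρ z * T * ρ (z : H)⁻¹ = T
    rw [hc, smul_mul_assoc, one_mul]
    have := rho_mul_inv ρ (z : H)
    rw [hc, smul_mul_assoc, one_mul] at this
    rw [smul_mul_assoc, ← mul_smul_comm, this, mul_one]) (p := p) ⟨_, hx⟩ hxZ (by
    change (g ^ (o' * p ^ j)) ^ p ∈ Subgroup.center H
    rw [← pow_mul, mul_assoc, ← pow_succ]; exact hg)
  let i0 : Fin d := ⟨0, Nat.pos_of_ne_zero hd⟩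
  have h1 := hR (Matrix.single i0 i0 1)
  have h2 := avg_scalar hd (ρ.comp L.subtype) h.res (Matrix.single i0 i0 1)
  have h3 : ∑ g, C g (Matrix.single i0 i0 1) = ∑ g : L, (ρ.comp L.subtype) g * Matrix.single i0 i0 1 * (ρ.comp L.subtype) g⁻¹ := rfl
  rw [h3, h2] at h1
  set T1 := ∑ r ∈ R, C r (Matrix.single i0 i0 1) with hT1
  have hcz : Nat.card Z = Nat.card (Subgroup.center H) := Nat.card_congr (Subgroup.subgroupOfEquivOfLe hZ).toEquiv
  have hz0 : (Nat.card (Subgroup.center H) : ℂ) ≠ 0 := by exact_mod_cast Nat.card_pos.ne'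
  rw [Matrix.trace_single_eq_same, mul_one, ← Nat.card_eq_fintype_card, hs, hst, hcz] at h1
  have h4 : ∑ i ∈ Finset.range p, C ((⟨g ^ (o' * p ^ j), hx⟩ : L) ^ i) T1 = (t : ℂ) • 1 := by
    have e1 : (((Nat.card (Subgroup.center H)) * (d * t) : ℕ) : ℂ) / (d : ℂ) = (Nat.card (Subgroup.center H) : ℂ) * t := by
      push_cast; field_simp
    rw [e1, mul_smul, ← Nat.cast_smul_eq_nsmul ℂ] at h1
    exact (smul_right_injective _ hz0 h1).symm
  -- scalars
  obtain ⟨c0, hc0⟩ := central_scalar h hg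
  have hpos : o' * p ^ (j+1) ≠ 0 := mul_ne_zero (fun h => ho' (h ▸ dvd_zero p)) (pow_ne_zero _ hp.ne_zero)
  have hentry : ∀ a b : ℂ, a • (1 : Matrix (Fin d) (Fin d) ℂ) = b • 1 → a = b := by
    intro a b hab
    have := congrFun (congrFun hab i0) i0
    simpa using this
  have hc00 : c0 ≠ 0 := by
    rintro rfl
    have := rho_mul_inv ρ (g ^ (o' * p ^ (j + 1)))
    rw [hc0, zero_smul, zero_mul] at this
    exact zero_ne_one (hentry 0 1 (by rw [zero_smul, one_smul]; exact this))
  have hc0A : c0⁻¹ ∈ A := by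
    have := hint (g ^ (o' * p ^ (j + 1)))⁻¹ i0 i0
    have e : ρ (g ^ (o' * p ^ (j + 1)))⁻¹ = c0⁻¹ • 1 := by
      have := rho_mul_inv ρ (g ^ (o' * p ^ (j + 1)))
      rw [hc0, smul_mul_assoc, one_mul] at this
      rw [← this, smul_smul, inv_mul_cancel₀ hc00, one_smul]
    rw [e] at this
    simpa using this
  obtain ⟨c, hc⟩ := IsAlgClosed.exists_pow_nat_eq c0⁻¹ (Nat.pos_of_ne_zero hpos)
  have hcA : c ∈ A := by
    rw [← A.valuation_le_one_iff] at hc0A ⊢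
    rw [← hc, map_pow] at hc0A
    by_contra hcon
    exact absurd hc0A (not_le.2 (one_lt_pow₀ (not_le.1 hcon) hpos))
  have hc0' : c ≠ 0 := by
    rintro rfl
    rw [zero_pow hpos] at hc
    exact (inv_ne_zero hc00) hc.symm
  -- matrices over A
  let gA : Matrix (Fin d) (Fin d) A := Matrix.of fun i k => ⟨c * ρ g i k, A.mul_mem _ _ hcA (hint g i k)⟩
  have hgA : gA.map A.subtype = c • ρ g := by ext i k; simp [gA]
  have hsA : ∀ l T, (∀ i k, T i k ∈ A) → ∀ i k, (C l T) i k ∈ A := by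
    intro l T hT i k
    rw [hCa, Matrix.mul_apply]
    refine A.toSubring.sum_mem (fun m _ => A.mul_mem _ _ ?_ (hint _ _ _))
    rw [Matrix.mul_apply]
    exact A.toSubring.sum_mem (fun m _ => A.mul_mem _ _ (hint _ _ _) (hT _ _))
  have hT1A : ∀ i k, T1 i k ∈ A := by
    intro i k
    rw [hT1, Matrix.sum_apply]
    refine A.toSubring.sum_mem (fun m _ => hsA _ _ ?_ _ _)
    intro a b
    rw [Matrix.single_apply]
    split_ifs
    · exact A.one_mem
    · exact A.zero_mem
  have ht0 : (t : ℂ) ≠ 0 := by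
    rintro h0
    have : t = 0 := by exact_mod_cast h0
    exact ht (this ▸ dvd_zero p)
  have htA : (t : ℂ)⁻¹ ∈ A := by
    rw [← A.valuation_le_one_iff, map_inv₀]
    suffices hh : A.valuation (t : ℂ) = 1 by rw [hh]; simp
    have hle : ∀ m : ℤ, A.valuation (m : ℂ) ≤ 1 := fun m => (A.valuation_le_one_iff _).2 (intCast_mem A.toSubring m)
    refine le_antisymm (by simpa using hle t) ?_
    by_contra hcon
    rw [not_le] at hcon
    have hcop : IsCoprime (p : ℤ) (t : ℤ) := Nat.isCoprime_iff_coprime.2 ((Nat.Prime.coprime_iff_not_dvd hp).2 ht)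
    obtain ⟨u, v, huv⟩ := hcop
    have h5 : A.valuation (1 : ℂ) < 1 := by
      have : (1 : ℂ) = u * p + v * t := by exact_mod_cast huv.symm
      rw [this]
      refine A.valuation.map_add_lt ?_ ?_
      · rw [map_mul]
        exact mul_lt_one_of_nonneg_of_lt_one_right (hle u) zero_le hA
      · rw [map_mul]; exact mul_lt_one_of_nonneg_of_lt_one_right (hle v) zero_le hcon
    rw [map_one] at h5
    exact lt_irrefl _ h5
  let TA : Matrix (Fin d) (Fin d) A := Matrix.of fun i k => ⟨(t : ℂ)⁻¹ * T1 i k, A.mul_mem _ _ htA (hT1A i k)⟩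
  have hTA : TA.map A.subtype = (t : ℂ)⁻¹ • T1 := by ext i k; simp [TA]
  have hminj : Function.Injective (fun M : Matrix (Fin d) (Fin d) A => A.subtype.mapMatrix M) := by
    intro M N hMN
    ext i k
    exact congrFun (congrFun hMN i) k
  have hgA' : A.subtype.mapMatrix gA = c • ρ g := hgA
  have hTA' : A.subtype.mapMatrix TA = (t : ℂ)⁻¹ • T1 := hTA
  have hgo : (c • ρ g) ^ (o' * p ^ (j + 1)) = 1 := by
    rw [smul_pow, hc, ← map_pow, hc0, smul_smul, inv_mul_cancel₀ hc00, one_smul]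
  have := defect_la A hA gA TA o' j ho' (hminj (by
    change A.subtype.mapMatrix _ = A.subtype.mapMatrix _
    rw [map_pow, hgA', map_one, hgo])) (hminj (by
    change A.subtype.mapMatrix _ = A.subtype.mapMatrix _
    simp only [map_sum, map_mul, map_pow, hgA', hTA', map_one]
    have e2 : ∀ i ∈ Finset.range p, (((c • ρ g) ^ (o' * p ^ j)) ^ i * ((t : ℂ)⁻¹ • T1) * ((c • ρ g) ^ (o' * p ^ j)) ^ (p - i)) =
        (t : ℂ)⁻¹ • C ((⟨g ^ (o' * p ^ j), hx⟩ : L) ^ i) T1 := by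
      intro i hi
      have hi' := (Finset.mem_range.1 hi).le
      set X := (c • ρ g) ^ (o' * p ^ j) with hX
      have hXp : X ^ i * X ^ (p - i) = 1 := by
        rw [← pow_add, Nat.add_sub_cancel' hi', hX, ← pow_mul, mul_assoc, ← pow_succ, hgo]
      have hXi : X ^ i = (c ^ (o' * p ^ j)) ^ i • ρ ((g ^ (o' * p ^ j)) ^ i) := by
        rw [hX, smul_pow, smul_pow, map_pow, map_pow]
      have hXi' : X ^ (p - i) = ((c ^ (o' * p ^ j)) ^ i)⁻¹ • ρ ((g ^ (o' * p ^ j)) ^ i)⁻¹ := by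
        have hcc : (c ^ (o' * p ^ j)) ^ i ≠ 0 := pow_ne_zero _ (pow_ne_zero _ hc0')
        have e3 : (((c ^ (o' * p ^ j)) ^ i)⁻¹ • ρ ((g ^ (o' * p ^ j)) ^ i)⁻¹) * X ^ i = 1 := by
          rw [hXi, smul_mul_smul_comm, inv_mul_cancel₀ hcc, rho_inv_mul, one_smul]
        exact (left_inv_eq_right_inv e3 hXp).symm
      have hcc : (c ^ (o' * p ^ j)) ^ i ≠ 0 := pow_ne_zero _ (pow_ne_zero _ hc0')
      rw [hXi, hXi', hCa]
      simp only [smul_mul_assoc, mul_smul_comm, smul_smul]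
      rw [mul_left_comm, inv_mul_cancel₀ hcc, mul_one]
      rfl
    rw [Finset.sum_congr rfl e2, ← Finset.smul_sum, h4, smul_smul, inv_mul_cancel₀ ht0, one_smul]))
  rw [hgA, Matrix.trace_smul, smul_eq_mul] at this
  exact (mul_eq_zero.1 this).resolve_left hc0'

theorem defect_zero [Finite H] (hd : d ≠ 0) {L : Subgroup H} {ρ : H →* Matrix (Fin d) (Fin d) ℂ} (h : ScalarComm L ρ)
    (hZ : Subgroup.center H ≤ L) {p : ℕ} [Fact p.Prime] {s t : ℕ} (hs : Nat.card L = Nat.card (Subgroup.center H) * s)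
    (hst : s = d * t) (ht : ¬ p ∣ t) (g : H) (o' j : ℕ) (ho' : ¬ p ∣ o') (hg : g ^ (o' * p ^ (j + 1)) ∈ Subgroup.center H)
    (hx : g ^ (o' * p ^ j) ∈ L) (hxZ : g ^ (o' * p ^ j) ∉ Subgroup.center H) : (ρ g).trace = 0 := by
  obtain ⟨A, hA⟩ := exists_val p Fact.out
  obtain ⟨P, hP, hPA⟩ := lattice A ρ
  have h1 : P * P⁻¹ = 1 := Matrix.mul_nonsing_inv P hP
  have h2 : P⁻¹ * P = 1 := Matrix.nonsing_inv_mul P hP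
  let ρ' : H →* Matrix (Fin d) (Fin d) ℂ :=
    { toFun := fun g => P⁻¹ * ρ g * P
      map_one' := by rw [map_one, mul_one, h2]
      map_mul' := by
        intro a b
        rw [map_mul]
        calc P⁻¹ * (ρ a * ρ b) * P = P⁻¹ * ρ a * 1 * ρ b * P := by simp only [mul_one, mul_assoc]
          _ = _ := by rw [← h1]; simp only [mul_assoc] }
  have e : ∀ g, ρ' g = P⁻¹ * ρ g * P := fun _ => rfl
  have := defect_core hd (ρ := ρ') (L := L) (by
    intro B hB
    obtain ⟨c, hc⟩ := h (P * B * P⁻¹) (by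
      intro l hl
      have h3 := hB l hl
      rw [e] at h3
      calc ρ l * (P * B * P⁻¹) = (P * P⁻¹) * ρ l * P * B * P⁻¹ := by rw [h1]; simp only [one_mul, mul_assoc]
        _ = P * (P⁻¹ * ρ l * P * B) * P⁻¹ := by simp only [mul_assoc]
        _ = P * B * P⁻¹ * ρ l * (P * P⁻¹) := by rw [h3]; simp only [mul_assoc]
        _ = _ := by rw [h1, mul_one])
    refine ⟨c, ?_⟩
    calc B = (P⁻¹ * P) * B * (P⁻¹ * P) := by rw [h2, one_mul, mul_one]
      _ = P⁻¹ * (P * B * P⁻¹) * P := by simp only [mul_assoc]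
      _ = _ := by rw [hc, mul_smul_comm, mul_one, smul_mul_assoc, h2]) hZ hs hst ht A hA hPA g o' j ho' hg hx hxZ
  rw [e, Matrix.trace_mul_comm, ← mul_assoc, h1, one_mul] at this
  exact this
end C3
end PX

namespace PX
section D1
open Matrix

abbrev SL (n : ℕ) (F : Type) [Field F] := Matrix.SpecialLinearGroup (Fin n) F
abbrev PS (n : ℕ) (F : Type) [Field F] := SL n F ⧸ Subgroup.center (SL n F)

/-- underlying matrix -/
def mt {F : Type} [Field F] {n : ℕ} : SL n F →* Matrix (Fin n) (Fin n) F :=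
  { toFun := fun u => u.1
    map_one' := rfl
    map_mul' := fun _ _ => rfl }

theorem mt_inj {F : Type} [Field F] {n : ℕ} {u v : SL n F} (h : mt u = mt v) : u = v := Subtype.ext h
theorem mt_det {F : Type} [Field F] {n : ℕ} (u : SL n F) : (mt u).det = 1 := u.2
theorem mt_ex {F : Type} [Field F] {n : ℕ} (M : Matrix (Fin n) (Fin n) F) (h : M.det = 1) : ∃ u : SL n F, mt u = M := ⟨⟨M, h⟩, rfl⟩
theorem mt_center {F : Type} [Field F] {n : ℕ} {z : SL n F} : z ∈ Subgroup.center (SL n F) ↔ ∃ r : F, r ^ n = 1 ∧ mt z = r • 1 := by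
  rw [Matrix.SpecialLinearGroup.mem_center_iff, Fintype.card_fin]
  refine exists_congr (fun r => and_congr_right (fun _ => ?_))
  rw [Matrix.smul_one_eq_diagonal, eq_comm]
  rfl

variable {F : Type} [Field F] {p : ℕ} [Fact p.Prime] [CharP F p] {n : ℕ} [NeZero n]

theorem pow_sub_one (M : Matrix (Fin n) (Fin n) F) (k : ℕ) [CharP (Matrix (Fin n) (Fin n) F) p] :
    (M - 1) ^ p ^ k = M ^ p ^ k - 1 := by
  have := sub_pow_expChar_pow_of_commute (p := p) k (Commute.one_right M)
  rwa [one_pow] at this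

theorem field_p {r : F} {k : ℕ} (h : r ^ p ^ k = 1) : r = 1 := by
  have : (r - 1) ^ p ^ k = 0 := by rw [sub_pow_char_pow, h, one_pow, sub_self]
  exact sub_eq_zero.1 (eq_zero_of_pow_eq_zero this)

theorem center_p {z : SL n F} (hz : z ∈ Subgroup.center (SL n F)) {k : ℕ} (h : z ^ p ^ k = 1) : z = 1 := by
  obtain ⟨r, hr, hrz⟩ := mt_center.1 hz
  have h1 : r ^ p ^ k = 1 := by
    have h2 := congrArg (fun M : SL n F => mt M 0 0) h
    simp only [map_pow, hrz, smul_pow, one_pow, map_one] at h2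
    simpa using h2
  apply mt_inj
  rw [hrz, field_p h1, one_smul, map_one]

variable [Fintype F]

theorem center_coprime : Nat.Coprime (Nat.card (Subgroup.center (SL n F))) p := by
  rw [Nat.coprime_comm, Nat.Prime.coprime_iff_not_dvd Fact.out]
  intro h
  obtain ⟨z, hz⟩ := exists_prime_orderOf_dvd_card' p h
  have h1 : (z : SL n F) ^ p ^ 1 = 1 := by
    rw [pow_one, ← hz, ← Subgroup.coe_pow, pow_orderOf_eq_one]; rfl
  have h2 := center_p z.2 h1
  have h3 : z = 1 := Subtype.ext h2
  rw [h3, orderOf_one] at hz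
  exact (Fact.out : p.Prime).one_lt.ne hz

theorem lift_p {s : PS n F} {k : ℕ} (hs : s ^ p ^ k = 1) : ∃ u : SL n F, QuotientGroup.mk u = s ∧ u ^ p ^ k = 1 := by
  obtain ⟨v, rfl⟩ := QuotientGroup.mk_surjective s
  have h1 : v ^ p ^ k ∈ Subgroup.center (SL n F) := by
    rw [← QuotientGroup.mk_pow] at hs; exact (QuotientGroup.eq_one_iff _).1 hs
  have hc : Nat.Coprime (Nat.card (Subgroup.center (SL n F))) (p ^ k) := center_coprime.pow_right k
  let z : Subgroup.center (SL n F) := (powCoprime hc).symm ⟨_, h1⟩⁻¹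
  have hz : z ^ p ^ k = ⟨_, h1⟩⁻¹ := (powCoprime hc).apply_symm_apply _
  refine ⟨v * z, ?_, ?_⟩
  · exact QuotientGroup.mk_mul_of_mem _ z.2
  · have : Commute v (z : SL n F) := (Subgroup.mem_center_iff.1 z.2 v)
    rw [this.mul_pow, ← Subgroup.coe_pow, hz]
    simp

theorem comm_exact {g u : SL n F} {k : ℕ} (hu : u ^ p ^ k = 1)
    (h : (QuotientGroup.mk g : PS n F) * QuotientGroup.mk u = QuotientGroup.mk u * QuotientGroup.mk g) : g * u = u * g := by
  rw [← QuotientGroup.mk_mul, ← QuotientGroup.mk_mul] at h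
  have h0 := QuotientGroup.eq.1 h
  have h0' : u⁻¹ * (g * u * g⁻¹) ∈ Subgroup.center (SL n F) := by
    have h1 := (Subgroup.center (SL n F)).inv_mem h0
    have := (inferInstance : (Subgroup.center (SL n F)).Normal).conj_mem _ h1 g
    convert this using 1
    group
  set z := u⁻¹ * (g * u * g⁻¹) with hz
  have h2 : u * z = g * u * g⁻¹ := by rw [hz]; group
  have h3 : (u * z) ^ p ^ k = 1 := by rw [h2, conj_pow, hu]; simp
  have hc : Commute u z := Subgroup.mem_center_iff.1 h0' u
  rw [hc.mul_pow, hu, one_mul] at h3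
  have h4 := center_p h0' h3
  rw [h4, mul_one] at h2
  nth_rw 2 [h2]
  group

theorem nil_pow {M : Matrix (Fin n) (Fin n) F} {k : ℕ} (h : M ^ k = 0) : M ^ n = 0 := by
  have h1 : M.charpoly = Polynomial.X ^ n := by
    have := Matrix.isNilpotent_charpoly_sub_pow_of_isNilpotent ⟨k, h⟩
    have h2 := this.eq_zero
    rw [sub_eq_zero] at h2
    simpa using h2
  have := Matrix.aeval_self_charpoly M
  rw [h1] at this
  simpa using this

/-- order bound -/
theorem order_bound {s : PS n F} {e : ℕ} (he : e ≠ 0) (hs : orderOf s = p ^ e) : p ^ (e - 1) < n := by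
  have : CharP (Matrix (Fin n) (Fin n) F) p := Matrix.charP p
  obtain ⟨u, rfl, hu⟩ := lift_p (p := p) (s := s) (k := e) (by rw [← hs, pow_orderOf_eq_one])
  by_contra hcon
  rw [not_lt] at hcon
  have h1 : (mt u - 1) ^ p ^ e = 0 := by
    rw [pow_sub_one, ← map_pow, hu]; simp
  have h2 := pow_eq_zero_of_le hcon (nil_pow h1)
  rw [pow_sub_one, ← map_pow, sub_eq_zero] at h2
  have h3 : u ^ p ^ (e - 1) = 1 := mt_inj (by rw [h2, map_one])
  have h4 : (QuotientGroup.mk u : PS n F) ^ p ^ (e - 1) = 1 := by rw [← QuotientGroup.mk_pow, h3]; rfl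
  have h5 := orderOf_dvd_of_pow_eq_one h4
  rw [hs] at h5
  have := Nat.pow_dvd_pow_iff_le_right (Fact.out : p.Prime).one_lt |>.1 h5
  omega

end D1
end PX

namespace PX
section D2
open Matrix

variable {F : Type} [Field F] {n : ℕ}

/-- unipotent radical type subgroup -/
def RR (ν : Matrix (Fin n) (Fin n) F) : Subgroup (SL n F) where
  carrier := {g | ν * mt g = ν ∧ ∀ w, ν *ᵥ w = 0 → mt g *ᵥ w = w}
  one_mem' := by simp
  mul_mem' := by
    rintro a b ⟨ha, ha'⟩ ⟨hb, hb'⟩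
    refine ⟨by rw [map_mul, ← mul_assoc, ha, hb], fun w hw => ?_⟩
    rw [map_mul, ← mulVec_mulVec, hb' w hw, ha' w hw]
  inv_mem' := by
    rintro a ⟨ha, ha'⟩
    have h1 : mt a * mt a⁻¹ = 1 := by rw [← map_mul]; simp
    have h2 : mt a⁻¹ * mt a = 1 := by rw [← map_mul]; simp
    refine ⟨?_, fun w hw => ?_⟩
    · nth_rw 1 [← ha]; rw [mul_assoc, h1, mul_one]
    · nth_rw 1 [← ha' w hw]; rw [mulVec_mulVec, h2, one_mulVec]

theorem mem_RR {ν : Matrix (Fin n) (Fin n) F} {g : SL n F} : g ∈ RR ν ↔ ν * mt g = ν ∧ ∀ w, ν *ᵥ w = 0 → mt g *ᵥ w = w := Iff.rfl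

theorem sq_zero {ν M : Matrix (Fin n) (Fin n) F} (h1 : ν * M = ν) (h2 : ∀ w, ν *ᵥ w = 0 → M *ᵥ w = w) : (M - 1) * (M - 1) = 0 := by
  have h3 : ν * (M - 1) = 0 := by rw [mul_sub, h1, mul_one, sub_self]
  rw [sub_mul, one_mul, sub_eq_zero]
  ext i j
  have := congrFun (h2 (fun k => (M - 1) k j) (by
    ext i
    exact congrFun (congrFun h3 i) j)) i
  exact this

variable {p : ℕ} [Fact p.Prime] [CharP F p] [NeZero n]

theorem pow_one_of {ν M : Matrix (Fin n) (Fin n) F} (h1 : ν * M = ν) (h2 : ∀ w, ν *ᵥ w = 0 → M *ᵥ w = w) : M ^ p = 1 := by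
  have : CharP (Matrix (Fin n) (Fin n) F) p := Matrix.charP p
  have h3 := pow_sub_one (p := p) M 1
  rw [pow_one] at h3
  have h4 : (M - 1) ^ p = 0 := pow_eq_zero_of_le (Fact.out : p.Prime).two_le (by rw [pow_two, sq_zero h1 h2])
  rw [h4] at h3
  exact (sub_eq_zero.1 h3.symm)

theorem RR_pow {ν : Matrix (Fin n) (Fin n) F} {g : SL n F} (hg : g ∈ RR ν) : g ^ p = 1 := by
  apply mt_inj
  rw [map_pow, map_one]
  exact pow_one_of hg.1 hg.2

variable [Fintype F]

theorem HS_PS : HS p (PS n F) := by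
  have hp : p.Prime := Fact.out
  intro x hx
  let π := QuotientGroup.mk' (Subgroup.center (SL n F))
  obtain ⟨u, rfl, hu⟩ := lift_p (p := p) (s := x) (k := 1) (by rw [pow_one, ← hx, pow_orderOf_eq_one])
  have hu1 : u ≠ 1 := by
    rintro rfl
    rw [QuotientGroup.mk_one, orderOf_one] at hx
    exact hp.one_lt.ne hx
  set ν := mt u - 1 with hν
  have hν0 : ν ≠ 0 := fun h => hu1 (mt_inj (by rw [sub_eq_zero.1 h, map_one]))
  have hνp : ν ^ p = 0 := by
    have : CharP (Matrix (Fin n) (Fin n) F) p := Matrix.charP p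
    have := pow_sub_one (p := p) (mt u) 1
    rw [← map_pow, hu, map_one, sub_self, pow_one] at this
    exact this
  have hconj : ∀ g : SL n F, g * u = u * g → ∀ r ∈ RR ν, g * r * g⁻¹ ∈ RR ν := by
    intro g hg r hr
    have hgν : mt g * ν = ν * mt g := by rw [hν, mul_sub, sub_mul, ← map_mul, hg, map_mul]; simp
    have h1 : mt g * mt g⁻¹ = 1 := by rw [← map_mul]; simp
    have h2 : mt g⁻¹ * mt g = 1 := by rw [← map_mul]; simp
    have hgν' : mt g⁻¹ * ν = ν * mt g⁻¹ := by
      calc mt g⁻¹ * ν = mt g⁻¹ * (ν * mt g) * mt g⁻¹ := by rw [mul_assoc, mul_assoc, h1, mul_one]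
        _ = _ := by rw [← hgν, ← mul_assoc, h2, one_mul]
    refine ⟨?_, fun w hw => ?_⟩
    · rw [map_mul, map_mul, ← mul_assoc, ← mul_assoc, ← hgν, mul_assoc (mt g), hr.1, hgν, mul_assoc, h1, mul_one]
    · have h3 : ν *ᵥ (mt g⁻¹ *ᵥ w) = 0 := by rw [mulVec_mulVec, ← hgν', ← mulVec_mulVec, hw, mulVec_zero]
      rw [map_mul, map_mul, ← mulVec_mulVec, ← mulVec_mulVec, hr.2 _ h3, mulVec_mulVec, h1, one_mulVec]
  -- exact commutation
  have hcx : ∀ g : SL n F, (QuotientGroup.mk g : PS n F) ∈ Subgroup.centralizer {(QuotientGroup.mk u : PS n F)} → g * u = u * g := by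
    intro g hg
    exact comm_exact hu (Subgroup.mem_centralizer_singleton_iff.1 hg)
  let Rb : Subgroup (PS n F) := (RR ν).map π
  have hRp : IsPGroup p Rb := by
    apply IsPGroup.map
    intro r
    exact ⟨1, Subtype.ext (by rw [pow_one]; exact RR_pow r.2)⟩
  have hCR : ∀ g ∈ Subgroup.centralizer {(QuotientGroup.mk u : PS n F)}, ∀ y ∈ Rb, g * y * g⁻¹ ∈ Rb := by
    intro g hg y hy
    obtain ⟨g, rfl⟩ := QuotientGroup.mk_surjective g
    obtain ⟨r, hr, rfl⟩ := hy
    exact ⟨g * r * g⁻¹, hconj g (hcx g hg) r hr, rfl⟩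
  have norm_of : ∀ (C K : Subgroup (PS n F)), (∀ g ∈ C, ∀ y ∈ K, g * y * g⁻¹ ∈ K) → C ≤ Subgroup.normalizer (K : Set (PS n F)) := by
    intro C K hCK g hg
    rw [Subgroup.mem_normalizer_iff]
    intro y
    refine ⟨hCK g hg y, fun h => ?_⟩
    have := hCK g⁻¹ (C.inv_mem hg) _ h
    convert this using 1
    group
  refine ⟨Subgroup.zpowers (QuotientGroup.mk u : PS n F) ⊔ Rb, ?_, ?_, ?_, ?_⟩
  · refine IsPGroup.to_sup_of_normal_right' (zpowers_pgroup ⟨1, ?_⟩) hRp (norm_of _ _ (fun g hg => hCR g ?_))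
    · rw [pow_one, ← hx, pow_orderOf_eq_one]
    · exact (Subgroup.zpowers_le.2 (Subgroup.mem_centralizer_singleton_iff.2 rfl)) hg
  · exact Subgroup.mem_sup_left (Subgroup.mem_zpowers _)
  · apply norm_of
    intro g hg
    have : Subgroup.zpowers (QuotientGroup.mk u : PS n F) ⊔ Rb ≤ (Subgroup.zpowers (QuotientGroup.mk u : PS n F) ⊔ Rb).comap (MulAut.conj g).toMonoidHom := by
      refine sup_le (Subgroup.zpowers_le.2 ?_) (fun y hy => ?_)
      · change g * QuotientGroup.mk u * g⁻¹ ∈ Subgroup.zpowers (QuotientGroup.mk u : PS n F) ⊔ Rb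
        rw [Subgroup.mem_centralizer_singleton_iff.1 hg, mul_inv_cancel_right]
        exact Subgroup.mem_sup_left (Subgroup.mem_zpowers _)
      · exact (le_sup_right : Rb ≤ _) (hCR g hg y hy)
    exact fun y hy => this hy
  · intro g hg
    apply (le_sup_right : Rb ≤ _)
    obtain ⟨g, rfl⟩ := QuotientGroup.mk_surjective g
    have hgR : ∀ r ∈ RR ν, g * r = r * g := by
      intro r hr
      refine comm_exact (p := p) (k := 1) (by rw [pow_one]; exact RR_pow hr) ?_
      exact (Subgroup.mem_centralizer_iff.1 hg _ ((le_sup_right : Rb ≤ _) ⟨r, hr, rfl⟩)).symm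
    -- rank one elements
    have hrk : ∀ w μ, ν *ᵥ w = 0 → mt g * vecMulVec w (μ ᵥ* ν) = vecMulVec w (μ ᵥ* ν) * mt g := by
      intro w μ hw
      have hm1 : ν * (1 + vecMulVec w (μ ᵥ* ν)) = ν := by
        rw [mul_add, mul_one, mul_vecMulVec, hw]; simp
      have hm2 : ∀ v, ν *ᵥ v = 0 → (1 + vecMulVec w (μ ᵥ* ν)) *ᵥ v = v := by
        intro v hv
        rw [add_mulVec, one_mulVec, vecMulVec_mulVec, ← dotProduct_mulVec, hv]; simp
      have hdet : (1 + vecMulVec w (μ ᵥ* ν)).det = 1 := by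
        have := congrArg Matrix.det (pow_one_of (p := p) hm1 hm2)
        rw [det_pow, det_one] at this
        exact field_p (p := p) (k := 1) (by rwa [pow_one])
      obtain ⟨r, hr⟩ := mt_ex _ hdet
      have := congrArg mt (hgR r ⟨by rw [hr, hm1], by rw [hr]; exact hm2⟩)
      rw [map_mul, map_mul, hr, mul_add, add_mul, mul_one, one_mul] at this
      exact add_left_cancel this
    -- kernel vector
    obtain ⟨w0, hw0, hw0'⟩ : ∃ w0, w0 ≠ 0 ∧ ν *ᵥ w0 = 0 := by
      apply Matrix.exists_mulVec_eq_zero_iff.2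
      have := congrArg Matrix.det hνp
      rw [det_pow, det_zero] at this
      exact eq_zero_of_pow_eq_zero this
    obtain ⟨k, hk⟩ : ∃ k, w0 k ≠ 0 := Function.ne_iff.1 hw0
    set c := (mt g *ᵥ w0) k / w0 k with hc
    have hνg : ν * mt g = c • ν := by
      ext i j
      have h1 := hrk w0 (Pi.single i 1) hw0'
      rw [mul_vecMulVec, vecMulVec_mul] at h1
      have h2 := congrFun (congrFun h1 k) j
      simp only [vecMulVec_apply, vecMul_vecMul, single_one_vecMul] at h2
      rw [Matrix.smul_apply, smul_eq_mul, hc, div_mul_eq_mul_div, eq_div_iff hk, mul_comm]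
      exact h2.symm
    obtain ⟨i0, j0, hij⟩ : ∃ i j, ν i j ≠ 0 := by
      by_contra hcon
      push Not at hcon
      exact hν0 (by ext i j; exact hcon i j)
    have hgw : ∀ w, ν *ᵥ w = 0 → mt g *ᵥ w = c • w := by
      intro w hw
      have h1 := hrk w (Pi.single i0 1) hw
      rw [mul_vecMulVec, vecMulVec_mul, vecMul_vecMul, hνg] at h1
      ext i
      have h2 := congrFun (congrFun h1 i) j0
      simp only [vecMulVec_apply, single_one_vecMul] at h2
      simp only [row_apply, Matrix.smul_apply, smul_eq_mul] at h2
      rw [← mul_assoc] at h2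
      have := mul_right_cancel₀ hij h2
      rw [this, mul_comm]; rfl
    have hc0 : c ≠ 0 := by
      intro h0
      rw [h0, zero_smul] at hνg
      have h1 : mt g * mt g⁻¹ = 1 := by rw [← map_mul]; simp
      have : ν * mt g * mt g⁻¹ = 0 := by rw [hνg, zero_mul]
      rw [mul_assoc, h1, mul_one] at this
      exact hν0 this
    have hm1 : ν * (c⁻¹ • mt g) = ν := by rw [mul_smul_comm, hνg, smul_smul, inv_mul_cancel₀ hc0, one_smul]
    have hm2 : ∀ v, ν *ᵥ v = 0 → (c⁻¹ • mt g) *ᵥ v = v := by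
      intro v hv
      rw [smul_mulVec, hgw v hv, smul_smul, inv_mul_cancel₀ hc0, one_smul]
    have hdet : (c⁻¹ • mt g).det = 1 := by
      have := congrArg Matrix.det (pow_one_of (p := p) hm1 hm2)
      rw [det_pow, det_one] at this
      exact field_p (p := p) (k := 1) (by rwa [pow_one])
    obtain ⟨r, hr⟩ := mt_ex _ hdet
    refine ⟨r, ⟨by rw [hr, hm1], by rw [hr]; exact hm2⟩, ?_⟩
    refine QuotientGroup.eq.2 (mt_center.2 ⟨c, ?_, ?_⟩)
    · rw [det_smul, mt_det, mul_one, inv_pow, Fintype.card_fin, inv_eq_one] at hdet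
      exact hdet
    · have h1 : mt r⁻¹ * mt r = 1 := by rw [← map_mul]; simp
      have h2 : mt g = c • mt r := by rw [hr, smul_smul, mul_inv_cancel₀ hc0, one_smul]
      rw [map_mul, h2, mul_smul_comm, h1]

end D2
end PX

namespace PX
section D3
open Matrix

variable {F : Type} [Field F] {n : ℕ}

/-- elementary matrices -/
def EE (i j : Fin n) (h : i ≠ j) (x : F) : SL n F := ⟨transvection i j x, det_transvection_of_ne i j h x⟩

theorem mt_EE (i j : Fin n) (h : i ≠ j) (x : F) : mt (EE i j h x) = 1 + Matrix.single i j x := rfl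

theorem EE_mul_apply (i j : Fin n) (x : F) (M : Matrix (Fin n) (Fin n) F) (a b : Fin n) :
    ((1 + Matrix.single i j x) * M) a b = M a b + if a = i then x * M j b else 0 := by
  rw [add_mul, one_mul, Matrix.add_apply]
  congr 1
  split_ifs with h
  · subst h; simp
  · rw [Matrix.single_mul_apply_of_ne _ _ _ _ _ h]

theorem EE_inv (i j : Fin n) (h : i ≠ j) (x : F) : (EE i j h x)⁻¹ = EE i j h (-x) := by
  rw [inv_eq_iff_mul_eq_one]
  apply mt_inj
  rw [map_mul, map_one]
  change transvection i j x * transvection i j (-x) = 1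
  rw [transvection_mul_transvection_same _ _ h, add_neg_cancel, transvection_zero]

variable [Fintype F]

/-- unitriangular -/
def UT (n : ℕ) (F : Type) [Field F] [Fintype F] : Subgroup (SL n F) :=
  let T : Submonoid (SL n F) :=
  { carrier := {g | ∀ i j, j ≤ i → mt g i j = if i = j then 1 else 0}
    one_mem' := by
      intro i j _
      rw [map_one, Matrix.one_apply]
    mul_mem' := by
      intro a b ha hb i j hij
      rw [map_mul, Matrix.mul_apply]
      rw [Finset.sum_eq_single i]
      · rw [ha i i le_rfl, hb i j hij]; simp
      · intro k _ hk
        rcases lt_or_gt_of_ne hk with h | h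
        · rw [ha i k h.le, if_neg h.ne', zero_mul]
        · rw [hb k j (hij.trans h.le), if_neg (hij.trans_lt h).ne', mul_zero]
      · simp }
  { T with
    inv_mem' := by
      intro x hx
      have : x⁻¹ = x ^ (orderOf x - 1) := by
        rw [inv_eq_iff_mul_eq_one, ← pow_succ', Nat.sub_add_cancel (orderOf_pos x), pow_orderOf_eq_one]
      rw [this]
      exact T.pow_mem hx _ }

theorem mem_UT {g : SL n F} : g ∈ UT n F ↔ ∀ i j, j ≤ i → mt g i j = if i = j then 1 else 0 := Iff.rfl

theorem EE_mem_UT {i j : Fin n} (h : i < j) (x : F) : EE i j h.ne x ∈ UT n F := by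
  intro a b hab
  rw [mt_EE, Matrix.add_apply, Matrix.one_apply, Matrix.single_apply, if_neg (c := i = a ∧ j = b), add_zero]
  rintro ⟨rfl, rfl⟩
  exact absurd hab (not_le.2 h)

theorem UT_gen (K : Subgroup (SL n F)) (hK : ∀ i j (h : i < j) (x : F), EE i j h.ne x ∈ K) : UT n F ≤ K := by
  classical
  have key : ∀ N : ℕ, ∀ u ∈ UT n F, (Finset.univ.filter (fun a : Fin n × Fin n => a.1 < a.2 ∧ mt u a.1 a.2 ≠ 0)).card = N → u ∈ K := by
    intro N
    induction N with
    | zero =>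
      intro u hu h0
      rw [Finset.card_eq_zero, Finset.filter_eq_empty_iff] at h0
      have : u = 1 := by
        apply mt_inj
        ext i j
        rw [map_one, Matrix.one_apply]
        rcases le_or_gt j i with h | h
        · exact hu i j h
        · rw [if_neg h.ne]
          have := h0 (Finset.mem_univ (i, j))
          simp only [not_and, not_not] at this
          exact this h
      rw [this]; exact K.one_mem
    | succ N ih =>
      intro u hu h0
      set s := (Finset.univ.filter (fun a : Fin n × Fin n => a.1 < a.2 ∧ mt u a.1 a.2 ≠ 0)) with hs
      obtain ⟨⟨i, j⟩, hij, hmax⟩ := Finset.exists_max_image s Prod.fst (Finset.card_pos.1 (by omega))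
      have hij' := (Finset.mem_filter.1 hij).2
      have hlt : i < j := hij'.1
      have hrow : ∀ b, mt u j b = if j = b then 1 else 0 := by
        intro b
        rcases le_or_gt b j with h | h
        · exact hu j b h
        · rw [if_neg h.ne]
          by_contra hcon
          have : (j, b) ∈ s := Finset.mem_filter.2 ⟨Finset.mem_univ _, h, hcon⟩
          exact absurd (hmax _ this) (not_le.2 hlt)
      set u' := EE i j hlt.ne (-(mt u i j)) * u with hu'
      have hent : ∀ a b, mt u' a b = if a = i ∧ b = j then 0 else mt u a b := by
        intro a b
        rw [hu', map_mul, mt_EE, EE_mul_apply, hrow]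
        by_cases ha : a = i
        · by_cases hb : b = j
          · subst ha hb; simp
          · simp [ha, hb, Ne.symm hb]
        · simp [ha]
      have h1 : u' ∈ K := by
        refine ih u' ((UT n F).mul_mem (EE_mem_UT hlt _) hu) ?_
        have : (Finset.univ.filter (fun a : Fin n × Fin n => a.1 < a.2 ∧ mt u' a.1 a.2 ≠ 0)) = s.erase (i, j) := by
          ext ⟨a, b⟩
          simp only [Finset.mem_filter, Finset.mem_univ, true_and, Finset.mem_erase, hs, hent, ne_eq, Prod.mk.injEq]
          by_cases hab : a = i ∧ b = j <;> simp [hab]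
        rw [this, Finset.card_erase_of_mem hij, h0]; rfl
      have h2 : u = (EE i j hlt.ne (-(mt u i j)))⁻¹ * u' := by rw [hu', inv_mul_cancel_left]
      rw [h2]
      exact K.mul_mem (K.inv_mem (hK i j hlt _)) h1
  exact fun u hu => key _ u hu rfl

theorem UT_card : Nat.card (UT n F) = Fintype.card F ^ (∑ i ∈ Finset.range n, i) := by
  classical
  let f : UT n F → (∀ i : Fin n, {j // j ∈ Finset.Ioi i} → F) := fun u i j => mt (u : SL n F) i j
  have hf : Function.Bijective f := by
    constructor
    · intro u v huv
      apply Subtype.ext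
      apply mt_inj
      ext i j
      rcases le_or_gt j i with h | h
      · rw [u.2 i j h, v.2 i j h]
      · exact congrFun (congrFun huv i) ⟨j, Finset.mem_Ioi.2 h⟩
    · intro w
      let M : Matrix (Fin n) (Fin n) F := Matrix.of fun i j => if h : i < j then w i ⟨j, Finset.mem_Ioi.2 h⟩ else if i = j then 1 else 0
      have hM : M.det = 1 := by
        rw [Matrix.det_of_upperTriangular]
        · exact Finset.prod_eq_one (fun i _ => by simp [M])
        · intro i j hij
          have hij' : j < i := hij
          simp [M, not_lt.2 hij'.le, hij'.ne']
      obtain ⟨u, hu⟩ := mt_ex M hM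
      refine ⟨⟨u, fun i j hij => ?_⟩, ?_⟩
      · rw [hu]; simp [M, not_lt.2 hij]
      · funext i j
        change mt u i j = _
        rw [hu]
        have := Finset.mem_Ioi.1 j.2
        simp [M, this]
  rw [Nat.card_congr (Equiv.ofBijective f hf), Nat.card_eq_fintype_card, Fintype.card_pi]
  simp only [Fintype.card_fun, Fintype.card_coe, Fin.card_Ioi]
  rw [Finset.prod_pow_eq_pow_sum, ← Finset.sum_range_reflect, Finset.sum_range]

variable {p : ℕ} [Fact p.Prime] [CharP F p]

theorem GL_val : p ^ (Nat.card (GL (Fin n) F)).factorization p = Fintype.card F ^ (∑ i ∈ Finset.range n, i) := by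
  have hp : p.Prime := Fact.out
  obtain ⟨f, -, hf⟩ := FiniteField.card F p
  have hq : 0 < Fintype.card F := Fintype.card_pos
  have h1 : ∀ i : Fin n, Fintype.card F ^ n - Fintype.card F ^ (i : ℕ) = Fintype.card F ^ (i : ℕ) * (Fintype.card F ^ (n - i) - 1) := by
    intro i
    rw [Nat.mul_sub, mul_one, ← pow_add, Nat.add_sub_cancel' i.2.le]
  rw [Matrix.card_GL_field, Finset.prod_congr rfl (fun i _ => h1 i), Finset.prod_mul_distrib, Finset.prod_pow_eq_pow_sum, Finset.sum_range]
  have h2 : ¬ p ∣ ∏ i : Fin n, (Fintype.card F ^ (n - (i : ℕ)) - 1) := by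
    rw [hp.prime.dvd_finset_prod_iff]
    rintro ⟨i, -, hi⟩
    have h3 : p ∣ Fintype.card F ^ (n - (i : ℕ)) := dvd_pow (hf ▸ dvd_pow_self p f.pos.ne') (by omega)
    have h4 : 1 ≤ Fintype.card F ^ (n - (i : ℕ)) := Nat.one_le_pow _ _ hq
    have := (Nat.dvd_sub h3 hi)
    rw [Nat.sub_sub_self h4] at this
    exact hp.one_lt.ne' (Nat.dvd_one.1 this)
  have h0 : (∏ i : Fin n, (Fintype.card F ^ (n - (i : ℕ)) - 1)) ≠ 0 := fun h => h2 (by rw [h]; exact dvd_zero p)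
  rw [Nat.factorization_mul (pow_pos hq _).ne' h0]
  rw [Finsupp.add_apply, Nat.factorization_eq_zero_of_not_dvd h2, add_zero, hf, ← pow_mul, hp.factorization_pow, Finsupp.single_eq_same]

theorem SL_val [NeZero n] : p ^ (Nat.card (SL n F)).factorization p = Fintype.card F ^ (∑ i ∈ Finset.range n, i) := by
  classical
  have hp : p.Prime := Fact.out
  obtain ⟨f, -, hf⟩ := FiniteField.card F p
  apply Nat.dvd_antisymm
  · rw [← GL_val (p := p)]
    have h1 : Nat.card (SL n F) ∣ Nat.card (GL (Fin n) F) :=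
      Subgroup.card_dvd_of_injective SpecialLinearGroup.toGL SpecialLinearGroup.toGL_injective
    exact pow_dvd_pow _ ((Nat.factorization_le_iff_dvd Nat.card_pos.ne' Nat.card_pos.ne').2 h1 p)
  · have h1 : Nat.card (UT n F) ∣ Nat.card (SL n F) := Subgroup.card_subgroup_dvd_card _
    rw [UT_card, hf, ← pow_mul] at h1
    rw [hf, ← pow_mul]
    exact pow_dvd_pow _ ((hp.pow_dvd_iff_le_factorization Nat.card_pos.ne').1 h1)

theorem PS_val [NeZero n] : p ^ (Nat.card (PS n F)).factorization p = Fintype.card F ^ (∑ i ∈ Finset.range n, i) := by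
  have hp : p.Prime := Fact.out
  rw [← SL_val (p := p), Subgroup.card_eq_card_quotient_mul_card_subgroup (Subgroup.center (SL n F)),
    Nat.factorization_mul Nat.card_pos.ne' Nat.card_pos.ne', Finsupp.add_apply,
    Nat.factorization_eq_zero_of_not_dvd (n := Nat.card (Subgroup.center (SL n F))), add_zero]
  exact fun h => ((Nat.Prime.coprime_iff_not_dvd hp).1 center_coprime.symm) h

/-- image of unitriangular group -/
def UB (n : ℕ) (F : Type) [Field F] [Fintype F] : Subgroup (PS n F) := (UT n F).map (QuotientGroup.mk' _)

theorem UT_pow [NeZero n] {u : SL n F} (hu : u ∈ UT n F) : ∃ k, u ^ p ^ k = 1 := by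
  obtain ⟨f, -, hf⟩ := FiniteField.card F p
  have : IsPGroup p (UT n F) := IsPGroup.of_card (n := f * (∑ i ∈ Finset.range n, i)) (by rw [UT_card, hf, ← pow_mul])
  obtain ⟨k, hk⟩ := this ⟨u, hu⟩
  exact ⟨k, congrArg Subtype.val hk⟩

theorem UB_card [NeZero n] : Nat.card (UB n F) = p ^ (Nat.card (PS n F)).factorization p := by
  rw [PS_val, ← UT_card]
  symm
  refine Nat.card_congr (Equiv.ofBijective (fun u : UT n F => (⟨QuotientGroup.mk' _ (u : SL n F), ⟨u, u.2, rfl⟩⟩ : UB n F)) ⟨?_, ?_⟩)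
  · intro u v huv
    have h1 := congrArg Subtype.val huv
    have h2 := QuotientGroup.eq.1 h1
    obtain ⟨k, hk⟩ := UT_pow (p := p) ((UT n F).mul_mem ((UT n F).inv_mem u.2) v.2)
    have h3 := center_p h2 hk
    exact Subtype.ext (inv_mul_eq_one.1 h3)
  · rintro ⟨_, u, hu, rfl⟩
    exact ⟨⟨u, hu⟩, rfl⟩

/-- Sylow subgroup -/
noncomputable def US (p : ℕ) [Fact p.Prime] (n : ℕ) [NeZero n] (F : Type) [Field F] [Fintype F] [CharP F p] : Sylow p (PS n F) :=
  Sylow.ofCard (UB n F) UB_card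

theorem US_coe [NeZero n] : ((US p n F : Sylow p (PS n F)) : Subgroup (PS n F)) = UB n F := rfl

end D3
end PX

namespace PX
section D4
open Matrix

variable {F : Type} [Field F] {m : ℕ}

theorem zl : (0 : Fin (m + 2)) ≠ Fin.last (m + 1) := (Fin.last_pos).ne

/-- long root element -/
abbrev E0 (m : ℕ) {F : Type} [Field F] (x : F) : SL (m + 2) F := EE 0 (Fin.last (m + 1)) zl x

theorem comm_entries {n : ℕ} {i j : Fin n} (h : i ≠ j) {x : F} (hx : x ≠ 0) {g : SL n F} (hg : g * EE i j h x = EE i j h x * g) (a b : Fin n) :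
    (if j = b then mt g a i else 0) = (if a = i then mt g j b else 0) := by
  have h1 := congrArg mt hg
  rw [map_mul, map_mul, mt_EE, mul_add, add_mul, mul_one, one_mul] at h1
  have h1' := add_left_cancel h1
  have h2 := congrFun (congrFun h1' a) b
  rw [Matrix.mul_apply, Matrix.mul_apply] at h2
  have e1 : ∑ k, mt g a k * Matrix.single i j x k b = (if j = b then mt g a i else 0) * x := by
    rw [Finset.sum_eq_single i]
    · rw [Matrix.single_apply]; simp
    · intro k _ hk; rw [Matrix.single_apply, if_neg (by simp [Ne.symm hk]), mul_zero]
    · simp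
  have e2 : ∑ k, Matrix.single i j x a k * mt g k b = (if a = i then mt g j b else 0) * x := by
    rw [Finset.sum_eq_single j]
    · rw [Matrix.single_apply]; by_cases hh : a = i
      · simp [hh, mul_comm]
      · simp [hh, Ne.symm hh]
    · intro k _ hk; rw [Matrix.single_apply, if_neg (by simp [Ne.symm hk]), zero_mul]
    · simp
  rw [e1, e2] at h2
  exact mul_right_cancel₀ hx h2

variable {p : ℕ} [Fact p.Prime] [CharP F p] [Fintype F]

theorem EE_pow {n : ℕ} [NeZero n] {i j : Fin n} (h : i ≠ j) (x : F) : (EE i j h x) ^ p = 1 := by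
  have : CharP (Matrix (Fin n) (Fin n) F) p := Matrix.charP p
  apply mt_inj
  have h3 := pow_sub_one (p := p) (mt (EE i j h x)) 1
  have h4 : (mt (EE i j h x) - 1) ^ p = 0 := pow_eq_zero_of_le (Fact.out : p.Prime).two_le (by
    rw [mt_EE, add_sub_cancel_left, pow_two, Matrix.single_mul_single_of_ne _ _ _ _ h.symm])
  rw [pow_one, h4] at h3
  rw [map_pow, map_one]
  exact (sub_eq_zero.1 h3.symm)

theorem cent_UB (p : ℕ) [Fact p.Prime] [CharP F p] {s : PS (m + 2) F} (hs : s ∈ Subgroup.centralizer (UB (m + 2) F : Set (PS (m + 2) F))) :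
    ∃ x : F, s = QuotientGroup.mk (E0 m x) := by
  obtain ⟨g, rfl⟩ := QuotientGroup.mk_surjective s
  have hc : ∀ i j (h : i < j) a b, (if j = b then mt g a i else 0) = (if a = i then mt g j b else 0) := by
    intro i j h
    apply comm_entries h.ne (one_ne_zero (α := F))
    obtain ⟨k, hk⟩ := UT_pow (p := p) (EE_mem_UT h (1 : F))
    exact comm_exact hk (Subgroup.mem_centralizer_iff.1 hs _ ⟨_, EE_mem_UT h 1, rfl⟩).symm
  have h1 : ∀ a b, a ≠ b → a ≠ 0 → mt g a b = 0 := by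
    intro a b hab ha
    have := hc 0 a (Fin.pos_iff_ne_zero.2 ha) 0 b
    rw [if_neg hab, if_pos rfl] at this
    exact this.symm
  have h2 : ∀ a b, a ≠ b → b ≠ Fin.last _ → mt g a b = 0 := by
    intro a b hab hb
    have := hc b (Fin.last _) (Fin.lt_last_iff_ne_last.2 hb) a (Fin.last _)
    rw [if_neg hab, if_pos rfl] at this
    exact this
  have h3 : ∀ a, mt g a a = mt g 0 0 := by
    intro a
    by_cases ha : a = 0
    · rw [ha]
    · have := hc 0 a (Fin.pos_iff_ne_zero.2 ha) 0 a
      rw [if_pos rfl, if_pos rfl] at this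
      exact this.symm
  set c := mt g 0 0 with hcdef
  have hc0 : c ≠ 0 := by
    intro h0
    have : (mt g).det = 0 := by
      apply Matrix.det_eq_zero_of_column_eq_zero 0
      intro i
      by_cases hi : i = 0
      · rw [hi]; exact h0
      · exact h1 i 0 hi hi
    rw [mt_det] at this
    exact one_ne_zero this
  have hg : mt g = c • mt (E0 m (mt g 0 (Fin.last _) / c)) := by
    ext a b
    rw [mt_EE, Matrix.smul_apply, Matrix.add_apply, Matrix.one_apply, Matrix.single_apply, smul_eq_mul]
    by_cases hab : a = b
    · subst hab
      have : ¬ (0 = a ∧ Fin.last (m+1) = a) := by rintro ⟨rfl, h⟩; exact zl h.symm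
      rw [if_pos rfl, if_neg this, add_zero, mul_one, h3]
    · rw [if_neg hab]
      by_cases h : 0 = a ∧ Fin.last (m+1) = b
      · obtain ⟨rfl, rfl⟩ := h
        simp [mul_div_cancel₀ _ hc0]
      · rw [if_neg h]
        simp only [add_zero, mul_zero]
        by_cases ha : a = 0
        · exact h2 a b hab (fun hb => h ⟨ha.symm, hb.symm⟩)
        · exact h1 a b hab ha
  obtain ⟨x, hg⟩ : ∃ x : F, mt g = c • mt (E0 m x) := ⟨_, hg⟩
  refine ⟨x, (QuotientGroup.eq (s := Subgroup.center (SL (m+2) F))).2 ?_⟩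
  rw [← inv_mem_iff, _root_.mul_inv_rev, inv_inv]
  refine mt_center.2 ⟨c, ?_, ?_⟩
  · have := congrArg Matrix.det hg
    rw [det_smul, mt_det, mt_det, mul_one, Fintype.card_fin] at this
    exact this.symm
  · have h5 : ∀ u : SL (m+2) F, mt u⁻¹ * mt u = 1 := fun u => by rw [← map_mul]; simp
    rw [map_mul, hg, mul_smul_comm, h5]

theorem cent_bound (p : ℕ) [Fact p.Prime] [CharP F p] (hm : 1 ≤ m) {x : F} (hx : x ≠ 0) :
    Nat.card (Subgroup.centralizer {(QuotientGroup.mk (E0 m x) : PS (m + 2) F)}) < Fintype.card F ^ ((m + 1) ^ 2) := by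
  classical
  have : Fintype (Subgroup.centralizer {(QuotientGroup.mk (E0 m x) : PS (m + 2) F)}) := Fintype.ofFinite _
  let rep : Subgroup.centralizer {(QuotientGroup.mk (E0 m x) : PS (m + 2) F)} → SL (m + 2) F := fun s => Quotient.out s.1
  have hrep : ∀ s, (QuotientGroup.mk (rep s) : PS (m+2) F) = s.1 := fun s => Quotient.out_eq' _
  have hE : ∀ s, rep s * E0 m x = E0 m x * rep s := by
    intro s
    refine comm_exact (p := p) (k := 1) (by rw [pow_one, EE_pow]) ?_
    rw [hrep]
    exact Subgroup.mem_centralizer_singleton_iff.1 s.2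
  have hent := fun s => comm_entries zl hx (hE s)
  have h1 : ∀ s a, a ≠ 0 → mt (rep s) a 0 = 0 := by
    intro s a ha
    have := hent s a (Fin.last _)
    rwa [if_pos rfl, if_neg ha] at this
  have h2 : ∀ s b, b ≠ Fin.last _ → mt (rep s) (Fin.last _) b = 0 := by
    intro s b hb
    have := hent s 0 b
    rw [if_neg hb.symm, if_pos rfl] at this
    exact this.symm
  have h3 : ∀ s, mt (rep s) (Fin.last _) (Fin.last _) = mt (rep s) 0 0 := by
    intro s
    have := hent s 0 (Fin.last _)
    rw [if_pos rfl, if_pos rfl] at this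
    exact this.symm
  have h0 : ∀ s, mt (rep s) 0 0 ≠ 0 := by
    intro s hs0
    have : (mt (rep s)).det = 0 := by
      apply Matrix.det_eq_zero_of_column_eq_zero 0
      intro i
      by_cases hi : i = 0
      · rw [hi]; exact hs0
      · exact h1 s i hi
    rw [mt_det] at this
    exact one_ne_zero this
  let f : Subgroup.centralizer {(QuotientGroup.mk (E0 m x) : PS (m + 2) F)} → Matrix (Fin (m+1)) (Fin (m+1)) F :=
    fun s => Matrix.of fun i j => (mt (rep s) 0 0)⁻¹ * mt (rep s) i.castSucc j.succ
  have hinj : Function.Injective f := by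
    intro s t hst
    have hN : (mt (rep s) 0 0)⁻¹ • mt (rep s) = (mt (rep t) 0 0)⁻¹ • mt (rep t) := by
      ext a b
      rw [Matrix.smul_apply, Matrix.smul_apply, smul_eq_mul, smul_eq_mul]
      refine Fin.cases ?_ (fun b => ?_) b
      · by_cases ha : a = 0
        · subst ha; rw [inv_mul_cancel₀ (h0 s), inv_mul_cancel₀ (h0 t)]
        · rw [h1 s a ha, h1 t a ha, mul_zero, mul_zero]
      · refine Fin.lastCases ?_ (fun a => ?_) a
        · by_cases hb : b.succ = Fin.last _
          · rw [hb, h3, h3, inv_mul_cancel₀ (h0 s), inv_mul_cancel₀ (h0 t)]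
          · rw [h2 s _ hb, h2 t _ hb, mul_zero, mul_zero]
        · exact congrFun (congrFun hst a) b
    have hN' : mt (rep t) = (mt (rep t) 0 0 * (mt (rep s) 0 0)⁻¹) • mt (rep s) := by
      rw [mul_smul, hN, smul_smul, mul_inv_cancel₀ (h0 t), one_smul]
    obtain ⟨c, hN'⟩ : ∃ c : F, mt (rep t) = c • mt (rep s) := ⟨_, hN'⟩
    apply Subtype.ext
    rw [← hrep, ← hrep]
    refine QuotientGroup.eq.2 (mt_center.2 ⟨c, ?_, ?_⟩)
    · have := congrArg Matrix.det hN'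
      rw [det_smul, mt_det, mt_det, mul_one, Fintype.card_fin] at this
      exact this.symm
    · have h5 : ∀ u : SL (m+2) F, mt u⁻¹ * mt u = 1 := fun u => by rw [← map_mul]; simp
      rw [map_mul, hN', mul_smul_comm, h5]
  have hnot : (0 : Matrix (Fin (m+1)) (Fin (m+1)) F) ∉ Set.range f := by
    rintro ⟨s, hs⟩
    have hz : ∀ i j, mt (rep s) (Fin.castSucc i) (Fin.succ j) = 0 := by
      intro i j
      have := congrFun (congrFun hs i) j
      exact (mul_eq_zero.1 this).resolve_left (inv_ne_zero (h0 s))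
    have : (mt (rep s)).det = 0 := by
      apply Matrix.det_eq_zero_of_row_eq_zero (Fin.castSucc ⟨1, by omega⟩)
      intro j
      refine Fin.cases ?_ (fun b => hz _ b) j
      exact h1 s _ (by rw [Ne, Fin.ext_iff]; simp)
    rw [mt_det] at this
    exact one_ne_zero this
  have := Fintype.card_lt_of_injective_of_notMem f hinj hnot
  rw [Nat.card_eq_fintype_card]
  refine this.trans_eq ?_
  rw [← Nat.card_eq_fintype_card]
  change Nat.card (Fin (m+1) → Fin (m+1) → F) = _
  rw [Nat.card_fun, Nat.card_fun, Nat.card_eq_fintype_card, Nat.card_eq_fintype_card, Fintype.card_fin, ← pow_mul, pow_two]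

end D4
end PX

namespace PX
section D5
open Matrix

variable {F : Type} [Field F] {n m : ℕ}

theorem EE_comm {i j k : Fin n} (hik : i ≠ k) (hkj : k ≠ j) (hij : i ≠ j) (x y : F) :
    EE i k hik x * EE k j hkj y * (EE i k hik x)⁻¹ * (EE k j hkj y)⁻¹ = EE i j hij (x * y) := by
  rw [mul_inv_eq_iff_eq_mul, mul_inv_eq_iff_eq_mul]
  apply mt_inj
  rw [map_mul, map_mul, map_mul, mt_EE, mt_EE, mt_EE]
  have e1 : Matrix.single i k x * Matrix.single k j y = Matrix.single i j (x * y) := by simp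
  have e2 : Matrix.single k j y * Matrix.single i k x = 0 := Matrix.single_mul_single_of_ne _ _ _ _ hij.symm _
  have e3 : Matrix.single i j (x * y) * Matrix.single k j y = 0 := Matrix.single_mul_single_of_ne _ _ _ _ hkj.symm _
  have e4 : Matrix.single i j (x * y) * Matrix.single i k x = 0 := Matrix.single_mul_single_of_ne _ _ _ _ hij.symm _
  simp only [add_mul, mul_add, one_mul, mul_one, e1, e2, e3, e4, zero_mul, add_zero, zero_add]
  abel

theorem EE_E0 {i k : Fin (m + 2)} (hik : i ≠ k) (h1 : i ≠ Fin.last _) (h2 : k ≠ 0) (x : F) :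
    EE i k hik x * E0 m 1 = E0 m 1 * EE i k hik x := by
  apply mt_inj
  rw [map_mul, map_mul, mt_EE, mt_EE]
  have e1 : Matrix.single i k x * Matrix.single 0 (Fin.last (m+1)) (1:F) = 0 := Matrix.single_mul_single_of_ne _ _ _ _ h2 _
  have e2 : Matrix.single (0 : Fin (m+2)) (Fin.last (m+1) : Fin (m+2)) (1:F) * Matrix.single i k x = 0 := Matrix.single_mul_single_of_ne _ _ _ _ h1.symm _
  simp only [add_mul, mul_add, e1, e2, mul_one, one_mul, add_zero]
  abel

theorem diag_single (d : Fin n → F) (i j : Fin n) (x : F) : Matrix.diagonal d * Matrix.single i j x = Matrix.single i j (d i * x) := by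
  ext a b
  rw [Matrix.diagonal_mul, Matrix.single_apply, Matrix.single_apply]
  by_cases h : i = a ∧ j = b
  · rw [if_pos h, if_pos h, h.1]
  · rw [if_neg h, if_neg h, mul_zero]

theorem single_diag (d : Fin n → F) (i j : Fin n) (x : F) : Matrix.single i j x * Matrix.diagonal d = Matrix.single i j (x * d j) := by
  ext a b
  rw [Matrix.mul_diagonal, Matrix.single_apply, Matrix.single_apply]
  by_cases h : i = a ∧ j = b
  · rw [if_pos h, if_pos h, h.2]
  · rw [if_neg h, if_neg h, zero_mul]

/-- commutators of elements commuting with the root element -/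
def CK (K : Subgroup (SL (m + 2) F)) : Prop :=
  ∀ a b : SL (m + 2) F, a * E0 m 1 = E0 m 1 * a → b * E0 m 1 = E0 m 1 * b → a * b * a⁻¹ * b⁻¹ ∈ K

theorem CK_mid {K : Subgroup (SL (m + 2) F)} (hK : CK K) {i j k : Fin (m+2)} (hij : i < j) (h0 : k ≠ 0) (hl : k ≠ Fin.last _) (hi : k ≠ i) (hj : k ≠ j) (x : F) :
    EE i j hij.ne x ∈ K := by
  rw [← mul_one x, ← EE_comm hi.symm hj hij.ne x 1]
  have hil : i ≠ Fin.last _ := fun h => by rw [h] at hij; exact absurd hij (not_lt.2 (Fin.le_last _))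
  have hj0 : j ≠ 0 := fun h => by rw [h] at hij; exact absurd hij (not_lt.2 (Fin.zero_le _))
  exact hK _ _ (EE_E0 _ hil h0 _) (EE_E0 _ hl hj0 _)

theorem CK_diag {K : Subgroup (SL (m + 2) F)} (hK : CK K) {i j : Fin (m+2)} (hij : i < j) (d : Fin (m+2) → F) (hd : ∏ i, d i = 1) (h0 : d 0 = d (Fin.last _)) (hdd : d i ≠ d j) (x : F) :
    EE i j hij.ne x ∈ K := by
  obtain ⟨D, hD⟩ := mt_ex (Matrix.diagonal d) (by rw [Matrix.det_diagonal, hd])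
  have hil : i ≠ Fin.last _ := fun h => by rw [h] at hij; exact absurd hij (not_lt.2 (Fin.le_last _))
  have hj0 : j ≠ 0 := fun h => by rw [h] at hij; exact absurd hij (not_lt.2 (Fin.zero_le _))
  have hne : d i - d j ≠ 0 := sub_ne_zero.2 hdd
  set y := x * d j / (d i - d j) with hy
  have h1 := hK D (EE i j hij.ne y) (by
    apply mt_inj
    rw [map_mul, map_mul, mt_EE, hD, mul_add, add_mul, diag_single, single_diag, h0]
    simp) (EE_E0 _ hil hj0 _)
  convert h1 using 1
  rw [eq_mul_inv_iff_mul_eq, eq_mul_inv_iff_mul_eq]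
  apply mt_inj
  rw [map_mul, map_mul, map_mul, hD, mt_EE, mt_EE]
  have e3 : Matrix.single i j x * Matrix.single i j y = 0 := Matrix.single_mul_single_of_ne _ _ _ _ hij.ne' _
  simp only [mul_add, add_mul, mul_one, one_mul, e3, zero_mul, add_zero, diag_single, single_diag]
  rw [add_assoc, ← Matrix.single_add]
  congr 2
  rw [hy]; field_simp; ring

theorem exists_pow_ne [Fintype F] (k : ℕ) (hk : ¬ (Fintype.card F - 1 ∣ k)) : ∃ a : F, a ≠ 0 ∧ a ^ k ≠ 1 := by
  classical
  obtain ⟨g, hg⟩ := IsCyclic.exists_generator (α := Fˣ)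
  refine ⟨g, g.ne_zero, fun h => hk ?_⟩
  have h1 : orderOf g = Fintype.card F - 1 := by
    rw [orderOf_eq_card_of_forall_mem_zpowers hg, Nat.card_eq_fintype_card, Fintype.card_units]
  rw [← h1]
  apply orderOf_dvd_of_pow_eq_one
  ext; simpa using h

theorem CK_UT [Fintype F] {K : Subgroup (SL (m + 2) F)} (hK : CK K) (hm : 1 ≤ m)
    (h32 : ¬ (m = 1 ∧ Fintype.card F = 2)) (h34 : ¬ (m = 1 ∧ Fintype.card F = 4)) (h42 : ¬ (m = 2 ∧ Fintype.card F = 2)) (h43 : ¬ (m = 2 ∧ Fintype.card F = 3)) :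
    UT (m + 2) F ≤ K := by
  have hq : 2 ≤ Fintype.card F := Fintype.one_lt_card
  apply UT_gen
  intro i j hij x
  by_cases hk : ∃ k : Fin (m+2), k ≠ 0 ∧ k ≠ Fin.last _ ∧ k ≠ i ∧ k ≠ j
  · obtain ⟨k, h1, h2, h3, h4⟩ := hk
    exact CK_mid hK hij h1 h2 h3 h4 x
  push Not at hk
  have hmm : m ≤ 2 := by
    by_contra hmm
    have : (Finset.univ : Finset (Fin (m+2))) ⊆ {0, Fin.last _, i, j} := by
      intro k _
      simp only [Finset.mem_insert, Finset.mem_singleton]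
      by_contra hh
      push Not at hh
      exact hh.2.2.2 (hk k hh.1 hh.2.1 hh.2.2.1)
    have h1 := (Finset.card_le_card this).trans Finset.card_le_four
    rw [Finset.card_univ, Fintype.card_fin] at h1
    omega
  interval_cases m
  · obtain ⟨a, ha, ha3⟩ := exists_pow_ne (F := F) 3 (by
      intro hdv
      have := (Nat.dvd_prime Nat.prime_three).1 hdv
      omega)
    have hne : a ≠ a⁻¹ ^ 2 := by
      intro h
      apply ha3
      have : a ^ 3 = a * a ^ 2 := by ring
      rw [this]
      nth_rw 1 [h]
      rw [inv_pow, inv_mul_cancel₀ (pow_ne_zero _ ha)]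
    refine CK_diag hK hij ![a, a⁻¹ ^ 2, a] ?_ rfl ?_ x
    · rw [Fin.prod_univ_three]; simp; field_simp
    · fin_cases i <;> fin_cases j <;> first | exact absurd hij (by decide) | skip
      · exact hne
      · exact absurd (hk 1 (by decide) (by decide) (by decide)) (by decide)
      · exact hne.symm
  · obtain ⟨b, hb, hb2⟩ := exists_pow_ne (F := F) 2 (by
      intro hdv
      have := (Nat.dvd_prime Nat.prime_two).1 hdv
      omega)
    have hne : b ≠ b⁻¹ := by
      intro h
      apply hb2
      rw [pow_two]; nth_rw 1 [h]; exact inv_mul_cancel₀ hb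
    refine CK_diag hK hij ![1, b, b⁻¹, 1] ?_ rfl ?_ x
    · rw [Fin.prod_univ_four]; simp [hb]
    · fin_cases i <;> fin_cases j <;> first | exact absurd hij (by decide) | exact absurd (hk 1 (by decide) (by decide) (by decide)) (by decide) | exact absurd (hk 2 (by decide) (by decide) (by decide)) (by decide) | skip
      exact hne

theorem E0_ne {x : F} (hx : x ≠ 0) : (QuotientGroup.mk (E0 m x) : PS (m+2) F) ≠ 1 := by
  intro h
  obtain ⟨r, _, hr⟩ := mt_center.1 ((QuotientGroup.eq_one_iff _).1 h)
  rw [mt_EE] at hr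
  have h1 := congrFun (congrFun hr 0) (Fin.last (m+1))
  rw [Matrix.add_apply, Matrix.smul_apply, Matrix.one_apply_ne zl, Matrix.single_apply] at h1
  simp at h1
  exact hx h1

variable (p : ℕ) [Fact p.Prime] [CharP F p] [Fintype F]

theorem sylow_lift {L : Type*} [Group L] [Finite L] (φ : L →* PS (m+2) F) (hφ : Function.Surjective φ) :
    ∃ U : Sylow p L, (U : Subgroup L).map φ = UB (m+2) F := by
  obtain ⟨U, hU⟩ := Sylow.mapSurjective_surjective hφ p (US p (m+2) F)
  refine ⟨U, ?_⟩
  rw [← US_coe (p := p), ← hU]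
  rfl

theorem nonexc {L : Type*} [Group L] [Finite L] (φ : L →* PS (m+2) F) (hφ : Function.Surjective φ) (hker : φ.ker = Subgroup.center L)
    (hm : 1 ≤ m)
    (h32 : ¬ (m = 1 ∧ Fintype.card F = 2)) (h34 : ¬ (m = 1 ∧ Fintype.card F = 4)) (h42 : ¬ (m = 2 ∧ Fintype.card F = 2)) (h43 : ¬ (m = 2 ∧ Fintype.card F = 3)) :
    ∃ U : Sylow p L, ∃ t, t ∈ Subgroup.centralizer ((U : Subgroup L) : Set L) ∧ t ∉ Subgroup.center L := by
  obtain ⟨T, hT⟩ := hφ (QuotientGroup.mk (E0 m (1:F)))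
  have hcm : ∀ A : L, ∀ a : SL (m+2) F, φ A = QuotientGroup.mk a → a * E0 m 1 = E0 m 1 * a →
      ∃ z ∈ Subgroup.center L, A * T = T * A * z := by
    intro A a hA ha
    refine ⟨(T * A)⁻¹ * (A * T), ?_, by group⟩
    rw [← hker, MonoidHom.mem_ker, map_mul, map_inv, map_mul, map_mul, hA, hT, ← QuotientGroup.mk_mul, ← QuotientGroup.mk_mul, ha, inv_mul_cancel]
  obtain ⟨U, hU⟩ := sylow_lift p φ hφ
  have hK : UT (m+2) F ≤ ((Subgroup.centralizer {T}).map φ).comap (QuotientGroup.mk' (Subgroup.center (SL (m+2) F))) := by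
    refine CK_UT ?_ hm h32 h34 h42 h43
    intro a b ha hb
    obtain ⟨A, hA⟩ := hφ (QuotientGroup.mk a)
    obtain ⟨B, hB⟩ := hφ (QuotientGroup.mk b)
    obtain ⟨z, hz, hAz⟩ := hcm A a hA ha
    obtain ⟨w, hw, hBw⟩ := hcm B b hB hb
    refine ⟨A * B * A⁻¹ * B⁻¹, ?_, ?_⟩
    · apply Subgroup.mem_centralizer_singleton_iff.2
      have hzc := fun g => Subgroup.mem_center_iff.1 hz g
      have hwc := fun g => Subgroup.mem_center_iff.1 hw g
      have e1 : T⁻¹ * A * T = A * z := by rw [mul_assoc, hAz]; group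
      have e2 : T⁻¹ * B * T = B * w := by rw [mul_assoc, hBw]; group
      have e3 : T⁻¹ * (A * B * A⁻¹ * B⁻¹) * T = A * B * A⁻¹ * B⁻¹ := by
        calc T⁻¹ * (A * B * A⁻¹ * B⁻¹) * T = (T⁻¹ * A * T) * (T⁻¹ * B * T) * (T⁻¹ * A * T)⁻¹ * (T⁻¹ * B * T)⁻¹ := by group
          _ = A * z * (B * w) * (A * z)⁻¹ * (B * w)⁻¹ := by rw [e1, e2]
          _ = A * (z * B) * w * z⁻¹ * A⁻¹ * w⁻¹ * B⁻¹ := by group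
          _ = A * B * (z * w) * z⁻¹ * A⁻¹ * w⁻¹ * B⁻¹ := by rw [← hzc B]; group
          _ = A * B * (w * A⁻¹) * w⁻¹ * B⁻¹ := by rw [hwc z]; group
          _ = _ := by rw [← hwc A⁻¹]; group
      calc A * B * A⁻¹ * B⁻¹ * T = T * (T⁻¹ * (A * B * A⁻¹ * B⁻¹) * T) := by group
        _ = _ := by rw [e3]
    · simp only [map_mul, map_inv, hA, hB]
      rfl
  refine ⟨U, T, ?_, ?_⟩
  · rw [Subgroup.mem_centralizer_iff]
    intro u hu
    have h1 : φ u ∈ UB (m+2) F := by rw [← hU]; exact ⟨u, hu, rfl⟩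
    obtain ⟨w, hw, hwu⟩ := h1
    obtain ⟨c, hc, hcu⟩ := hK hw
    have h2 : c⁻¹ * u ∈ Subgroup.center L := by
      rw [← hker, MonoidHom.mem_ker, map_mul, map_inv, hcu, hwu, inv_mul_cancel]
    have h3 := Subgroup.mem_center_iff.1 h2 T
    have h4 : c * T = T * c := Subgroup.mem_centralizer_singleton_iff.1 hc
    calc u * T = c * (c⁻¹ * u * T) := by group
      _ = c * T * (c⁻¹ * u) := by rw [← h3]; group
      _ = T * u := by rw [h4]; group
  · rw [← hker, MonoidHom.mem_ker, hT]
    exact E0_ne one_ne_zero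

end D5
end PX

namespace PX
section D6

variable {F : Type} [Field F] {V : Type*} [AddCommGroup V] [Module F V] [FiniteDimensional F V]

theorem dep {k : ℕ} (f : Fin k → V) (h : Module.finrank F V < k) : ∃ a : Fin k → F, ∑ i, a i • f i = 0 ∧ ∃ i, a i ≠ 0 := by
  apply Fintype.not_linearIndependent_iff.1
  intro hl
  have := hl.fintype_card_le_finrank
  rw [Fintype.card_fin] at this
  omega

theorem cyc_nil {N g : Module.End F V} {n : ℕ} (hN : N ^ n = 0) (hg : ∀ x, N (g x) = g (N x)) {w : V} (hw : N w = 0) (hk : ∀ x, N x = 0 → ∃ a : F, x = a • w) :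
    ∃ c : F, IsNilpotent (g - c • 1) := by
  obtain ⟨c, hc⟩ := hk (g w) (by rw [hg, hw, map_zero])
  refine ⟨c, n, ?_⟩
  have hpow : ∀ i x, (N ^ i) ((g - c • 1) x) = (g - c • 1) ((N ^ i) x) := by
    have hcm : Commute N (g - c • 1) := by
      apply Commute.sub_right
      · exact LinearMap.ext hg
      · exact (Commute.one_right N).smul_right c
    intro i x
    exact congrArg (fun T : Module.End F V => T x) (hcm.pow_left i).eq
  have h0 : ∀ x, N x = 0 → (g - c • 1) x = 0 := by
    intro x hx
    obtain ⟨a, rfl⟩ := hk x hx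
    simp [hc, smul_comm]
  have key : ∀ i x, (N ^ i) x = 0 → ((g - c • 1) ^ i) x = 0 := by
    intro i
    induction i with
    | zero => intro x hx; simpa using hx
    | succ i ih =>
      intro x hx
      rw [pow_succ, Module.End.mul_apply]
      apply ih
      rw [hpow]
      apply h0
      rw [← Module.End.mul_apply, ← pow_succ']
      exact hx
  ext x
  rw [key n x (by rw [hN]; rfl)]
  rfl

theorem cyc3 (hV : Module.finrank F V = 3) {N g : Module.End F V} (hN : ∀ x, N (N (N x)) = 0) (v : V) (hv : N (N v) ≠ 0) (hg : ∀ x, N (g x) = g (N x)) :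
    ∃ c : F, IsNilpotent (g - c • 1) := by
  refine cyc_nil (n := 3) (w := N (N v)) (by ext x; simpa [pow_succ] using hN x) hg (hN v) ?_
  intro x hx
  obtain ⟨a, ha, hi⟩ := dep (F := F) ![v, N v, N (N v), x] (by omega)
  simp only [Fin.sum_univ_four, Matrix.cons_val] at ha
  have h1 := congrArg N (congrArg N ha)
  simp only [map_add, map_smul, map_zero, hN, hx, smul_zero, add_zero] at h1
  have a0 : a 0 = 0 := (smul_eq_zero.1 h1).resolve_right hv
  rw [a0, zero_smul, zero_add] at ha
  have h2 := congrArg N ha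
  simp only [map_add, map_smul, map_zero, hN, hx, smul_zero, add_zero] at h2
  have a1 : a 1 = 0 := (smul_eq_zero.1 h2).resolve_right hv
  rw [a1, zero_smul, zero_add] at ha
  have a3 : a 3 ≠ 0 := by
    intro a3
    rw [a3, zero_smul, add_zero] at ha
    have a2 : a 2 = 0 := (smul_eq_zero.1 ha).resolve_right hv
    obtain ⟨i, hi⟩ := hi
    fin_cases i <;> simp_all
  refine ⟨-(a 3)⁻¹ * a 2, ?_⟩
  rw [mul_smul, eq_neg_of_add_eq_zero_left ha, smul_neg, neg_smul, neg_neg, smul_smul, inv_mul_cancel₀ a3, one_smul]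

theorem cyc4 (hV : Module.finrank F V = 4) {N g : Module.End F V} (hN : ∀ x, N (N (N (N x))) = 0) (v : V) (hv : N (N (N v)) ≠ 0) (hg : ∀ x, N (g x) = g (N x)) :
    ∃ c : F, IsNilpotent (g - c • 1) := by
  refine cyc_nil (n := 4) (w := N (N (N v))) (by ext x; simpa [pow_succ] using hN x) hg (hN v) ?_
  intro x hx
  obtain ⟨a, ha, hi⟩ := dep (F := F) ![v, N v, N (N v), N (N (N v)), x] (by omega)
  simp only [Fin.sum_univ_five, Matrix.cons_val] at ha
  have h1 := congrArg N (congrArg N (congrArg N ha))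
  simp only [map_add, map_smul, map_zero, hN, hx, smul_zero, add_zero] at h1
  have a0 : a 0 = 0 := (smul_eq_zero.1 h1).resolve_right hv
  rw [a0, zero_smul, zero_add] at ha
  have h2 := congrArg N (congrArg N ha)
  simp only [map_add, map_smul, map_zero, hN, hx, smul_zero, add_zero] at h2
  have a1 : a 1 = 0 := (smul_eq_zero.1 h2).resolve_right hv
  rw [a1, zero_smul, zero_add] at ha
  have h3 := congrArg N ha
  simp only [map_add, map_smul, map_zero, hN, hx, smul_zero, add_zero] at h3
  have a2 : a 2 = 0 := (smul_eq_zero.1 h3).resolve_right hv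
  rw [a2, zero_smul, zero_add] at ha
  have a4 : a 4 ≠ 0 := by
    intro a4
    rw [a4, zero_smul, add_zero] at ha
    have a3 : a 3 = 0 := (smul_eq_zero.1 ha).resolve_right hv
    obtain ⟨i, hi⟩ := hi
    fin_cases i <;> simp_all
  refine ⟨-(a 4)⁻¹ * a 3, ?_⟩
  rw [mul_smul, eq_neg_of_add_eq_zero_left ha, smul_neg, neg_smul, neg_neg, smul_smul, inv_mul_cancel₀ a4, one_smul]

theorem two_dep (hF : ∀ a : F, a = 0 ∨ a = 1) (h2 : (1 : F) + 1 = 0) {e w : V} (he : e ≠ 0) {a b : F} (h : a • e + b • w = 0) (hw0 : w ≠ 0) (hwe : w ≠ e) : a = 0 ∧ b = 0 := by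
  have hee : e + e = 0 := by rw [← one_smul F e, ← add_smul, h2, zero_smul]
  rcases hF a with rfl | rfl <;> rcases hF b with rfl | rfl <;> simp_all
  apply hwe
  rw [← add_right_inj e, h, hee]

theorem quad (hV : Module.finrank F V = 4) (hF : ∀ a : F, a = 0 ∨ a = 1) (h2 : (1 : F) + 1 = 0) {N g : Module.End F V} (hN : ∀ x, N (N (N x)) = 0) (v : V) (hv : N (N v) ≠ 0) (hg : ∀ x, N (g x) = g (N x)) (hinj : Function.Injective g) :
    ∃ c : F, IsNilpotent (g - c • 1) := by
  set e := N (N v) with hedef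
  have hNe : N e = 0 := hN v
  have hA : ∀ w, N (N w) = 0 ∨ N (N w) = e := by
    intro w
    by_contra hh
    push Not at hh
    obtain ⟨a, ha, i, hi⟩ := dep (F := F) ![v, N v, e, w, N w] (by omega)
    simp only [Fin.sum_univ_five, Matrix.cons_val] at ha
    have h1 := congrArg N (congrArg N ha)
    simp only [map_add, map_smul, map_zero, hN, hNe, smul_zero, add_zero, ← hedef] at h1
    obtain ⟨a0, a3⟩ := two_dep hF h2 hv h1 hh.1 hh.2
    rw [a0, a3] at ha
    have h3 := congrArg N ha
    simp only [map_add, map_smul, map_zero, hN, hNe, smul_zero, zero_smul, zero_add, add_zero, ← hedef] at h3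
    obtain ⟨a1, a4⟩ := two_dep hF h2 hv h3 hh.1 hh.2
    rw [a1, a4] at ha
    simp only [zero_smul, add_zero, zero_add] at ha
    have a2 : a 2 = 0 := (smul_eq_zero.1 ha).resolve_right hv
    fin_cases i <;> simp_all
  have hB : ∀ k, N (N k) = 0 → N k = 0 ∨ N k = e := by
    intro w hw
    by_contra hh
    push Not at hh
    obtain ⟨a, ha, i, hi⟩ := dep (F := F) ![v, N v, e, w, N w] (by omega)
    simp only [Fin.sum_univ_five, Matrix.cons_val] at ha
    have h1 := congrArg N (congrArg N ha)
    simp only [map_add, map_smul, map_zero, hN, hNe, hw, smul_zero, add_zero, ← hedef] at h1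
    have a0 : a 0 = 0 := (smul_eq_zero.1 h1).resolve_right hv
    rw [a0] at ha
    have h3 := congrArg N ha
    simp only [map_add, map_smul, map_zero, hN, hNe, hw, smul_zero, zero_smul, zero_add, add_zero, ← hedef] at h3
    obtain ⟨a1, a3⟩ := two_dep hF h2 hv h3 hh.1 hh.2
    rw [a1, a3] at ha
    simp only [zero_smul, add_zero, zero_add] at ha
    obtain ⟨a2, a4⟩ := two_dep hF h2 hv ha hh.1 hh.2
    fin_cases i <;> simp_all
  have hge : g e = e := by
    have h3 := hA (g v)
    rw [hg, hg, ← hedef] at h3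
    refine h3.resolve_left (fun h0 => hv (hinj ?_))
    rw [h0, map_zero]
  have hxx : ∀ x : V, x + x = 0 := fun x => by rw [← one_smul F x, ← add_smul, h2, zero_smul]
  have hC : ∀ x, N x = 0 → g x - x = 0 ∨ g x - x = e := by
    intro x hx
    by_cases hx0 : x = 0
    · left; rw [hx0, map_zero, sub_zero]
    by_cases hxe : x = e
    · left; rw [hxe, hge, sub_self]
    have hgx : N (g x) = 0 := by rw [hg, hx, map_zero]
    have hg0 : g x ≠ 0 := fun h => hx0 (hinj (by rw [h, map_zero]))
    have hgxe : g x ≠ e := fun h => hxe (hinj (by rw [h, hge]))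
    obtain ⟨a, ha, i, hi⟩ := dep (F := F) ![v, N v, e, x, g x] (by omega)
    simp only [Fin.sum_univ_five, Matrix.cons_val] at ha
    have h1 := congrArg N (congrArg N ha)
    simp only [map_add, map_smul, map_zero, hN, hNe, hx, hgx, smul_zero, add_zero, ← hedef] at h1
    have a0 : a 0 = 0 := (smul_eq_zero.1 h1).resolve_right hv
    rw [a0] at ha
    have h3 := congrArg N ha
    simp only [map_add, map_smul, map_zero, hN, hNe, hx, hgx, smul_zero, zero_smul, zero_add, add_zero, ← hedef] at h3
    have a1 : a 1 = 0 := (smul_eq_zero.1 h3).resolve_right hv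
    rw [a1] at ha
    simp only [zero_smul, add_zero, zero_add] at ha
    have a4 : a 4 = 1 := by
      refine (hF _).resolve_left (fun a4 => ?_)
      rw [a4, zero_smul, add_zero] at ha
      obtain ⟨a2, a3⟩ := two_dep hF h2 hv ha hx0 hxe
      fin_cases i <;> simp_all
    have a3 : a 3 = 1 := by
      refine (hF _).resolve_left (fun a3 => ?_)
      rw [a3, zero_smul, add_zero] at ha
      have := (two_dep hF h2 hv ha hg0 hgxe).2
      rw [a4] at this
      exact one_ne_zero this
    rw [a3, a4, one_smul, one_smul] at ha
    have hs : g x - x = x + g x := by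
      rw [sub_eq_iff_eq_add, add_right_comm, hxx, zero_add]
    rw [hs]
    rcases hF (a 2) with h | h <;> rw [h] at ha
    · left; simpa using ha
    · right
      rw [one_smul, add_assoc] at ha
      rw [← add_right_inj e, ha, hxx]
  refine ⟨1, 4, ?_⟩
  have hap : ∀ x, (g - (1:F) • (1 : Module.End F V)) x = g x - x := fun x => by simp
  ext x
  change ((g - (1:F) • (1 : Module.End F V)) ^ 4) x = 0
  simp only [pow_succ, pow_zero, one_mul, Module.End.mul_apply]
  simp only [hap]
  have s1 : N (N (g x - x)) = 0 := by
    rw [map_sub, map_sub, hg, hg]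
    rcases hA x with h | h <;> rw [h]
    · simp
    · rw [hge, sub_self]
  set x1 := g x - x
  have s2 : N (g x1 - x1) = 0 := by
    rw [map_sub, hg]
    rcases hB x1 s1 with h | h <;> rw [h]
    · simp
    · rw [hge, sub_self]
  set x2 := g x1 - x1
  rcases hC x2 s2 with h | h <;> rw [h]
  · simp
  · rw [hge, sub_self]

variable (p : ℕ) [Fact p.Prime] [CharP F p] [Fintype F] {m : ℕ}

theorem cent_p (hexc : (m = 1 ∧ Fintype.card F = 2) ∨ (m = 1 ∧ Fintype.card F = 4) ∨ (m = 2 ∧ Fintype.card F = 2) ∨ (m = 2 ∧ Fintype.card F = 3))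
    {y : SL (m+2) F} {j : ℕ} (hy : y ^ p ^ j = 1) (hyp : y ^ p ≠ 1) (s : PS (m+2) F) (hs : s * QuotientGroup.mk y = QuotientGroup.mk y * s) : ∃ k, s ^ p ^ k = 1 := by
  have hp : p.Prime := Fact.out
  have : CharP (Matrix (Fin (m+2)) (Fin (m+2)) F) p := Matrix.charP p
  obtain ⟨g, rfl⟩ := QuotientGroup.mk_surjective s
  have hgy := comm_exact hy hs
  set ν := mt y - 1 with hν
  have hνp : ν ^ p ≠ 0 := by
    have := pow_sub_one (p := p) (mt y) 1
    rw [pow_one] at this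
    rw [hν, this, sub_ne_zero]
    intro h
    apply hyp
    apply mt_inj
    rw [map_pow, h, map_one]
  have hνn : ν ^ (m+2) = 0 := by
    apply nil_pow (k := p ^ j)
    rw [hν, pow_sub_one, ← map_pow, hy, map_one, sub_self]
  have hcm : ν * mt g = mt g * ν := by
    rw [hν, sub_mul, mul_sub, ← map_mul, ← map_mul, hgy, one_mul, mul_one]
  have hpc : p ∣ Fintype.card F := by
    obtain ⟨f, -, hf⟩ := FiniteField.card F p
    rw [hf]; exact dvd_pow_self _ f.2.ne'
  let Φ := Matrix.toLinAlgEquiv' (R := F) (n := Fin (m+2))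
  have hfr : Module.finrank F (Fin (m+2) → F) = m + 2 := by simp
  have hΦc : ∀ x, Φ ν (Φ (mt g) x) = Φ (mt g) (Φ ν x) := by
    intro x
    have := congrArg (fun M => Φ M x) hcm
    simp only [map_mul] at this
    exact this
  have hex : ∀ k, ν ^ k ≠ 0 → ∃ v, ((Φ ν) ^ k) v ≠ 0 := by
    intro k hk
    by_contra hh
    push Not at hh
    apply hk
    apply Φ.injective
    rw [map_pow, map_zero]
    exact LinearMap.ext hh
  have hall : ∀ k, ν ^ k = 0 → ∀ x, ((Φ ν) ^ k) x = 0 := by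
    intro k hk x
    rw [← map_pow, hk, map_zero]; rfl
  have hnil : ∃ c : F, IsNilpotent (Φ (mt g) - c • 1) := by
    have hginj : Function.Injective (Φ (mt g)) := by
      intro a b hab
      have h1 := congrArg (Φ (mt g⁻¹)) hab
      rw [← Module.End.mul_apply, ← Module.End.mul_apply, ← map_mul, ← map_mul, inv_mul_cancel, map_one, map_one] at h1
      exact h1
    have hp2 : ∀ q, Fintype.card F = q → p ∣ q := fun q h => h ▸ hpc
    have c3 : m = 1 → p = 2 → ∃ c : F, IsNilpotent (Φ (mt g) - c • 1) := by
      intro hm hp2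
      subst hp2
      subst hm
      obtain ⟨v, hv⟩ := hex 2 hνp
      have h3 := hall 3 hνn
      simp only [pow_succ, pow_zero, one_mul, Module.End.mul_apply] at hv h3
      exact cyc3 hfr h3 v hv hΦc
    have c4 : m = 2 → ν ^ 3 ≠ 0 → ∃ c : F, IsNilpotent (Φ (mt g) - c • 1) := by
      intro hm h3
      subst hm
      obtain ⟨v, hv⟩ := hex 3 h3
      have h3 := hall 4 hνn
      simp only [pow_succ, pow_zero, one_mul, Module.End.mul_apply] at hv h3
      exact cyc4 hfr h3 v hv hΦc
    rcases hexc with ⟨hm, hq⟩ | ⟨hm, hq⟩ | ⟨hm, hq⟩ | ⟨hm, hq⟩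
    · exact c3 hm ((Nat.prime_dvd_prime_iff_eq hp Nat.prime_two).1 (hp2 _ hq))
    · exact c3 hm ((Nat.prime_dvd_prime_iff_eq hp Nat.prime_two).1 (hp.dvd_of_dvd_pow (show p ∣ 2 ^ 2 from hp2 _ hq)))
    · have hp2 := (Nat.prime_dvd_prime_iff_eq hp Nat.prime_two).1 (hp2 _ hq)
      by_cases h3 : ν ^ 3 = 0
      · subst hp2
        subst hm
        obtain ⟨v, hv⟩ := hex 2 hνp
        have h3 := hall 3 h3
        simp only [pow_succ, pow_zero, one_mul, Module.End.mul_apply] at hv h3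
        refine quad hfr ?_ ?_ h3 v hv hΦc hginj
        · intro a
          by_cases ha : a = 0
          · left; exact ha
          · right
            have := FiniteField.pow_card_sub_one_eq_one a ha
            rwa [hq, pow_one] at this
        · have := CharP.cast_eq_zero F 2
          push_cast at this
          rw [one_add_one_eq_two]; exact this
      · exact c4 hm h3
    · have hp3 := (Nat.prime_dvd_prime_iff_eq hp Nat.prime_three).1 (hp2 _ hq)
      subst hp3
      exact c4 hm hνp
  obtain ⟨c, k, hk⟩ := hnil
  have hk2 : (mt g - c • 1) ^ k = 0 := by
    apply Φ.injective
    rw [map_pow, map_sub, map_smul, map_one, hk, map_zero]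
  refine ⟨k, ?_⟩
  have hk3 : (mt g - c • 1) ^ p ^ k = 0 := pow_eq_zero_of_le (Nat.lt_pow_self hp.one_lt).le hk2
  rw [sub_pow_char_pow_of_commute p _ ((Commute.one_right (mt g)).smul_right c), smul_pow, one_pow, sub_eq_zero, ← map_pow] at hk3
  rw [← QuotientGroup.mk_pow, QuotientGroup.eq_one_iff]
  refine mt_center.2 ⟨c ^ p ^ k, ?_, hk3⟩
  have := congrArg Matrix.det hk3
  rw [mt_det, Matrix.det_smul, Matrix.det_one, mul_one, Fintype.card_fin] at this
  exact this.symm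

end D6
end PX

namespace PX
section E1
open MonoidAlgebra
open scoped Classical

variable {G : Type*} [Group G] [Fintype G] {p : ℕ} [Fact p.Prime]

theorem not_integral {a b : ℕ} (hb : b ≠ 0) (h : IsIntegral ℤ ((a : ℂ) / b)) : b ∣ a := by
  have h5 : IsIntegral ℤ ((a : ℚ) / b) := by
    rw [← isIntegral_algebraMap_iff (B := ℂ) (FaithfulSMul.algebraMap_injective ℚ ℂ)]
    simpa using h
  obtain ⟨k, hk⟩ := IsIntegrallyClosed.isIntegral_iff.1 h5
  have hb' : (b : ℚ) ≠ 0 := by exact_mod_cast hb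
  rw [eq_div_iff hb'] at hk
  change (k : ℚ) * b = a at hk
  have : k * b = a := by exact_mod_cast hk
  exact Int.natCast_dvd_natCast.1 ⟨k, by rw [← this, mul_comm]⟩

theorem nat_integral (a : ℕ) : IsIntegral ℤ (a : ℂ) := by
  have := isIntegral_algebraMap (R := ℤ) (A := ℂ) (x := (a : ℤ))
  simpa using this

theorem mem_sylow (U : Sylow p G) {x : G} (hx : x ∈ Subgroup.centralizer ((U : Subgroup G) : Set G)) (hp : ∃ k, x ^ p ^ k = 1) : x ∈ (U : Subgroup G) := by
  have hz := zpowers_pgroup hp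
  have hn : Subgroup.zpowers x ≤ Subgroup.normalizer ((U : Subgroup G) : Set G) := by
    rw [Subgroup.zpowers_le]
    exact Subgroup.centralizer_le_normalizer _ hx
  have h1 : IsPGroup p ↥((U : Subgroup G) ⊔ Subgroup.zpowers x) := IsPGroup.to_sup_of_normal_left' U.2 hz hn
  have h2 := U.3 h1 le_sup_left
  rw [← h2]
  exact (le_sup_right : Subgroup.zpowers x ≤ _) (Subgroup.mem_zpowers x)

theorem nil_single {k : Type*} [CommRing k] [CharP k p] {x : G} (hp : ∃ j, x ^ p ^ j = 1) : IsNilpotent (single x (1:k) - 1 : MonoidAlgebra k G) := by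
  obtain ⟨j, hj⟩ := hp
  have : CharP (MonoidAlgebra k G) p := charP_of_injective_algebraMap (R := k) (A := MonoidAlgebra k G) (by
    intro a b h
    have := congrArg (fun f => coeff f 1) h
    simpa [MonoidAlgebra.algebraMap_def] using this) p
  refine ⟨p ^ j, ?_⟩
  rw [sub_pow_char_pow_of_commute p _ (Commute.one_right _), single_pow, hj, one_pow, one_pow, one_def, sub_self]

theorem br_nil (U : Sylow p G) (A : MonoidAlgebra (ZMod p) G) (hA : IsCl A)
    (hs : ∀ x, coeff A x ≠ 0 → ∃ k, x ^ p ^ k = 1) :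
    IsNilpotent (br (U : Subgroup G) (A - (∑ x, coeff A x) • 1)) := by
  have h1 : ∑ x, coeff A x = ∑ x ∈ Finset.univ.filter (fun g => g ∈ Subgroup.centralizer ((U : Subgroup G) : Set G)), coeff A x := by
    rw [psum U.2 (cj (U : Subgroup G)) (fun m => zmod_nsmul m) (fun x => coeff A x) (fun u x => hA _ _)]
    refine Finset.sum_congr ?_ (fun _ _ => rfl)
    ext x
    simp only [Finset.mem_filter, Finset.mem_univ, true_and]
    exact cj_fixed _ x
  rw [br_sub, br_smul, br_one, h1, br, Finset.sum_smul, ← Finset.sum_sub_distrib]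
  have h2 : ∀ x, single x (coeff A x) - coeff A x • (1 : MonoidAlgebra (ZMod p) G) = coeff A x • (single x 1 - 1) := by
    intro x
    rw [smul_sub, smul_single, smul_eq_mul, mul_one]
  simp only [h2]
  refine Commute.isNilpotent_sum ?_ ?_
  · intro x _
    by_cases hx : coeff A x = 0
    · rw [hx, zero_smul]; exact IsNilpotent.zero
    · exact (nil_single (hs x hx)).smul _
  · intro x y hx hy
    by_cases hx0 : coeff A x = 0
    · rw [hx0, zero_smul]; exact Commute.zero_left _
    have hxU := mem_sylow U (Finset.mem_filter.1 hx).2 (hs x hx0)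
    have hxy := Subgroup.mem_centralizer_iff.1 (Finset.mem_filter.1 hy).2 x hxU
    refine Commute.smul_left (Commute.smul_right ?_ _) _
    refine Commute.sub_left (Commute.sub_right ?_ (Commute.one_right _)) (Commute.one_left _)
    change _ * _ = _ * _
    rw [single_mul_single, single_mul_single, hxy]

/-- conjugacy class -/
noncomputable def KK (g : G) : Finset G := Finset.univ.image (fun l : (⊤ : Subgroup G) => (l : G) * g * (l : G)⁻¹)

theorem mem_KK {g x : G} : x ∈ KK g ↔ ∃ l, l * g * l⁻¹ = x := by
  simp [KK]

theorem KK_conj {g x : G} (y : G) : y * x * y⁻¹ ∈ KK g ↔ x ∈ KK g := by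
  rw [mem_KK, mem_KK]
  constructor
  · rintro ⟨l, hl⟩
    refine ⟨y⁻¹ * l, ?_⟩
    calc y⁻¹ * l * g * (y⁻¹ * l)⁻¹ = y⁻¹ * (l * g * l⁻¹) * y := by group
      _ = x := by rw [hl]; group
  · rintro ⟨l, hl⟩
    exact ⟨y * l, by rw [← hl]; group⟩

theorem caseA {d : ℕ} (hd : d ≠ 0) {ρ : G →* Matrix (Fin d) (Fin d) ℂ} (hS : ScalarComm ⊤ ρ) (hinj : Function.Injective ρ) (hB : HB p G)
    (s : ℕ) (hs : Nat.card G = Nat.card (Subgroup.center G) * s) (hb : d.factorization p < s.factorization p)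
    (U : Sylow p G) {g : G} (hg : g ∈ Subgroup.centralizer ((U : Subgroup G) : Set G)) (hgp : ∃ k, g ^ p ^ k = 1) :
    p ^ (2 * d.factorization p) * Nat.card (Subgroup.center G) ≤ cc ⊤ g := by
  have hp : p.Prime := Fact.out
  have hd' : (d : ℂ) ≠ 0 := by exact_mod_cast hd
  have hp' : (p : ℂ) ≠ 0 := by exact_mod_cast hp.ne_zero
  have : Nonempty (Fin d) := ⟨⟨0, Nat.pos_of_ne_zero hd⟩⟩
  have hcard : Nat.card (⊤ : Subgroup G) = Nat.card G := Subgroup.card_top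
  have hKc : Nat.card G = cc ⊤ g * (KK g).card := by
    rw [← hcard]; exact card_conj ⊤ g
  have hKcop : Nat.Coprime (KK g).card p := by
    rw [Nat.coprime_comm, hp.coprime_iff_not_dvd]
    intro hdv
    have h1 : Nat.card (U : Subgroup G) ∣ cc ⊤ g := by
      apply Subgroup.card_dvd_of_le
      intro u hu
      refine ⟨Subgroup.mem_top _, Subgroup.mem_centralizer_singleton_iff.2 ?_⟩
      exact (Subgroup.mem_centralizer_iff.1 hg u hu)
    have h2 : Nat.card (U : Subgroup G) * p ∣ Nat.card G := by
      rw [hKc]; exact mul_dvd_mul h1 hdv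
    rw [Sylow.card_eq_multiplicity, ← pow_succ] at h2
    exact Nat.pow_succ_factorization_not_dvd Nat.card_pos.ne' hp h2
  -- class sum
  let a : MonoidAlgebra ℤ G := ∑ x ∈ KK g, single x 1
  have hac : ∀ x, coeff a x = if x ∈ KK g then 1 else 0 := by
    intro x
    simp only [a]
    rw [coeff_sum']
    simp [Finsupp.single_apply]
  have hacl : IsCl a := by
    intro y x
    rw [hac, hac]
    simp only [KK_conj]
  have hcm : ∀ A : Matrix (Fin d) (Fin d) ℂ, A = ∑ x ∈ KK g, ρ x → ∃ c : ℂ, A = c • 1 := by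
    rintro A rfl
    apply hS
    intro y _
    rw [Finset.mul_sum, Finset.sum_mul]
    refine Finset.sum_bij (fun x _ => y * x * y⁻¹) ?_ ?_ ?_ ?_
    · intro x hx; exact (KK_conj y).2 hx
    · intro x _ x' _ h; simpa using h
    · intro x hx
      refine ⟨y⁻¹ * x * y, ?_, by group⟩
      have := (KK_conj (g := g) (x := x) y⁻¹).2 hx
      rwa [inv_inv] at this
    · intro x _
      rw [← map_mul, ← map_mul]; congr 1; group
  obtain ⟨ω, hω⟩ := hcm _ rfl
  have htr : ((KK g).card : ℂ) * (ρ g).trace = ω * d := by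
    have h1 := congrArg Matrix.trace hω
    rw [Matrix.trace_sum, Matrix.trace_smul, Matrix.trace_one, Fintype.card_fin, smul_eq_mul] at h1
    rw [← h1, ← nsmul_eq_mul, ← Finset.sum_const]
    refine Finset.sum_congr rfl (fun x hx => ?_)
    obtain ⟨l, rfl⟩ := mem_KK.1 hx
    rw [map_mul, map_mul, Matrix.trace_mul_comm, ← mul_assoc, rho_inv_mul, one_mul]
  obtain ⟨N, γ, hγ, hN⟩ := block hd hS hB s hs hb a hacl (KK g).card (by
    intro U'
    have h1 : ∀ x, coeff (mapRingHom G (Int.castRingHom (ZMod p)) a) x = if x ∈ KK g then 1 else 0 := by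
      intro x
      have : coeff (mapRingHom G (Int.castRingHom (ZMod p)) a) x = (coeff a x : ZMod p) := by simp
      rw [this, hac]
      split_ifs <;> simp
    have h2 := br_nil U' (mapRingHom G (Int.castRingHom (ZMod p)) a) (by
      intro y x
      rw [h1, h1]
      simp only [KK_conj]) (by
      intro x hx
      rw [h1] at hx
      have hx' : x ∈ KK g := by
        by_contra h; rw [if_neg h] at hx; exact hx rfl
      obtain ⟨l, rfl⟩ := mem_KK.1 hx'
      obtain ⟨k, hk⟩ := hgp
      exact ⟨k, by rw [conj_pow, hk]; group⟩)
    have h3 : ∑ x, coeff (mapRingHom G (Int.castRingHom (ZMod p)) a) x = (((KK g).card : ℤ) : ZMod p) := by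
      simp only [h1]
      simp
    rw [h3] at h2
    exact h2) ω (by
      rw [← hω]
      simp only [hac]
      simp [Finset.sum_ite_mem])
  have hne : (ρ g).trace ≠ 0 := by
    intro h0
    rw [h0, mul_zero] at htr
    have hω0 : ω = 0 := (mul_eq_zero.1 htr.symm).resolve_right hd'
    rw [hω0, zero_sub] at hN
    have h5 : IsIntegral ℤ ((((KK g).card ^ N : ℕ) : ℂ) / p) := by
      have : (((KK g).card ^ N : ℕ) : ℂ) / p = (-1) ^ N * γ := by
        rw [div_eq_iff hp', mul_assoc, mul_comm γ, ← hN]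
        push_cast
        rw [← mul_pow]; ring
      rw [this]
      exact ((isIntegral_one.neg).pow N).mul hγ
    have h6 := not_integral hp.ne_zero h5
    have h7 := hp.dvd_of_dvd_pow h6
    exact (hp.coprime_iff_not_dvd.1 hKcop.symm) h7
  have hint : ∀ x, ((KK g).card : ℂ) * (ρ x).trace = (Nat.card G : ℂ) / cc ⊤ x * (ρ x).trace → ∃ γ : ℂ, IsIntegral ℤ γ ∧ (ρ x).trace = (p ^ d.factorization p : ℕ) * γ := by
    intro x hx
    have hω := omega_integral hd hS x
    rw [hcard] at hω
    refine bez (d' := (KK g).card) (hKcop.pow_right _) (chi_integral ρ x) (α := (d / p ^ d.factorization p : ℕ) * ((Nat.card G : ℂ) / cc ⊤ x * (ρ x).trace / d)) ?_ ?_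
    · exact (nat_integral _).mul hω
    · rw [hx, ← mul_assoc, ← Nat.cast_mul, Nat.ordProj_mul_ordCompl_eq_self, mul_div_cancel₀ _ hd']
  have hgeq : ∀ x : G, cc ⊤ x = cc ⊤ g → (Nat.card G : ℂ) / cc ⊤ x = (KK g).card := by
    intro x hx
    have : (cc ⊤ g : ℂ) ≠ 0 := by exact_mod_cast (cc_pos ⊤ g).ne'
    rw [hx, hKc]; push_cast
    rw [mul_div_cancel_left₀ _ this]
  have hcinv : cc ⊤ g⁻¹ = cc ⊤ g := by
    unfold cc
    have : Subgroup.centralizer {g⁻¹} = Subgroup.centralizer {g} := by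
      ext x
      rw [Subgroup.mem_centralizer_singleton_iff, Subgroup.mem_centralizer_singleton_iff]
      exact Commute.inv_right_iff (a := x) (b := g)
    rw [this]
  obtain ⟨γ1, hγ1, h1⟩ := hint g (by rw [hgeq g rfl])
  obtain ⟨γ2, hγ2, h2⟩ := hint g⁻¹ (by rw [hgeq _ hcinv])
  obtain ⟨j, hj, hjne, hjb⟩ := galois_bound (Nat.card_pos (α := G)) (ρ g) (rho_pow_card ρ g) 1 (p ^ (2 * d.factorization p)) (pow_pos hp.pos _) hne (by
    have h3 : (ρ g) ^ (Nat.card G - 1) = ρ g⁻¹ := by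
      rw [← map_pow]
      congr 1
      rw [eq_comm, inv_eq_iff_mul_eq_one, ← pow_succ', Nat.sub_add_cancel Nat.card_pos, pow_card_eq_one']
    rw [h3, h1, h2]
    have : (((p ^ d.factorization p : ℕ) : ℂ) * γ1 * ((p ^ d.factorization p : ℕ) * γ2)) ^ 1 / ((p ^ (2 * d.factorization p) : ℕ) : ℂ) = γ1 * γ2 := by
      have hpp : (p : ℂ) ^ d.factorization p ≠ 0 := pow_ne_zero _ hp'
      push_cast
      rw [two_mul, pow_add, pow_one]
      field_simp
    rw [this]
    exact hγ1.mul hγ2)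
  rw [← map_pow] at hjne hjb
  have h4 := chi_bound hd hS hinj le_top (g ^ j) hjne
  have h5 : cc ⊤ (g ^ j) ≤ cc ⊤ g := by
    obtain ⟨i, hi⟩ := exists_pow_eq_self_of_coprime (x := g) (n := j) (hj.coprime_dvd_right (orderOf_dvd_natCard g))
    apply Nat.le_of_dvd (cc_pos ⊤ g)
    apply Subgroup.card_dvd_of_le
    refine inf_le_inf_left _ ?_
    intro x hx
    rw [Subgroup.mem_centralizer_singleton_iff] at hx ⊢
    have : Commute x ((g ^ j) ^ i) := Commute.pow_right hx i
    rwa [hi] at this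
  have h6 : ((p ^ (2 * d.factorization p) : ℕ) : ℝ) * Nat.card (Subgroup.center G) ≤ cc ⊤ g := by
    calc _ ≤ ‖(ρ (g ^ j)).trace‖ ^ 2 * Nat.card (Subgroup.center G) := mul_le_mul_of_nonneg_right (by simpa using hjb) (Nat.cast_nonneg _)
      _ ≤ _ := h4.trans (by exact_mod_cast h5)
  exact_mod_cast h6

end E1
end PX

namespace PX
section E2
open MonoidAlgebra
open scoped Classical

theorem card_map_ker {G S : Type*} [Group G] [Group S] (φ : G →* S) (C : Subgroup G) (h : φ.ker ≤ C) :
    Nat.card C = Nat.card φ.ker * Nat.card (C.map φ) := by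
  have h1 := (φ.comp C.subtype).ker.card_mul_index
  rw [Subgroup.index_ker, MonoidHom.range_comp, Subgroup.range_subtype] at h1
  rw [← h1]
  congr 1
  exact Nat.card_congr (Subgroup.subgroupOfEquivOfLe h).toEquiv

section A
variable {G : Type*} [Group G] [Fintype G] {p : ℕ} [Fact p.Prime] {F : Type} [Field F] [Fintype F] [CharP F p] {m : ℕ}

theorem cent_conj {S : Type*} [Group S] [Finite S] (U U' : Sylow p S) {g : S} (hg : g ∈ Subgroup.centralizer ((U : Subgroup S) : Set S)) :
    ∃ x : S, x * g * x⁻¹ ∈ Subgroup.centralizer ((U' : Subgroup S) : Set S) := by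
  obtain ⟨x, rfl⟩ := MulAction.exists_smul_eq S U U'
  refine ⟨x, Subgroup.mem_centralizer_iff.2 ?_⟩
  rintro _ ⟨u, hu, rfl⟩
  have := Subgroup.mem_centralizer_iff.1 hg u hu
  change x * u * x⁻¹ * (x * g * x⁻¹) = x * g * x⁻¹ * (x * u * x⁻¹)
  calc x * u * x⁻¹ * (x * g * x⁻¹) = x * (u * g) * x⁻¹ := by group
    _ = _ := by rw [this]; group

theorem caseA_num {d : ℕ} (hd : d ≠ 0) {ρ : G →* Matrix (Fin d) (Fin d) ℂ} (hS : ScalarComm ⊤ ρ) (hinj : Function.Injective ρ)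
    (φ : G →* PS (m+2) F) (hφ : Function.Surjective φ) (hker : φ.ker = Subgroup.center G) (hm : 1 ≤ m)
    (s : ℕ) (hs : Nat.card G = Nat.card (Subgroup.center G) * s) (hb : d.factorization p < s.factorization p)
    (U : Sylow p G) {t : G} (ht : t ∈ Subgroup.centralizer ((U : Subgroup G) : Set G)) (htz : t ∉ Subgroup.center G) :
    p ^ (2 * d.factorization p) < Fintype.card F ^ ((m+1)^2) := by
  have hp : p.Prime := Fact.out
  have hB : HB p G := HB_of_HS φ hφ hker HS_PS
  obtain ⟨U', hU'⟩ := sylow_lift p φ hφ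
  obtain ⟨x, hx⟩ := cent_conj U U' ht
  set t' := x * t * x⁻¹ with ht'
  have htz' : t' ∉ Subgroup.center G := by
    intro h
    apply htz
    have := (Subgroup.Normal.conj_mem (inferInstance : (Subgroup.center G).Normal) _ h x⁻¹)
    rw [ht'] at this
    convert this using 1; group
  have hcent : ∀ g ∈ Subgroup.centralizer ((U' : Subgroup G) : Set G), ∃ y : F, φ g = QuotientGroup.mk (E0 m y) := by
    intro g hg
    apply cent_UB p
    rw [← hU', Subgroup.mem_centralizer_iff]
    rintro _ ⟨u, hu, rfl⟩
    rw [← map_mul, ← map_mul, Subgroup.mem_centralizer_iff.1 hg u hu]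
  have hpow : ∀ g ∈ Subgroup.centralizer ((U' : Subgroup G) : Set G), g ^ p ∈ Subgroup.center G := by
    intro g hg
    obtain ⟨y, hy⟩ := hcent g hg
    rw [← hker, MonoidHom.mem_ker, map_pow, hy, ← QuotientGroup.mk_pow, EE_pow]; rfl
  -- make it a p-element
  set o := orderOf t' with ho
  have ho0 : o ≠ 0 := (orderOf_pos t').ne'
  set b := o / p ^ o.factorization p with hbdef
  have hbc : Nat.Coprime p b := Nat.coprime_ordCompl hp ho0
  set g := t' ^ b with hgdef
  have hgC : g ∈ Subgroup.centralizer ((U' : Subgroup G) : Set G) := Subgroup.pow_mem _ hx b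
  have hgp : ∃ k, g ^ p ^ k = 1 := by
    refine ⟨o.factorization p, ?_⟩
    rw [hgdef, ← pow_mul, mul_comm, Nat.ordProj_mul_ordCompl_eq_self, ho, pow_orderOf_eq_one]
  have hgz : g ∉ Subgroup.center G := by
    intro hg
    apply htz'
    have h1 := hpow t' hx
    rw [← QuotientGroup.eq_one_iff, QuotientGroup.mk_pow] at h1 hg
    rw [← QuotientGroup.eq_one_iff, ← orderOf_eq_one_iff]
    exact Nat.eq_one_of_dvd_coprimes hbc (orderOf_dvd_of_pow_eq_one h1) (orderOf_dvd_of_pow_eq_one hg)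
  have h1 := caseA hd hS hinj hB s hs hb U' hgC hgp
  obtain ⟨y, hy⟩ := hcent g hgC
  have hy0 : y ≠ 0 := by
    rintro rfl
    apply hgz
    rw [← hker, MonoidHom.mem_ker, hy]
    have : E0 m (0 : F) = 1 := by
      apply mt_inj
      rw [mt_EE, map_one, Matrix.single_zero, add_zero]
    rw [this]; rfl
  have h2 : cc ⊤ g ≤ Nat.card (Subgroup.center G) * Nat.card (Subgroup.centralizer {φ g}) := by
    unfold cc
    rw [top_inf_eq, ← hker, card_map_ker φ (Subgroup.centralizer {g}) (by rw [hker]; exact Subgroup.center_le_centralizer _)]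
    apply Nat.mul_le_mul_left
    apply Nat.le_of_dvd Nat.card_pos
    apply Subgroup.card_dvd_of_le
    rintro _ ⟨c, hc, rfl⟩
    rw [Subgroup.mem_centralizer_singleton_iff, ← map_mul, ← map_mul]
    congr 1
    exact Subgroup.mem_centralizer_singleton_iff.1 hc
  rw [hy] at h2
  have h3 := cent_bound p hm hy0
  have h4 : p ^ (2 * d.factorization p) ≤ Nat.card (Subgroup.centralizer {(QuotientGroup.mk (E0 m y) : PS (m+2) F)}) := by
    have := h1.trans h2
    rw [mul_comm] at this
    exact Nat.le_of_mul_le_mul_left this Nat.card_pos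
  exact h4.trans_lt h3
end A

section B
variable {H : Type*} [Group H] [Fintype H] {p : ℕ} [Fact p.Prime]

/-- class under a subgroup -/
noncomputable def KL (L : Subgroup H) (g : H) : Finset H := Finset.univ.image (fun l : L => (l : H) * g * (l : H)⁻¹)

theorem mem_KL {L : Subgroup H} {g x : H} : x ∈ KL L g ↔ ∃ l ∈ L, l * g * l⁻¹ = x := by
  simp [KL]

theorem KL_conj {L : Subgroup H} {g x : H} {y : H} (hy : y ∈ L) : y * x * y⁻¹ ∈ KL L g ↔ x ∈ KL L g := by
  rw [mem_KL, mem_KL]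
  constructor
  · rintro ⟨l, hl0, hl⟩
    refine ⟨y⁻¹ * l, L.mul_mem (L.inv_mem hy) hl0, ?_⟩
    calc y⁻¹ * l * g * (y⁻¹ * l)⁻¹ = y⁻¹ * (l * g * l⁻¹) * y := by group
      _ = x := by rw [hl]; group
  · rintro ⟨l, hl0, hl⟩
    exact ⟨y * l, L.mul_mem hy hl0, by rw [← hl]; group⟩

theorem KL_scalar {d : ℕ} {L : Subgroup H} {ρ : H →* Matrix (Fin d) (Fin d) ℂ} (hS : ScalarComm L ρ) (h : H)
    (f : H → H) (hf : ∀ y x, f (y * x * y⁻¹) = y * f x * y⁻¹) :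
    ∃ c : ℂ, ∑ x ∈ KL L h, ρ (f x) = c • 1 ∧ (KL L h).card * (ρ (f h)).trace = c * d := by
  have : ∃ c : ℂ, ∑ x ∈ KL L h, ρ (f x) = c • 1 := by
    apply hS
    intro y hy
    rw [Finset.mul_sum, Finset.sum_mul]
    refine Finset.sum_bij (fun x _ => y * x * y⁻¹) ?_ ?_ ?_ ?_
    · intro x hx; exact (KL_conj hy).2 hx
    · intro x _ x' _ h; simpa using h
    · intro x hx
      refine ⟨y⁻¹ * x * y, ?_, by group⟩
      have := (KL_conj (g := h) (x := x) (L.inv_mem hy)).2 hx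
      rwa [inv_inv] at this
    · intro x _
      rw [← map_mul, ← map_mul, hf]; congr 1; group
  obtain ⟨c, hc⟩ := this
  refine ⟨c, hc, ?_⟩
  have h1 := congrArg Matrix.trace hc
  rw [Matrix.trace_sum, Matrix.trace_smul, Matrix.trace_one, Fintype.card_fin, smul_eq_mul] at h1
  rw [← h1, ← nsmul_eq_mul, ← Finset.sum_const]
  refine Finset.sum_congr rfl (fun x hx => ?_)
  obtain ⟨l, _, rfl⟩ := mem_KL.1 hx
  rw [hf, map_mul, map_mul, Matrix.trace_mul_comm, ← mul_assoc, rho_inv_mul, one_mul]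

theorem caseB_block {d : ℕ} (hd : d ≠ 0) {L : Subgroup H} [L.Normal] {ρ : H →* Matrix (Fin d) (Fin d) ℂ} (hS : ScalarComm L ρ)
    (hinj : Function.Injective ρ)
    (hz : Subgroup.map L.subtype (Subgroup.center L) = Subgroup.center H) (hB : HB p L)
    (s : ℕ) (hs : Nat.card L = Nat.card (Subgroup.center L) * s) (hb : d.factorization p < s.factorization p)
    (hC : ∀ U : Sylow p L, Subgroup.centralizer ((U : Subgroup L) : Set L) ≤ Subgroup.center L) (h : H) (hne : (ρ h).trace ≠ 0)
    (hpK : p ∣ (KL L h).card) :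
    ∃ ω ω' : ℂ, (KL L h).card * (ρ h).trace = ω * d ∧ (KL L h).card * (ρ h⁻¹).trace = ω' * d ∧
     IsIntegral ℤ ω ∧ IsIntegral ℤ ω' ∧ ∃ N γ, IsIntegral ℤ γ ∧ (ω * ω') ^ N = p * γ := by
  obtain ⟨ω, hω, hωd⟩ := KL_scalar hS h id (fun _ _ => rfl)
  obtain ⟨ω', hω', hωd'⟩ := KL_scalar hS h (fun x => x⁻¹) (fun y x => by group)
  have hd' : (d : ℂ) ≠ 0 := by exact_mod_cast hd
  have hcc : (cc L h : ℂ) ≠ 0 := by exact_mod_cast (cc_pos L h).ne'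
  have hccn : Nat.card L = cc L h * (KL L h).card := card_conj L h
  have hcinv : cc L h⁻¹ = cc L h := by
    unfold cc
    have : Subgroup.centralizer {h⁻¹} = Subgroup.centralizer {h} := by
      ext x
      rw [Subgroup.mem_centralizer_singleton_iff, Subgroup.mem_centralizer_singleton_iff]
      exact Commute.inv_right_iff (a := x) (b := h)
    rw [this]
  refine ⟨ω, ω', hωd, hωd', ?_, ?_, ?_⟩
  · have := omega_integral hd hS h
    rw [hccn, Nat.cast_mul, mul_div_cancel_left₀ _ hcc] at this
    simp only [id] at hωd
    rwa [hωd, mul_div_cancel_right₀ _ hd'] at this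
  · have := omega_integral hd hS h⁻¹
    rw [hcinv, hccn, Nat.cast_mul, mul_div_cancel_left₀ _ hcc] at this
    rwa [hωd', mul_div_cancel_right₀ _ hd'] at this
  have hKL : ∀ x ∈ KL L h, ∀ y ∈ KL L h, x * y⁻¹ ∈ L := by
    intro x hx y hy
    obtain ⟨l, hl, rfl⟩ := mem_KL.1 hx
    obtain ⟨k, hk, rfl⟩ := mem_KL.1 hy
    have h1 : h * (l⁻¹ * k) * h⁻¹ ∈ L := Subgroup.Normal.conj_mem inferInstance _ (L.mul_mem (L.inv_mem hl) hk) h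
    have : l * h * l⁻¹ * (k * h * k⁻¹)⁻¹ = l * (h * (l⁻¹ * k) * h⁻¹) * k⁻¹ := by group
    rw [this]
    exact L.mul_mem (L.mul_mem hl h1) (L.inv_mem hk)
  let A : L → ℕ := fun u => ((KL L h).filter (fun y => (u : H) * y ∈ KL L h)).card
  let a : MonoidAlgebra ℤ L := ∑ u : L, single u (A u : ℤ)
  have hac : ∀ u, coeff a u = A u := by
    intro u
    simp only [a]
    rw [coeff_sum']
    simp [Finsupp.single_apply]
  have hacl : IsCl a := by
    intro x u
    rw [hac, hac]
    congr 1
    symm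
    refine Finset.card_bij (fun y _ => (x : H) * y * (x : H)⁻¹) ?_ ?_ ?_
    · intro y hy
      rw [Finset.mem_filter] at hy ⊢
      refine ⟨(KL_conj x.2).2 hy.1, ?_⟩
      have := (KL_conj (g := h) x.2).2 hy.2
      convert this using 1
      push_cast; group
    · intro y _ y' _ h; simpa using h
    · intro y hy
      rw [Finset.mem_filter] at hy
      refine ⟨(x : H)⁻¹ * y * (x : H), ?_, by group⟩
      have e1 : (x : H) * ((x : H)⁻¹ * y * x) * (x : H)⁻¹ = y := by group
      have e2 : (x : H) * (u * ((x : H)⁻¹ * y * x)) * (x : H)⁻¹ = ((x * u * x⁻¹ : L) : H) * y := by push_cast; group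
      rw [Finset.mem_filter]
      refine ⟨(KL_conj x.2).1 ?_, (KL_conj x.2).1 ?_⟩
      · rw [e1]; exact hy.1
      · rw [e2]; exact hy.2
  have hR : ∑ u : L, (coeff a u : ℂ) • ρ (u : H) = (ω * ω') • (1 : Matrix (Fin d) (Fin d) ℂ) := by
    have h1 : (ω * ω') • (1 : Matrix (Fin d) (Fin d) ℂ) = (∑ x ∈ KL L h, ρ x) * ∑ y ∈ KL L h, ρ y⁻¹ := by
      simp only [id] at hω
      rw [hω, hω', smul_mul_smul_comm, mul_one]
    rw [h1, Finset.sum_mul_sum, Finset.sum_comm]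
    have h2 : ∀ u : L, (coeff a u : ℂ) • ρ (u : H) = ∑ y ∈ KL L h, if (u : H) * y ∈ KL L h then ρ (u : H) else 0 := by
      intro u
      rw [hac, ← Finset.sum_filter, Finset.sum_const, ← Nat.cast_smul_eq_nsmul ℂ]
      simp [A]
    simp only [h2]
    rw [Finset.sum_comm]
    refine Finset.sum_congr rfl (fun y hy => ?_)
    rw [← Finset.sum_filter]
    refine Finset.sum_bij (fun u _ => (u : H) * y) ?_ ?_ ?_ ?_
    · intro u hu; exact (Finset.mem_filter.1 hu).2
    · intro u _ u' _ h; simpa using h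
    · intro x hx
      refine ⟨⟨x * y⁻¹, hKL x hx y hy⟩, ?_, ?_⟩
      · simp [hx]
      · simp
    · intro u _
      rw [← map_mul]; congr 1; group
  obtain ⟨N, γ, hγ, hN⟩ := block (G := L) (ρ := ρ.comp L.subtype) hd (fun B hB => hS.res B (fun g => hB g (Subgroup.mem_top g))) hB s hs hb a hacl 0 (by
    intro U
    refine ⟨1, ?_⟩
    rw [pow_one]
    ext u
    rw [coeff_br]
    simp only [Int.cast_zero, zero_smul, sub_zero]
    have : coeff (mapRingHom L (Int.castRingHom (ZMod p)) a) u = (coeff a u : ZMod p) := by simp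
    rw [this, hac]
    split_ifs with hu
    · have huz := hC U hu
      have huzH : (u : H) ∈ Subgroup.center H := by rw [← hz]; exact ⟨u, huz, rfl⟩
      by_cases hu1 : u = 1
      · subst hu1
        have : A 1 = (KL L h).card := by
          simp only [A, Subgroup.coe_one, one_mul]
          rw [Finset.filter_true_of_mem (fun _ hx => hx)]
        rw [this]
        simp [(ZMod.natCast_eq_zero_iff _ _).2 hpK]
      · have : A u = 0 := by
          rw [Finset.card_eq_zero, Finset.filter_eq_empty_iff]
          intro y hy huy
          apply hu1
          obtain ⟨l, hl, rfl⟩ := mem_KL.1 hy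
          obtain ⟨k, hk, hk'⟩ := mem_KL.1 huy
          have hzz := Subgroup.mem_center_iff.1 huzH
          apply Subtype.ext
          refine conj_center hd hS hinj (g := h) (x := l⁻¹ * k) huzH hne ?_
          calc l⁻¹ * k * h * (l⁻¹ * k)⁻¹ = l⁻¹ * (k * h * k⁻¹) * l := by group
            _ = l⁻¹ * (u * l) * h := by rw [hk']; group
            _ = u * h := by rw [← hzz l]; group
            _ = h * u := (hzz h).symm
        rw [this]
        simp
    · simp) (ω * ω') hR
  refine ⟨N, γ, hγ, ?_⟩
  simpa using hN

theorem caseB {d : ℕ} (hd : d ≠ 0) {L : Subgroup H} [L.Normal] {ρ : H →* Matrix (Fin d) (Fin d) ℂ} (hS : ScalarComm L ρ)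
    (hinj : Function.Injective ρ)
    (hz : Subgroup.map L.subtype (Subgroup.center L) = Subgroup.center H) (hB : HB p L)
    (s : ℕ) (hs : Nat.card L = Nat.card (Subgroup.center L) * s) (hb : s.factorization p = d.factorization p + 1)
    (hC : ∀ U : Sylow p L, Subgroup.centralizer ((U : Subgroup L) : Set L) ≤ Subgroup.center L) (h : H) (hne : (ρ h).trace ≠ 0)
    (c : ℕ) (hc : cc L h = Nat.card (Subgroup.center L) * p ^ (c + 2)) (hcs : c + 2 < s.factorization p) : False := by
  have hp : p.Prime := Fact.out
  have hd' : (d : ℂ) ≠ 0 := by exact_mod_cast hd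
  have hp' : (p : ℂ) ≠ 0 := by exact_mod_cast hp.ne_zero
  have hccn : Nat.card L = cc L h * (KL L h).card := card_conj L h
  have hsK : s = p ^ (c + 2) * (KL L h).card := by
    rw [hc, hs, mul_assoc] at hccn
    exact Nat.eq_of_mul_eq_mul_left Nat.card_pos hccn
  have hs0 : s ≠ 0 := by rintro rfl; simp at hb
  have hK0 : (KL L h).card ≠ 0 := by rintro h0; rw [h0, mul_zero] at hsK; exact hs0 hsK
  have hfK : s.factorization p = c + 2 + (KL L h).card.factorization p := by
    rw [hsK, Nat.factorization_mul (pow_ne_zero _ hp.ne_zero) hK0]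
    simp [hp.factorization_self]
  have hpK : p ∣ (KL L h).card := Nat.dvd_of_factorization_pos (by omega)
  obtain ⟨ω, ω', h1, h2, hω, hω', N, γ, hγ, hN⟩ := caseB_block hd hS hinj hz hB s hs (by omega) hC h hne hpK
  set k' := (KL L h).card / p ^ (KL L h).card.factorization p with hk'
  set d' := d / p ^ d.factorization p with hd''
  set e := (KL L h).card.factorization p with he
  have hkk : (KL L h).card = p ^ e * k' := (Nat.ordProj_mul_ordCompl_eq_self _ _).symm
  have hdd : d = p ^ (e + (c + 1)) * d' := by
    have : e + (c + 1) = d.factorization p := by omega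
    rw [this]; exact (Nat.ordProj_mul_ordCompl_eq_self _ _).symm
  have hk'c : Nat.Coprime k' p := (Nat.coprime_ordCompl hp hK0).symm
  have hred : ∀ χ ω : ℂ, (KL L h).card * χ = ω * d → (k' : ℂ) * χ = (p ^ (c + 1) : ℕ) * (d' * ω) := by
    intro χ ω hh
    have hpe : (p : ℂ) ^ e ≠ 0 := pow_ne_zero _ hp'
    apply mul_left_cancel₀ hpe
    have e1 : ((KL L h).card : ℂ) = p ^ e * k' := by
      rw [hkk]; push_cast; rfl
    have e2 : (d : ℂ) = p ^ (e + (c + 1)) * d' := by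
      rw [hdd]; push_cast; rfl
    rw [e1, e2] at hh
    rw [← mul_assoc, hh]; push_cast; ring
  have hr1 := hred _ _ h1
  have hr2 := hred _ _ h2
  obtain ⟨β, hβ, hb1⟩ := bez (hk'c.pow_right _) (chi_integral ρ h) ((nat_integral d').mul hω) hr1
  obtain ⟨β', hβ', hb2⟩ := bez (hk'c.pow_right _) (chi_integral ρ h⁻¹) ((nat_integral d').mul hω') hr2
  have hpc : ((p ^ (c + 1) : ℕ) : ℂ) ≠ 0 := by exact_mod_cast pow_ne_zero _ hp.ne_zero
  have hk1 : (k' : ℂ) * β = d' * ω := by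
    apply mul_left_cancel₀ hpc
    rw [← hr1, hb1]; ring
  have hk2 : (k' : ℂ) * β' = d' * ω' := by
    apply mul_left_cancel₀ hpc
    rw [← hr2, hb2]; ring
  obtain ⟨δ, hδ, hδe⟩ := bez (m := p) (d' := k' ^ (2 * N)) (hk'c.pow_left _) ((hβ.mul hβ').pow N) (α := (d' : ℂ) ^ (2 * N) * γ) (((nat_integral d').pow _).mul hγ) (by
    have : ((k' ^ (2 * N) : ℕ) : ℂ) * (β * β') ^ N = ((k' * β) * (k' * β')) ^ N := by
      push_cast; rw [pow_mul]; ring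
    rw [this, hk1, hk2]
    have : ((d' : ℂ) * ω * (d' * ω')) ^ N = d' ^ (2 * N) * (ω * ω') ^ N := by
      rw [pow_mul]; ring
    rw [this, hN]; ring)
  obtain ⟨j, hj, hjne, hjb⟩ := galois_bound (Nat.card_pos (α := H)) (ρ h) (rho_pow_card ρ h) N (p ^ (2 * (c + 1) * N + 1)) (pow_pos hp.pos _) hne (by
    have h3 : (ρ h) ^ (Nat.card H - 1) = ρ h⁻¹ := by
      rw [← map_pow]
      congr 1
      rw [eq_comm, inv_eq_iff_mul_eq_one, ← pow_succ', Nat.sub_add_cancel Nat.card_pos, pow_card_eq_one']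
    rw [h3, hb1, hb2]
    have : (((p ^ (c + 1) : ℕ) : ℂ) * β * ((p ^ (c + 1) : ℕ) * β')) ^ N / ((p ^ (2 * (c + 1) * N + 1) : ℕ) : ℂ) = δ := by
      have hpp : ((p ^ (2 * (c + 1) * N + 1) : ℕ) : ℂ) ≠ 0 := by exact_mod_cast pow_ne_zero _ hp.ne_zero
      rw [div_eq_iff hpp]
      have : (((p ^ (c + 1) : ℕ) : ℂ) * β * ((p ^ (c + 1) : ℕ) * β')) ^ N = (p ^ (2 * (c + 1) * N)) * (β * β') ^ N := by
        push_cast; rw [pow_mul, mul_comm 2, pow_mul]; ring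
      rw [this, hδe]; push_cast; ring
    rw [this]
    exact hδ)
  rw [← map_pow] at hjne hjb
  have hZL : Subgroup.center H ≤ L := by
    rw [← hz]; exact Subgroup.map_subtype_le _
  have h4 := chi_bound hd hS hinj hZL (h ^ j) hjne
  have h5 : cc L (h ^ j) ≤ cc L h := by
    obtain ⟨i, hi⟩ := exists_pow_eq_self_of_coprime (x := h) (n := j) (hj.coprime_dvd_right (orderOf_dvd_natCard h))
    apply Nat.le_of_dvd (cc_pos L h)
    apply Subgroup.card_dvd_of_le
    refine inf_le_inf_left _ ?_
    intro x hx
    rw [Subgroup.mem_centralizer_singleton_iff] at hx ⊢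
    have : Commute x ((h ^ j) ^ i) := Commute.pow_right hx i
    rwa [hi] at this
  have hcz : Nat.card (Subgroup.center H) = Nat.card (Subgroup.center L) := by
    rw [← hz]
    exact Nat.card_congr ((Subgroup.center L).equivMapOfInjective _ L.subtype_injective).symm.toEquiv
  have h6 : ‖(ρ (h ^ j)).trace‖ ^ 2 ≤ (p : ℝ) ^ (c + 2) := by
    have hzp : (0 : ℝ) < Nat.card (Subgroup.center H) := by exact_mod_cast Nat.card_pos
    have h7 : ‖(ρ (h ^ j)).trace‖ ^ 2 * Nat.card (Subgroup.center H) ≤ (p : ℝ) ^ (c + 2) * Nat.card (Subgroup.center H) := by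
      refine h4.trans ?_
      have : (cc L (h ^ j) : ℝ) ≤ cc L h := by exact_mod_cast h5
      refine this.trans ?_
      rw [hc, ← hcz]; push_cast; rw [mul_comm]
    exact le_of_mul_le_mul_right h7 hzp
  have h8 : ((p ^ (2 * (c + 1) * N + 1) : ℕ) : ℝ) ≤ (p : ℝ) ^ ((c + 2) * N) := by
    refine hjb.trans ?_
    rw [pow_mul, pow_mul]
    exact pow_le_pow_left₀ (by positivity) h6 N
  have h9 : p ^ (2 * (c + 1) * N + 1) ≤ p ^ ((c + 2) * N) := by exact_mod_cast h8
  have h10 := (Nat.pow_le_pow_iff_right hp.one_lt).1 h9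
  nlinarith

end B
end E2
end PX

namespace PX
section F
open scoped Classical

variable {F : Type} [Field F] [Fintype F] {m p : ℕ} [hpf : Fact p.Prime] [CharP F p]
variable {H : Type} [Group H]

theorem cc_val [Finite H] {L : Subgroup H}
    (hz : Subgroup.map L.subtype (Subgroup.center L) = Subgroup.center H)
    (φ : L →* PS (m+2) F) (hφ : Function.Surjective φ) (hker : φ.ker = Subgroup.center L)
    (hexc : (m = 1 ∧ Fintype.card F = 2) ∨ (m = 1 ∧ Fintype.card F = 4) ∨ (m = 2 ∧ Fintype.card F = 2) ∨ (m = 2 ∧ Fintype.card F = 3))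
    (h : H) (y : L) (hy : ∀ x : L, (x : H) * h = h * x → x * y = y * x) (hyh : (y : H) * h = h * y)
    (ho : orderOf (φ y) = p ^ 2) :
    ∃ c, cc L h = Nat.card (Subgroup.center L) * p ^ (c + 2) ∧ c + 2 < (Nat.card (PS (m+2) F)).factorization p := by
  have hp : p.Prime := Fact.out
  let C : Subgroup L := (Subgroup.centralizer {h}).subgroupOf L
  have hmemC : ∀ x : L, x ∈ C ↔ (x : H) * h = h * x := fun x => by
    rw [Subgroup.mem_subgroupOf, Subgroup.mem_centralizer_singleton_iff]
  have hcard : cc L h = Nat.card C := by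
    unfold cc
    rw [inf_comm, ← Subgroup.subgroupOf_map_subtype]
    exact (Nat.card_congr (Subgroup.equivMapOfInjective C L.subtype L.subtype_injective).toEquiv).symm
  have hkC : φ.ker ≤ C := by
    intro x hx
    rw [hker] at hx
    rw [hmemC]
    have : (x : H) ∈ Subgroup.center H := by rw [← hz]; exact ⟨x, hx, rfl⟩
    exact (Subgroup.mem_center_iff.1 this h).symm
  obtain ⟨u, hu, hup⟩ := lift_p (p := p) (s := φ y) (k := 2) (by rw [← ho]; exact pow_orderOf_eq_one _)
  have hyp1 : φ y ^ p ≠ 1 := by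
    intro hc
    have h1 := orderOf_dvd_of_pow_eq_one hc
    rw [ho] at h1
    have h2 := Nat.le_of_dvd hp.pos h1
    nlinarith [hp.two_le]
  have hup1 : u ^ p ≠ 1 := by
    intro hc
    apply hyp1
    rw [← hu, ← QuotientGroup.mk_pow, hc]; rfl
  have hcom : ∀ s ∈ C.map φ, s * φ y = φ y * s := by
    rintro _ ⟨x, hx, rfl⟩
    rw [← map_mul, ← map_mul, hy x ((hmemC x).1 hx)]
  have hpg : IsPGroup p (C.map φ) := by
    rintro ⟨s, hs⟩
    obtain ⟨k, hk⟩ := cent_p p hexc hup hup1 s (by rw [hu]; exact hcom s hs)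
    exact ⟨k, Subtype.ext hk⟩
  obtain ⟨c', hc'⟩ := IsPGroup.iff_card.1 hpg
  have hyC : φ y ∈ C.map φ := ⟨y, (hmemC y).2 hyh, rfl⟩
  have h2 : 2 ≤ c' := by
    have : orderOf (φ y) ∣ Nat.card (C.map φ) := by
      have := orderOf_dvd_natCard (⟨φ y, hyC⟩ : C.map φ)
      rwa [Subgroup.orderOf_mk] at this
    rw [ho, hc'] at this
    exact (Nat.pow_dvd_pow_iff_le_right hp.one_lt).1 this
  have hle : c' ≤ (Nat.card (PS (m+2) F)).factorization p := by
    have := Subgroup.card_subgroup_dvd_card (C.map φ)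
    rw [hc'] at this
    exact (hp.pow_dvd_iff_le_factorization Nat.card_pos.ne').1 this
  refine ⟨c' - 2, ?_, ?_⟩
  · rw [hcard, card_map_ker φ C hkC, hker, hc', Nat.sub_add_cancel h2]
  rw [Nat.sub_add_cancel h2]
  refine lt_of_le_of_ne hle (fun he => hyp1 ?_)
  let U : Sylow p (PS (m+2) F) := Sylow.ofCard (C.map φ) (by rw [hc', he])
  have hyU : φ y ∈ Subgroup.centralizer ((U : Subgroup (PS (m+2) F)) : Set (PS (m+2) F)) := by
    rw [Subgroup.mem_centralizer_iff]
    intro s hs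
    exact hcom s hs
  obtain ⟨x, hx⟩ := cent_conj U (US p (m+2) F) hyU
  rw [US_coe] at hx
  obtain ⟨a, ha⟩ := cent_UB p hx
  have h3 : (x * φ y * x⁻¹) ^ p = 1 := by
    rw [ha, ← QuotientGroup.mk_pow, E0, EE_pow]; rfl
  rw [conj_pow] at h3
  simpa using h3

theorem num1 {n q s a v : ℕ} (hp : p.Prime) (hq : p ≤ q) (h1 : p ^ v = q ^ (∑ i ∈ Finset.range (n+2), i))
    (h2 : p ^ (2 * a) < q ^ ((n+1)^2)) (hav : a ≤ v) (hs : p ^ s < n + 2) (hn : 1 ≤ n) : s + 1 ≤ v - a := by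
  obtain ⟨b, rfl⟩ := Nat.exists_eq_add_of_le hav
  have h3 : (∑ i ∈ Finset.range (n+2), i) * 2 = (n+2) * (n+1) := Finset.sum_range_id_mul_two (n+2)
  have hq0 : 0 < q := lt_of_lt_of_le hp.pos hq
  have h4 : p ^ (2 * a) * p ^ (2 * b) = q ^ ((n+1)^2) * q ^ (n+1) := by
    rw [← pow_add, ← mul_add, mul_comm 2, pow_mul, h1, ← pow_mul, h3, ← pow_add]
    congr 1; ring
  have h5 : q ^ (n+1) < p ^ (2 * b) := by
    by_contra hcon
    push Not at hcon
    have : p ^ (2 * a) * p ^ (2 * b) < q ^ ((n+1)^2) * q ^ (n+1) :=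
      Nat.mul_lt_mul_of_lt_of_le h2 hcon (pow_pos hq0 _)
    omega
  have h6 : p ^ (n+1) < p ^ (2 * b) := lt_of_le_of_lt (Nat.pow_le_pow_left hq _) h5
  have h7 : n + 1 < 2 * b := (Nat.pow_lt_pow_iff_right hp.one_lt).1 h6
  have h8 : 2 ^ s < n + 2 := lt_of_le_of_lt (Nat.pow_le_pow_left hp.two_le s) hs
  rw [Nat.add_sub_cancel_left]
  by_contra hcon
  push Not at hcon
  have h9 : 2 ^ s < 2 * s := by omega
  rcases s with _ | _ | _ | s
  · omega
  · omega
  · omega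
  · have : s + 3 ≤ 2 ^ (s+2) := by
      have := Nat.lt_two_pow_self (n := s + 2); omega
    rw [show s + 1 + 1 + 1 = (s + 2) + 1 by ring, pow_succ] at h9
    omega

theorem core [Fintype H] {d : ℕ} (hd : d ≠ 0) {L : Subgroup H} [L.Normal] {ρ : H →* Matrix (Fin d) (Fin d) ℂ}
    (hS : ScalarComm L ρ) (hinj : Function.Injective ρ)
    (hz : Subgroup.map L.subtype (Subgroup.center L) = Subgroup.center H)
    (φ : L →* PS (m+2) F) (hφ : Function.Surjective φ) (hker : φ.ker = Subgroup.center L)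
    (h : H) (hne : (ρ h).trace ≠ 0) :
    (orderOf (QuotientGroup.mk h : H ⧸ Subgroup.center H)).factorization p + d.factorization p ≤
      ((Subgroup.center H).index).factorization p := by
  have hp : p.Prime := Fact.out
  set s := Nat.card (PS (m+2) F) with hsdef
  have hs0 : s ≠ 0 := Nat.card_pos.ne'
  have hs : Nat.card L = Nat.card (Subgroup.center L) * s := by
    have := card_map_ker φ ⊤ le_top
    rw [Subgroup.card_top, ← MonoidHom.range_eq_map, MonoidHom.range_eq_top.2 hφ, Subgroup.card_top, hker] at this
    exact this
  have hzc : Nat.card (Subgroup.center L) = Nat.card (Subgroup.center H) := by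
    rw [← hz]
    exact Nat.card_congr (Subgroup.equivMapOfInjective _ L.subtype L.subtype_injective).toEquiv
  have hZL : Subgroup.center H ≤ L := by
    rw [← hz]; exact Subgroup.map_subtype_le _
  have hs' : Nat.card L = Nat.card (Subgroup.center H) * s := by rw [← hzc]; exact hs
  obtain ⟨t, hst⟩ := degree_dvd hd hS hZL s hs'
  have ht0 : t ≠ 0 := by rintro rfl; exact hs0 (by rw [hst, mul_zero])
  have hsf : s.factorization p = d.factorization p + t.factorization p := by
    rw [hst, Nat.factorization_mul hd ht0]; rfl
  have hidx : (Subgroup.center H).index = L.index * s := by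
    have h1 := (Subgroup.center H).card_mul_index
    have h2 := L.card_mul_index
    rw [hs', ← h1, mul_assoc, mul_comm s] at h2
    exact (Nat.eq_of_mul_eq_mul_left Nat.card_pos h2).symm
  have hL0 : L.index ≠ 0 := Subgroup.index_ne_zero_of_finite
  have hidf : ((Subgroup.center H).index).factorization p = L.index.factorization p + s.factorization p := by
    rw [hidx, Nat.factorization_mul hL0 hs0]; rfl
  set o := orderOf (QuotientGroup.mk h : H ⧸ Subgroup.center H) with ho
  have ho0 : o ≠ 0 := (orderOf_pos _).ne'
  rw [hidf, hsf]
  set k := o.factorization p with hk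
  set μ := L.index.factorization p with hμ
  suffices hmain : k - μ ≤ t.factorization p by omega
  by_cases hkμ : k ≤ μ
  · omega
  obtain ⟨e, he⟩ : ∃ e, k = μ + e + 1 := ⟨k - μ - 1, by omega⟩
  -- the auxiliary exponent
  have hoo : p ^ k * (o / p ^ k) = o := Nat.ordProj_mul_ordCompl_eq_self o p
  have hLL : p ^ μ * (L.index / p ^ μ) = L.index := Nat.ordProj_mul_ordCompl_eq_self _ p
  have ho1 : ¬ p ∣ o / p ^ k := Nat.not_dvd_ordCompl hp ho0
  have hL1 : ¬ p ∣ L.index / p ^ μ := Nat.not_dvd_ordCompl hp hL0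
  set o1 := o / p ^ k with ho1d
  set i1 := L.index / p ^ μ with hi1d
  have hoi : ¬ p ∣ o1 * i1 := fun hc => (hp.dvd_mul.1 hc).elim ho1 hL1
  have hpowZ : ∀ j, h ^ j ∈ Subgroup.center H ↔ o ∣ j := by
    intro j
    rw [ho, orderOf_dvd_iff_pow_eq_one, ← QuotientGroup.mk_pow, QuotientGroup.eq_one_iff]
  have hpowL : ∀ j, μ ≤ j → h ^ (o1 * i1 * p ^ j) ∈ L := by
    intro j hj
    obtain ⟨j', rfl⟩ := Nat.exists_eq_add_of_le hj
    have : o1 * i1 * p ^ (μ + j') = L.index * (o1 * p ^ j') := by rw [← hLL, pow_add]; ring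
    rw [this, pow_mul]
    exact L.pow_mem (Subgroup.pow_index_mem L h) _
  have hZ1 : ∀ j, h ^ (o1 * i1 * p ^ j) ∈ Subgroup.center H ↔ k ≤ j := by
    intro j
    rw [hpowZ, ← hoo]
    constructor
    · intro hc
      have h1 : p ^ k ∣ o1 * i1 * p ^ j := (Dvd.intro _ rfl).trans hc
      have h2 : (p ^ k).Coprime (o1 * i1) := ((Nat.Prime.coprime_iff_not_dvd hp).2 hoi).pow_left k
      exact (Nat.pow_dvd_pow_iff_le_right hp.one_lt).1 (h2.dvd_of_dvd_mul_left h1)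
    · intro hc
      rw [mul_comm (p ^ k)]
      exact mul_dvd_mul (Dvd.intro _ rfl) (pow_dvd_pow p hc)
  have hb : 1 ≤ t.factorization p := by
    by_contra hcon
    have ht : ¬ p ∣ t := fun hd' => hcon ((hp.dvd_iff_one_le_factorization ht0).1 hd')
    refine hne (defect_zero hd hS hZL hs' hst ht h (o1 * i1) (μ + e) hoi ?_ ?_ ?_)
    · rw [hZ1]; omega
    · exact hpowL _ (by omega)
    · rw [hZ1]; omega
  let y : L := ⟨h ^ (o1 * i1 * p ^ μ), hpowL μ le_rfl⟩
  have hcen : ∀ x : L, x ∈ Subgroup.center L ↔ (x : H) ∈ Subgroup.center H := by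
    intro x
    rw [← hz]
    constructor
    · intro hx; exact ⟨x, hx, rfl⟩
    · rintro ⟨x', hx', hxx⟩
      rwa [← Subtype.ext hxx]
  have hφy : ∀ j, φ y ^ p ^ j = 1 ↔ e + 1 ≤ j := by
    intro j
    rw [← map_pow, ← MonoidHom.mem_ker, hker, hcen]
    have : ((y ^ p ^ j : L) : H) = h ^ (o1 * i1 * p ^ (μ + j)) := by
      simp only [y, Subgroup.coe_pow]
      rw [← pow_mul, pow_add, mul_assoc (o1 * i1)]
    rw [this, hZ1]
    omega
  have hord : orderOf (φ y) = p ^ (e + 1) :=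
    orderOf_eq_prime_pow (fun hc => by have := (hφy e).1 hc; omega) ((hφy (e+1)).2 le_rfl)
  have hbound := order_bound (p := p) (e := e + 1) (by omega) hord
  rw [Nat.add_sub_cancel] at hbound
  have hke : k - μ = e + 1 := by omega
  rw [hke]
  have hpe : 2 ^ e < m + 2 := lt_of_le_of_lt (Nat.pow_le_pow_left hp.two_le e) hbound
  by_cases hm : 1 ≤ m
  swap
  · have : m = 0 := by omega
    subst this
    have : e = 0 := by
      by_contra h0
      have := Nat.pow_le_pow_right (n := 2) (by norm_num) (Nat.one_le_iff_ne_zero.2 h0)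
      omega
    omega
  by_cases hA : ∃ U : Sylow p L, ∃ t, t ∈ Subgroup.centralizer ((U : Subgroup L) : Set L) ∧ t ∉ Subgroup.center L
  · obtain ⟨U, w, hw, hwz⟩ := hA
    have : Fintype L := Fintype.ofFinite L
    have hnum := caseA_num hd (ρ := ρ.comp L.subtype) (fun A hA => hS.res A (fun g => hA g trivial))
      (hinj.comp L.subtype_injective) φ hφ hker hm s hs (by omega) U hw hwz
    have hq : p ≤ Fintype.card F := by
      obtain ⟨n, _, hn⟩ := FiniteField.card F p
      rw [hn]
      exact Nat.le_self_pow n.ne_zero p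
    have := num1 hp hq (PS_val (n := m+2) (F := F)) hnum (by rw [← hsdef]; omega) hbound hm
    rw [← hsdef] at this
    omega
  · push Not at hA
    have hexc : (m = 1 ∧ Fintype.card F = 2) ∨ (m = 1 ∧ Fintype.card F = 4) ∨ (m = 2 ∧ Fintype.card F = 2) ∨ (m = 2 ∧ Fintype.card F = 3) := by
      by_contra hcon
      push Not at hcon
      obtain ⟨U, w, hw, hwz⟩ := nonexc (p := p) φ hφ hker hm (fun h => hcon.1 h.1 h.2) (fun h => hcon.2.1 h.1 h.2)
        (fun h => hcon.2.2.1 h.1 h.2) (fun h => hcon.2.2.2 h.1 h.2)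
      exact hwz (hA U w hw)
    have he1 : e ≤ 1 := by
      by_contra h0
      have := Nat.pow_le_pow_right (n := 2) (by norm_num) (show 2 ≤ e by omega)
      omega
    by_contra hcon
    have hee : e = 1 := by omega
    subst hee
    have hyh : (y : H) * h = h * y := (Commute.refl h).pow_left _
    obtain ⟨c, hc, hcs⟩ := cc_val hz φ hφ hker hexc h y
      (fun x hx => Subtype.ext ((show Commute (x : H) h from hx).pow_right _)) hyh hord
    exact caseB hd hS hinj hz (HB_of_HS φ hφ hker HS_PS) s hs (by omega) (fun U w hw => hA U w hw) h hne c hc hcs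

end F
end PX

/-- Let `p` be a prime, `F` a finite field of characteristic `p`, and
`n ≥ 2` with `(n, |F|) ∉ {(2,2), (2,3)}`. Let `H` be a finite group with `L = [H,H]`
quasi-simple, `Z(L) = Z(H)` and `L/Z(L) ≅ PSLₙ(F)`. Let `χ` be a faithful irreducible
complex character of `H` (afforded by `V`) and `h ∈ H` with `χ(h) ≠ 0` and `H = ⟨L, h⟩`.
Then `o(hZ(H))_p · χ(1)_p` divides `|H : Z(H)|_p` (where `m_p` denotes the `p`-part). -/
theorem conjecture24_for_PSL_defining_characteristic
    (p : ℕ) (hp : p.Prime) (F : Type) [Field F] [Fintype F] [CharP F p]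
    (n : ℕ) (hn : 2 ≤ n)
    (h22 : ¬(n = 2 ∧ Fintype.card F = 2)) (h23 : ¬(n = 2 ∧ Fintype.card F = 3))
    (H : Type) [Group H] [Finite H]
    (hqs : IsQuasisimple ↥(commutator H))
    (hz : Subgroup.map (commutator H).subtype (Subgroup.center ↥(commutator H)) =
      Subgroup.center H)
    (hiso : Nonempty ((↥(commutator H) ⧸ Subgroup.center ↥(commutator H)) ≃*
      (Matrix.SpecialLinearGroup (Fin n) F ⧸
        Subgroup.center (Matrix.SpecialLinearGroup (Fin n) F))))
    (V : FDRep ℂ H) (hV : CategoryTheory.Simple V) (hfaith : Function.Injective V.ρ)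
    (h : H) (hne : V.character h ≠ 0)
    (hgen : commutator H ⊔ Subgroup.zpowers h = ⊤) :
    p ^ (orderOf (QuotientGroup.mk h : H ⧸ Subgroup.center H)).factorization p *
        p ^ (Module.finrank ℂ V).factorization p ∣
      p ^ ((Subgroup.center H).index).factorization p := by
  classical
  have : Fintype H := Fintype.ofFinite H
  have : Fact p.Prime := ⟨hp⟩
  obtain ⟨m, rfl⟩ := Nat.exists_eq_add_of_le' hn
  obtain ⟨ρ, hinj, htr, hsc⟩ := PX.aux_matrix H V hV hfaith
  have hne' : (ρ h).trace ≠ 0 := by rw [htr]; exact hne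
  have hd : Module.finrank ℂ V ≠ 0 := by
    intro h0
    apply hne'
    have : IsEmpty (Fin (Module.finrank ℂ V)) := by rw [h0]; infer_instance
    simp [Matrix.trace]
  have hS : PX.ScalarComm (commutator H) ρ :=
    fun A hA => PX.comm_scalar hd ρ hsc (commutator H) h hgen hne' A hA
  obtain ⟨ψ⟩ := hiso
  let φ : ↥(commutator H) →* PX.PS (m+2) F := ψ.toMonoidHom.comp (QuotientGroup.mk' _)
  have hφ : Function.Surjective φ := ψ.surjective.comp (QuotientGroup.mk'_surjective _)
  have hker : φ.ker = Subgroup.center ↥(commutator H) := by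
    ext x
    rw [MonoidHom.mem_ker]
    change ψ (QuotientGroup.mk x) = 1 ↔ _
    rw [EmbeddingLike.map_eq_one_iff, QuotientGroup.eq_one_iff]
  rw [← pow_add]
  exact pow_dvd_pow p (PX.core hd hS hinj hz φ hφ hker h hne')
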